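/- arXiv:0710.2233 — 3 statements merged into one kernel-verified Lean document; each statement's English description precedes it below -/
import Mathlib

section
/- Let r ∈ ℂ satisfy r·(r+1)·(r²+r+1) ≠ 0. Then there exists at most one integer m > 1 such that 1 + r^m - (1 + r)^m = 0; that is, if m₁, m₂ > 1 are integers with 1 + r^{m₁} = (1+r)^{m₁} and 1 + r^{m₂} = (1+r)^{m₂}, then m₁ = m₂. -/
namespace Beukers

open NumberField

/-- A place of `K`: `θ = 1` archimedean, `θ = 0` ultrametric. -/
structure IsPl {K : Type*} [Field K] (v : K → ℝ) (θ : ℕ) : Prop where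
  mul : ∀ x y, v (x * y) = v x * v y
  one : v 1 = 1
  zero : v 0 = 0
  nonneg : ∀ x, 0 ≤ v x
  neg : ∀ x, v (-x) = v x
  add : (θ = 1 ∧ ∀ x y, v (x + y) ≤ v x + v y) ∨ (θ = 0 ∧ ∀ x y, v (x + y) ≤ max (v x) (v y))

/-- `x` is bounded by `C ^ θ * B`. -/
def Bd {K : Type*} (v : K → ℝ) (θ : ℕ) (x : K) (C : ℕ) (B : ℝ) : Prop :=
  v x ≤ (C : ℝ) ^ θ * B

section Pl
variable {K : Type*} [Field K] {v : K → ℝ} {θ : ℕ}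

theorem IsPl.pow (h : IsPl v θ) (x : K) (n : ℕ) : v (x ^ n) = v x ^ n := by
  induction n with
  | zero => simp [h.one]
  | succ n ih => rw [pow_succ, h.mul, ih, pow_succ]

theorem Bd.add (h : IsPl v θ) {x y : K} {C D : ℕ} {B : ℝ}
    (hx : Bd v θ x C B) (hy : Bd v θ y D B) : Bd v θ (x + y) (C + D) B := by
  unfold Bd at *
  rcases h.add with ⟨rfl, ha⟩ | ⟨rfl, ha⟩
  · have := ha x y
    push_cast
    simp only [pow_one] at *
    linarith
  · have := ha x y
    simp only [pow_zero, one_mul] at *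
    exact this.trans (max_le hx hy)

theorem Bd.neg (h : IsPl v θ) {x : K} {C : ℕ} {B : ℝ}
    (hx : Bd v θ x C B) : Bd v θ (-x) C B := by
  unfold Bd at *
  rwa [h.neg]

theorem Bd.sub (h : IsPl v θ) {x y : K} {C D : ℕ} {B : ℝ}
    (hx : Bd v θ x C B) (hy : Bd v θ y D B) : Bd v θ (x - y) (C + D) B := by
  rw [sub_eq_add_neg]
  exact hx.add h (hy.neg h)

theorem Bd.mul (h : IsPl v θ) {x y : K} {C D : ℕ} {B B' : ℝ}
    (hx : Bd v θ x C B) (hy : Bd v θ y D B') : Bd v θ (x * y) (C * D) (B * B') := by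
  unfold Bd at *
  rw [h.mul]
  push_cast
  calc v x * v y ≤ ((C : ℝ) ^ θ * B) * ((D : ℝ) ^ θ * B') :=
        mul_le_mul hx hy (h.nonneg _) ((h.nonneg _).trans hx)
    _ = _ := by ring

theorem Bd.natCast (h : IsPl v θ) (n : ℕ) : Bd v θ (n : K) n 1 := by
  induction n with
  | zero => simp [Bd, h.zero]
  | succ n ih =>
    push_cast
    refine Bd.add h ih ?_
    simp [Bd, h.one]

theorem Bd.pow (h : IsPl v θ) {x : K} {C : ℕ} {B : ℝ}
    (hx : Bd v θ x C B) (n : ℕ) : Bd v θ (x ^ n) (C ^ n) (B ^ n) := by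
  induction n with
  | zero => simp [Bd, h.one]
  | succ n ih => rw [pow_succ, pow_succ, pow_succ]; exact ih.mul h hx

theorem Bd.mono {x : K} {C D : ℕ} {B B' : ℝ} (hx : Bd v θ x C B) (hC : C ≤ D) (hB : B ≤ B')
    (hB0 : 0 ≤ B') : Bd v θ x D B' := by
  unfold Bd at *
  refine hx.trans ?_
  have : (C : ℝ) ≤ D := by exact_mod_cast hC
  calc (C : ℝ) ^ θ * B ≤ (C : ℝ) ^ θ * B' := by gcongr
    _ ≤ _ := by gcongr

theorem Bd.sum (h : IsPl v θ) {ι : Type*} (s : Finset ι) (f : ι → K) (c : ι → ℕ) {B : ℝ}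
    (hB : 0 ≤ B) (hf : ∀ i ∈ s, Bd v θ (f i) (c i) B) : Bd v θ (∑ i ∈ s, f i) (∑ i ∈ s, c i) B := by
  classical
  induction s using Finset.induction_on with
  | empty => simp [Bd, h.zero]; positivity
  | insert a s ha ih =>
    rw [Finset.sum_insert ha, Finset.sum_insert ha]
    exact Bd.add h (hf a (by simp)) (ih fun i hi => hf i (by simp [hi]))

end Pl

theorem inf_isPl {K : Type*} [Field K] [NumberField K] (w : InfinitePlace K) :
    IsPl (fun x => w x) 1 where
  mul x y := map_mul w x y
  one := map_one w
  zero := map_zero w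
  nonneg x := apply_nonneg w x
  neg x := by
    show w.1 (-x) = w.1 x
    exact AbsoluteValue.map_neg _ _
  add := by
    left
    refine ⟨rfl, fun x y => ?_⟩
    exact w.1.add_le x y

theorem fin_isPl {K : Type*} [Field K] [NumberField K] (w : FinitePlace K) :
    IsPl (fun x => w x) 0 where
  mul x y := map_mul w x y
  one := map_one w
  zero := map_zero w
  nonneg x := apply_nonneg w x
  neg x := by
    show w.val (-x) = w.val x
    exact AbsoluteValue.map_neg _ _
  add := by
    right
    exact ⟨rfl, fun x y => FinitePlace.add_le w x y⟩

theorem prod_contra {K : Type*} [Field K] [NumberField K] (ξ : K) (hξ : ξ ≠ 0) (c : ℝ)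
    (hc : c < 1) (hinf : ∀ w : InfinitePlace K, w ξ ≤ c)
    (hfin : ∀ w : FinitePlace K, w ξ ≤ 1) : False := by
  have h := prod_abs_eq_one hξ
  have h1 : ∏ᶠ w : FinitePlace K, w ξ ≤ 1 := by
    refine finprod_induction (p := fun x : ℝ => x ≤ 1 ∧ 0 ≤ x) ⟨le_refl _, zero_le_one⟩ ?_ ?_ |>.1
    · rintro x y ⟨hx, hx'⟩ ⟨hy, hy'⟩
      exact ⟨mul_le_one₀ hx hy' hy, mul_nonneg hx' hy'⟩
    · intro w; exact ⟨hfin w, apply_nonneg w ξ⟩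
  have h2 : ∏ w : InfinitePlace K, w ξ ^ w.mult < 1 := by
    have : ∏ w : InfinitePlace K, w ξ ^ w.mult < ∏ w : InfinitePlace K, (1 : ℝ) := by
      apply Finset.prod_lt_prod_of_nonempty
      · intro w _
        exact pow_pos (by simpa [InfinitePlace.pos_iff] using hξ) _
      · intro w _
        exact pow_lt_one₀ (apply_nonneg w ξ) ((hinf w).trans_lt hc) w.mult_pos.ne'
      · exact Finset.univ_nonempty
    simpa using this
  have h3 : 0 ≤ ∏ w : InfinitePlace K, w ξ ^ w.mult :=
    Finset.prod_nonneg fun w _ => pow_nonneg (apply_nonneg w ξ) _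
  nlinarith

theorem abc_sorted {a b c : ℝ} (ha : 0 ≤ a) (hab : a ≤ b) (hbc : b ≤ c) :
    a * b * c * (a ^ 2 + b ^ 2 + c ^ 2 - a * b - b * c - c * a) ≤ 4 / 27 * c ^ 5 := by
  have hc : 0 ≤ c := by linarith
  have hb : 0 ≤ b := by linarith
  have h1 : 0 ≤ a * c * ((c - b) * (b * (b - a) + (c - a) ^ 2)) := by
    have : 0 ≤ c - b := by linarith
    have : 0 ≤ b - a := by linarith
    positivity
  have h2 : 0 ≤ c ^ 2 * ((c - 3 * a) ^ 2 * (4 * c - 3 * a)) := by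
    have : 0 ≤ 4 * c - 3 * a := by linarith
    positivity
  nlinarith

theorem abc_ineq {a b c N : ℝ} (ha : 0 ≤ a) (hb : 0 ≤ b) (hc : 0 ≤ c) (haN : a ≤ N) (hbN : b ≤ N)
    (hcN : c ≤ N) :
    a * b * c * (a ^ 2 + b ^ 2 + c ^ 2 - a * b - b * c - c * a) ≤ 4 / 27 * N ^ 5 := by
  have key : ∀ x : ℝ, 0 ≤ x → x ≤ N → 4 / 27 * x ^ 5 ≤ 4 / 27 * N ^ 5 := by
    intro x hx hxN; gcongr
  rcases le_total a b with h1 | h1 <;> rcases le_total b c with h2 | h2 <;>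
    rcases le_total a c with h3 | h3
  · have := abc_sorted ha h1 h2; linarith [key c hc hcN]
  · have := abc_sorted ha h1 h2; linarith [key c hc hcN]
  · have := abc_sorted ha h3 h2; linarith [key b hb hbN]
  · have := abc_sorted hc h3 h1; linarith [key b hb hbN]
  · have := abc_sorted hb h1 h3; linarith [key c hc hcN]
  · have := abc_sorted hb h2 h3; linarith [key a ha haN]
  · have := abc_sorted hc h2 h1; linarith [key a ha haN]
  · have := abc_sorted hc h2 h1; linarith [key a ha haN]

theorem arch_nu (r : ℂ) (M : ℝ) (h1 : 1 ≤ M) (hr : ‖r‖ ≤ M) (hs : ‖1 + r‖ ≤ M) :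
    ‖r * (1 + r) * (r ^ 2 + r + 1)‖ ^ 2 ≤ 4 / 27 * M ^ 10 := by
  have h := abc_ineq (a := 1) (b := ‖r‖ ^ 2) (c := ‖1 + r‖ ^ 2) (N := M ^ 2) (by norm_num)
    (by positivity) (by positivity) (by nlinarith) (by gcongr) (by gcongr)
  have e : ‖r * (1 + r) * (r ^ 2 + r + 1)‖ ^ 2 = 1 * ‖r‖ ^ 2 * ‖1 + r‖ ^ 2 *
      (1 ^ 2 + (‖r‖ ^ 2) ^ 2 + (‖1 + r‖ ^ 2) ^ 2 - 1 * ‖r‖ ^ 2 - ‖r‖ ^ 2 * ‖1 + r‖ ^ 2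
        - ‖1 + r‖ ^ 2 * 1) := by
    rw [norm_mul, norm_mul, mul_pow, mul_pow, one_mul]
    congr 1
    simp only [← Complex.normSq_eq_norm_sq, Complex.normSq_apply]
    simp [pow_two]
    ring
  rw [e]
  calc _ ≤ _ := h
    _ = _ := by ring

/-- the local maximum -/
noncomputable def MM {K : Type*} [Field K] (v : K → ℝ) (r : K) : ℝ := max 1 (max (v r) (v (1 + r)))

theorem one_le_MM {K : Type*} [Field K] (v : K → ℝ) (r : K) : 1 ≤ MM v r := le_max_left _ _
theorem r_le_MM {K : Type*} [Field K] (v : K → ℝ) (r : K) : v r ≤ MM v r :=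
  (le_max_left _ _).trans (le_max_right _ _)
theorem s_le_MM {K : Type*} [Field K] (v : K → ℝ) (r : K) : v (1 + r) ≤ MM v r :=
  (le_max_right _ _).trans (le_max_right _ _)

theorem lstar {K : Type*} [Field K] [NumberField K] (r : K)
    (hr : r * (1 + r) * (r ^ 2 + r + 1) ≠ 0) (μ : K) (hμ : μ ≠ 0) (A B C D : ℕ) (hD : B + D ≤ A)
    (hC : (C : ℝ) ^ 10 < (27 / 4) ^ D)
    (h : ∀ (v : K → ℝ) (θ : ℕ), IsPl v θ → Bd v θ μ C (MM v r ^ B) ∧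
      Bd v θ (μ * r ^ A) C (MM v r ^ B) ∧ Bd v θ (μ * (1 + r) ^ A) C (MM v r ^ B)) : False := by
  have key : ∀ (v : K → ℝ) (θ : ℕ), IsPl v θ → v μ * MM v r ^ D ≤ (C : ℝ) ^ θ := by
    intro v θ hv
    obtain ⟨h1, h2, h3⟩ := h v θ hv
    unfold Bd at h1 h2 h3
    rw [hv.mul, hv.pow] at h2 h3
    have hM := one_le_MM v r
    have h4 : v μ * MM v r ^ A ≤ (C : ℝ) ^ θ * MM v r ^ B := by
      rcases max_choice 1 (max (v r) (v (1 + r))) with e | e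
      · rw [show MM v r = 1 from e] at *
        simpa using h1
      · rcases max_choice (v r) (v (1 + r)) with e' | e'
        · rw [show MM v r = v r from e.trans e'] at *
          exact h2
        · rw [show MM v r = v (1 + r) from e.trans e'] at *
          exact h3
    have h5 : v μ * MM v r ^ D * MM v r ^ B ≤ (C : ℝ) ^ θ * MM v r ^ B := by
      refine le_trans ?_ h4
      rw [mul_assoc, ← pow_add]
      gcongr
      · exact hv.nonneg μ
      · omega
    exact le_of_mul_le_mul_right h5 (by positivity)
  set ν := r * (1 + r) * (r ^ 2 + r + 1) with hν
  refine prod_contra (μ ^ 10 * ν ^ (2 * D)) (mul_ne_zero (pow_ne_zero _ hμ) (pow_ne_zero _ hr))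
    ((C : ℝ) ^ 10 * (4 / 27) ^ D) ?_ ?_ ?_
  · have : ((27 : ℝ) / 4) ^ D * (4 / 27) ^ D = 1 := by rw [← mul_pow]; norm_num
    rw [← this]
    gcongr
  · intro w
    have hv := inf_isPl w
    have h1 := key _ _ hv
    have hM := one_le_MM (fun x => w x) r
    set M := MM (fun x => w x) r with hMdef
    have h2 : (w ν) ^ 2 ≤ 4 / 27 * M ^ 10 := by
      obtain ⟨φ, hφ⟩ := w.2
      have hw : ∀ x, w x = ‖φ x‖ := fun x => by
        show w.1 x = _
        rw [← hφ]; rfl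
      have ha : w r ≤ M := r_le_MM (fun x => w x) r
      have hb : w (1 + r) ≤ M := s_le_MM (fun x => w x) r
      rw [hw] at ha hb ⊢
      have := arch_nu (φ r) M hM ha (by simpa using hb)
      rw [hν]
      simpa using this
    rw [map_mul, map_pow, map_pow, pow_mul]
    simp only [pow_one] at h1
    have hμ0 : 0 ≤ w μ := apply_nonneg w μ
    have hν0 : 0 ≤ w ν := apply_nonneg w ν
    calc w μ ^ 10 * (w ν ^ 2) ^ D ≤ w μ ^ 10 * (4 / 27 * M ^ 10) ^ D := by gcongr
      _ = (w μ * M ^ D) ^ 10 * (4 / 27) ^ D := by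
        rw [mul_pow, mul_pow, ← pow_mul, ← pow_mul, mul_comm 10 D]; ring
      _ ≤ _ := by gcongr
  · intro w
    have hv := fin_isPl w
    have h1 := key _ _ hv
    have hM := one_le_MM (fun x => w x) r
    have ha : w r ≤ _ := r_le_MM (fun x => w x) r
    have hb : w (1 + r) ≤ _ := s_le_MM (fun x => w x) r
    set M := MM (fun x => w x) r with hMdef
    have h2 : w ν ≤ M ^ 5 := by
      have h3 : w (r ^ 2 + r + 1) ≤ M ^ 2 := by
        have e : r ^ 2 + r + 1 = r * (1 + r) + 1 := by ring
        rw [e]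
        refine (FinitePlace.add_le w _ _).trans (max_le ?_ ?_)
        · rw [map_mul, pow_two]
          have := apply_nonneg w (1 + r)
          gcongr
        · rw [map_one]; nlinarith
      rw [hν, map_mul, map_mul]
      have := apply_nonneg w (1 + r)
      have := apply_nonneg w (r ^ 2 + r + 1)
      calc w r * w (1 + r) * w (r ^ 2 + r + 1) ≤ M * M * M ^ 2 := by gcongr
        _ = M ^ 4 := by ring
        _ ≤ M ^ 5 := by gcongr; norm_num
    rw [map_mul, map_pow, map_pow]
    simp only [pow_zero] at h1
    have hμ0 : 0 ≤ w μ := apply_nonneg w μ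
    have hν0 : 0 ≤ w ν := apply_nonneg w ν
    calc w μ ^ 10 * w ν ^ (2 * D) ≤ w μ ^ 10 * (M ^ 5) ^ (2 * D) := by gcongr
      _ = (w μ * M ^ D) ^ 10 := by rw [mul_pow, ← pow_mul, ← pow_mul]; ring_nf
      _ ≤ _ := pow_le_one₀ (by positivity) h1

end Beukers


namespace Beukers

open NumberField

theorem Bd.rpow {K : Type*} [Field K] {v : K → ℝ} {θ : ℕ} (h : IsPl v θ) (r : K) (t e : ℕ)
    (he : t ≤ e) : Bd v θ (r ^ t) 1 (MM v r ^ e) := by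
  unfold Bd
  rw [h.pow]
  simp only [Nat.cast_one, one_pow, one_mul]
  calc v r ^ t ≤ MM v r ^ t := pow_le_pow_left₀ (h.nonneg _) (r_le_MM v r) _
    _ ≤ _ := pow_le_pow_right₀ (one_le_MM v r) he

theorem Bd.spow {K : Type*} [Field K] {v : K → ℝ} {θ : ℕ} (h : IsPl v θ) (r : K) (t e : ℕ)
    (he : t ≤ e) : Bd v θ ((1 + r) ^ t) 1 (MM v r ^ e) := by
  unfold Bd
  rw [h.pow]
  simp only [Nat.cast_one, one_pow, one_mul]
  calc v (1 + r) ^ t ≤ MM v r ^ t := pow_le_pow_left₀ (h.nonneg _) (s_le_MM v r) _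
    _ ≤ _ := pow_le_pow_right₀ (one_le_MM v r) he

theorem Bd.one {K : Type*} [Field K] {v : K → ℝ} {θ : ℕ} (h : IsPl v θ) (r : K) (e : ℕ) :
    Bd v θ 1 1 (MM v r ^ e) := by
  simpa using Bd.rpow h r 0 e (Nat.zero_le e)

theorem Bd.rspow {K : Type*} [Field K] {v : K → ℝ} {θ : ℕ} (h : IsPl v θ) (r : K) (t : ℕ) :
    Bd v θ (r ^ t * (1 + r) ^ t) 1 (MM v r ^ (2 * t)) := by
  have := (Bd.rpow h r t t le_rfl).mul h (Bd.spow h r t t le_rfl)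
  rwa [mul_one, ← pow_add, ← two_mul] at this

/-- smul by a natural number -/
theorem Bd.nsmul {K : Type*} [Field K] {v : K → ℝ} {θ : ℕ} (h : IsPl v θ) {x : K} {C : ℕ} {B : ℝ}
    (k : ℕ) (hx : Bd v θ x C B) : Bd v θ ((k : K) * x) (k * C) B := by
  have := (Bd.natCast h k).mul h hx
  rwa [one_mul] at this

/-- the vector orthogonal to `(1, y^q, z^q)` coming from the second exponent -/
structure WV {K : Type*} [Field K] (r : K) (m q e : ℕ) (W₁ W₂ W₃ : K) : Prop where
  rel : W₁ + (r ^ m) ^ q * W₂ + (-(1 + r) ^ m) ^ q * W₃ = 0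
  ne : W₁ ≠ 0
  b1 : ∀ (v : K → ℝ) (θ : ℕ), IsPl v θ → Bd v θ W₁ 1 (MM v r ^ e)
  b2 : ∀ (v : K → ℝ) (θ : ℕ), IsPl v θ → Bd v θ W₂ 1 (MM v r ^ e)
  b3 : ∀ (v : K → ℝ) (θ : ℕ), IsPl v θ → Bd v θ W₃ 1 (MM v r ^ e)

theorem Bd.sign {K : Type*} [Field K] {v : K → ℝ} {θ : ℕ} (h : IsPl v θ) {x : K} {C : ℕ} {B : ℝ}
    (q : ℕ) (hx : Bd v θ x C B) : Bd v θ ((-1) ^ q * x) C B := by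
  rcases neg_one_pow_eq_or K q with e | e <;> rw [e]
  · rwa [one_mul]
  · rw [neg_one_mul]; exact hx.neg h

theorem wpos {K : Type*} [Field K] (r : K) (m n q t : ℕ) (hn : n = q * m + t)
    (h : 1 + r ^ n = (1 + r) ^ n) : WV r m q t 1 (r ^ t) ((-1) ^ q * -(1 + r) ^ t) where
  rel := by
    have e : (-(1 + r) ^ m) ^ q * ((-1) ^ q * -(1 + r) ^ t) = -(1 + r) ^ n := by
      rw [neg_pow ((1 + r) ^ m) q]
      have : ((-1 : K) ^ q) * (-1) ^ q = 1 := by rw [← mul_pow]; simp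
      rw [hn, pow_add, mul_comm q m, pow_mul]
      linear_combination (-((1 + r) ^ m) ^ q * (1 + r) ^ t) * this
    rw [e, ← h, hn, pow_add, mul_comm q m, pow_mul]
    ring
  ne := one_ne_zero
  b1 v θ hv := Bd.one hv r t
  b2 v θ hv := Bd.rpow hv r t t le_rfl
  b3 v θ hv := ((Bd.spow hv r t t le_rfl).neg hv).sign hv q

theorem wneg {K : Type*} [Field K] (r : K) (hr0 : r ≠ 0) (hs0 : 1 + r ≠ 0) (m n q t : ℕ)
    (hn : n + t = q * m) (h : 1 + r ^ n = (1 + r) ^ n) :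
    WV r m q (2 * t) (r ^ t * (1 + r) ^ t) ((1 + r) ^ t) ((-1) ^ q * -r ^ t) where
  rel := by
    have e1 : (r ^ m) ^ q = r ^ n * r ^ t := by rw [← pow_mul, ← pow_add, hn, mul_comm]
    have e2 : ((1 + r) ^ m) ^ q = (1 + r) ^ n * (1 + r) ^ t := by
      rw [← pow_mul, ← pow_add, hn, mul_comm]
    have : ((-1 : K) ^ q) * (-1) ^ q = 1 := by rw [← mul_pow]; simp
    rw [neg_pow ((1 + r) ^ m) q, e1, e2, ← h]
    linear_combination (-(1 + r ^ n) * (1 + r) ^ t * r ^ t) * this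
  ne := mul_ne_zero (pow_ne_zero _ hr0) (pow_ne_zero _ hs0)
  b1 v θ hv := Bd.rspow hv r t
  b2 v θ hv := Bd.spow hv r t _ (by omega)
  b3 v θ hv := ((Bd.rpow hv r t _ (by omega)).neg hv).sign hv q

theorem neg_pow_cases {K : Type*} [Field K] (a : K) (q : ℕ) : (-a) ^ q = a ^ q ∨ (-a) ^ q = -a ^ q := by
  rcases Nat.even_or_odd q with h | h
  · left; exact h.neg_pow a
  · right; exact h.neg_pow a

/-- `lstar` in vector form. -/
theorem lvec {K : Type*} [Field K] [NumberField K] (r : K)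
    (hr : r * (1 + r) * (r ^ 2 + r + 1) ≠ 0) (m q B C D : ℕ) (hD : B + D ≤ q * m)
    (hC : (C : ℝ) ^ 10 < (27 / 4) ^ D) (P₁ P₂ P₃ : K)
    (h2 : P₂ = P₁ * (r ^ m) ^ q) (h3 : P₃ = P₁ * (-(1 + r) ^ m) ^ q)
    (b1 : ∀ (v : K → ℝ) (θ : ℕ), IsPl v θ → Bd v θ P₁ C (MM v r ^ B))
    (b2 : ∀ (v : K → ℝ) (θ : ℕ), IsPl v θ → Bd v θ P₂ C (MM v r ^ B))
    (b3 : ∀ (v : K → ℝ) (θ : ℕ), IsPl v θ → Bd v θ P₃ C (MM v r ^ B)) : P₁ = 0 := by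
  by_contra hP
  refine lstar r hr P₁ hP (q * m) B C D hD hC fun v θ hv => ⟨b1 v θ hv, ?_, ?_⟩
  · have := b2 v θ hv
    rwa [h2, ← pow_mul, mul_comm m q] at this
  · have := b3 v θ hv
    rw [h3] at this
    rw [mul_comm q m, pow_mul]
    rcases neg_pow_cases ((1 + r) ^ m) q with e | e
    · rwa [e] at this
    · rw [e] at this
      have := this.neg hv
      rwa [mul_neg, neg_neg] at this

theorem cross {K : Type*} [Field K] [NumberField K] (r : K)
    (hr : r * (1 + r) * (r ^ 2 + r + 1) ≠ 0) (m q e d C D : ℕ) (W₁ W₂ W₃ : K)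
    (hW : WV r m q e W₁ W₂ W₃) (T₁ T₂ T₃ : K)
    (hT : T₁ + (r ^ m) ^ q * T₂ + (-(1 + r) ^ m) ^ q * T₃ = 0)
    (c₁ c₂ c₃ : ℕ) (h12 : c₁ + c₂ ≤ C) (h13 : c₁ + c₃ ≤ C) (h23 : c₂ + c₃ ≤ C)
    (b1 : ∀ (v : K → ℝ) (θ : ℕ), IsPl v θ → Bd v θ T₁ c₁ (MM v r ^ d))
    (b2 : ∀ (v : K → ℝ) (θ : ℕ), IsPl v θ → Bd v θ T₂ c₂ (MM v r ^ d))
    (b3 : ∀ (v : K → ℝ) (θ : ℕ), IsPl v θ → Bd v θ T₃ c₃ (MM v r ^ d))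
    (hD : d + e + D ≤ q * m) (hC : (C : ℝ) ^ 10 < (27 / 4) ^ D) :
    T₂ * W₃ = T₃ * W₂ ∧ T₃ * W₁ = T₁ * W₃ ∧ T₁ * W₂ = T₂ * W₁ := by
  set y := (r ^ m) ^ q with hy
  set z := (-(1 + r) ^ m) ^ q with hz
  have e2 : T₃ * W₁ - T₁ * W₃ = (T₂ * W₃ - T₃ * W₂) * y := by
    linear_combination T₃ * hW.rel - W₃ * hT
  have e3 : T₁ * W₂ - T₂ * W₁ = (T₂ * W₃ - T₃ * W₂) * z := by
    linear_combination W₂ * hT - T₂ * hW.rel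
  have bb : ∀ (v : K → ℝ) (θ : ℕ), IsPl v θ → ∀ (a b p p' : K) (ca cb : ℕ), ca + cb ≤ C →
      Bd v θ a ca (MM v r ^ d) → Bd v θ b cb (MM v r ^ d) → Bd v θ p 1 (MM v r ^ e) →
      Bd v θ p' 1 (MM v r ^ e) → Bd v θ (a * p - b * p') C (MM v r ^ (d + e)) := by
    intro v θ hv a b p p' ca cb hc ha hb hp hp'
    have := (ha.mul hv hp).sub hv (hb.mul hv hp')
    have hM := one_le_MM v r
    rw [pow_add]
    exact this.mono (by omega) le_rfl (by positivity)
  have h0 : T₂ * W₃ - T₃ * W₂ = 0 := by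
    refine lvec r hr m q (d + e) C D hD hC _ _ _ e2 e3 ?_ ?_ ?_
    · exact fun v θ hv => bb v θ hv _ _ _ _ _ _ h23 (b2 v θ hv) (b3 v θ hv) (hW.b3 v θ hv) (hW.b2 v θ hv)
    · exact fun v θ hv => bb v θ hv _ _ _ _ _ _ (by omega) (b3 v θ hv) (b1 v θ hv) (hW.b1 v θ hv) (hW.b3 v θ hv)
    · exact fun v θ hv => bb v θ hv _ _ _ _ _ _ h12 (b1 v θ hv) (b2 v θ hv) (hW.b2 v θ hv) (hW.b1 v θ hv)
  rw [h0, zero_mul] at e2 e3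
  exact ⟨sub_eq_zero.1 h0, sub_eq_zero.1 e2, sub_eq_zero.1 e3⟩

theorem unity_contra {K : Type*} [Field K] [NumberField K] (r : K)
    (hr : r * (1 + r) * (r ^ 2 + r + 1) ≠ 0) (t : ℕ) (ht : t ≠ 0) (h1 : r ^ t = 1)
    (h2 : (1 + r) ^ t = 1) : False := by
  obtain ⟨φ⟩ : Nonempty (K →+* ℂ) := inferInstance
  have n1 : ‖φ r‖ = 1 := by
    have : ‖φ r‖ ^ t = 1 := by rw [← norm_pow, ← map_pow, h1]; simp
    exact (pow_eq_one_iff_of_nonneg (norm_nonneg _) ht).1 this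
  have n2 : ‖1 + φ r‖ = 1 := by
    have : ‖1 + φ r‖ ^ t = 1 := by
      rw [← norm_pow, ← map_one φ, ← map_add, ← map_pow, h2]; simp
    exact (pow_eq_one_iff_of_nonneg (norm_nonneg _) ht).1 this
  have m1 := Complex.mul_conj (φ r)
  have m2 := Complex.mul_conj (1 + φ r)
  rw [Complex.normSq_eq_norm_sq, n1] at m1
  rw [Complex.normSq_eq_norm_sq, n2, map_add, map_one] at m2
  simp only [one_pow, Complex.ofReal_one] at m1 m2
  have : φ (r ^ 2 + r + 1) = 0 := by
    simp only [map_add, map_pow, map_one]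
    linear_combination (φ r) * m2 - (φ r + 1) * m1
  rw [map_eq_zero] at this
  exact hr (by rw [this, mul_zero])

section
variable {K : Type*} [Field K] [NumberField K] (r : K)
    (hr : r * (1 + r) * (r ^ 2 + r + 1) ≠ 0) (m n : ℕ)
    (h1 : 1 + r ^ m = (1 + r) ^ m) (h2 : 1 + r ^ n = (1 + r) ^ n)
include hr h1 h2

theorem T0 (hmn : m < n) (hb : n + 4 ≤ 2 * m) : False := by
  obtain ⟨t, rfl⟩ : ∃ t, n = m + t := ⟨n - m, by omega⟩
  have hW := wpos r m (m + t) 1 t (by ring) h2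
  have := cross r hr m 1 t 0 2 4 _ _ _ hW 1 1 1 (by rw [pow_one, pow_one, ← h1]; ring) 1 1 1 le_rfl le_rfl le_rfl
    (fun v θ hv => Bd.one hv r 0) (fun v θ hv => Bd.one hv r 0) (fun v θ hv => Bd.one hv r 0)
    (by omega) (by norm_num)
  obtain ⟨ha, hb, hc⟩ := this
  refine unity_contra r hr t (by omega) ?_ ?_
  · linear_combination hc
  · linear_combination -hb

theorem bnd_lin (v : K → ℝ) (θ : ℕ) (hv : IsPl v θ) : Bd v θ 1 1 (MM v r ^ m) ∧
    Bd v θ (r ^ m) 1 (MM v r ^ m) ∧ Bd v θ (-(1 + r) ^ m) 1 (MM v r ^ m) :=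
  ⟨Bd.one hv r m, Bd.rpow hv r m m le_rfl, (Bd.spow hv r m m le_rfl).neg hv⟩

theorem T1 (hm : 11 ≤ m) (hlo : 3 * m ≤ n + 5) (hhi : n + 4 ≤ 4 * m) : False := by
  have hr0 : r ≠ 0 := by rintro rfl; simp at hr
  have hs0 : 1 + r ≠ 0 := by intro h; simp [h] at hr
  set y := r ^ m with hy
  set z := -(1 + r) ^ m with hz
  have hx : 1 + y + z = 0 := by rw [hz, ← h1]; ring
  have hx' : z = -1 - y := by linear_combination hx
  have bx := fun v θ hv => (bnd_lin r hr m n h1 h2 v θ hv).1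
  have by_ := fun v θ hv => (bnd_lin r hr m n h1 h2 v θ hv).2.1
  have bz := fun v θ hv => (bnd_lin r hr m n h1 h2 v θ hv).2.2
  have main : ∀ (e : ℕ) (W₁ W₂ W₃ : K), WV r m 3 e W₁ W₂ W₃ → e ≤ 2 * m - 8 →
      (z - 1) * W₃ = (1 - y) * W₂ ∧ (1 - y) * W₁ = (y - z) * W₃ ∧ (y - z) * W₂ = (z - 1) * W₁ := by
    intro e W₁ W₂ W₃ hW he
    refine cross r hr m 3 e m 4 8 _ _ _ hW _ _ _ ?_ 2 2 2 le_rfl le_rfl le_rfl ?_ ?_ ?_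
      (by omega) (by norm_num)
    · rw [← hy, ← hz, hx']; ring
    · exact fun v θ hv => (by_ v θ hv).sub hv (bz v θ hv)
    · exact fun v θ hv => (bz v θ hv).sub hv (bx v θ hv)
    · exact fun v θ hv => (bx v θ hv).sub hv (by_ v θ hv)
  by_cases hn : 3 * m ≤ n
  · obtain ⟨t, rfl⟩ : ∃ t, n = 3 * m + t := ⟨n - 3 * m, by omega⟩
    have hW := wpos r m (3 * m + t) 3 t (by ring) h2
    obtain ⟨ha, hb, hc⟩ := main _ _ _ _ hW (by omega)
    set W₂ := r ^ t
    set W₃ := (-1 : K) ^ 3 * -(1 + r) ^ t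
    have hl : (y - z) * (W₃ - W₂) = 3 := by linear_combination -hb - hc - hx
    have hl0 : y - z ≠ 0 := by rintro h; rw [h, zero_mul] at hl; norm_num at hl
    have hP : W₃ - W₂ = 0 := by
      refine lvec r hr m 1 t 2 4 (by omega) (by norm_num) (W₃ - W₂) (1 - W₃) (W₂ - 1) ?_ ?_ ?_ ?_ ?_
      · apply mul_left_cancel₀ hl0
        rw [pow_one, ← hy]
        linear_combination (-y) * hl + hb - hx
      · apply mul_left_cancel₀ hl0
        rw [pow_one, ← hz]
        linear_combination (-z) * hl + hc - hx
      · exact fun v θ hv => (hW.b3 v θ hv).sub hv (hW.b2 v θ hv)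
      · exact fun v θ hv => (hW.b1 v θ hv).sub hv (hW.b3 v θ hv)
      · exact fun v θ hv => (hW.b2 v θ hv).sub hv (hW.b1 v θ hv)
    rw [hP, mul_zero] at hl
    norm_num at hl
  · obtain ⟨t, ht⟩ : ∃ t, n + t = 3 * m := ⟨3 * m - n, by omega⟩
    have hW := wneg r hr0 hs0 m n 3 t ht h2
    obtain ⟨ha, hb, hc⟩ := main _ _ _ _ hW (by omega)
    set R := r ^ t with hR
    set S := (1 + r) ^ t with hS
    have hR0 : R ≠ 0 := pow_ne_zero _ hr0
    have hS0 : S ≠ 0 := pow_ne_zero _ hs0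
    -- T = λ (R S, S, R)
    have hb' : 1 - y = (z - 1) / S * R := by
      field_simp
      linear_combination -ha
    have hc' : y - z = (z - 1) / S * (R * S) := by
      field_simp
      have : S * (y - z - (z - 1) * R) = 0 := by linear_combination hc
      rcases mul_eq_zero.1 this with h | h
      · exact absurd h hS0
      · linear_combination h
    set l := (z - 1) / S with hl
    have ha' : z - 1 = l * S := by rw [hl]; field_simp
    set κ := l ^ 2 * R * S with hκ
    have p1 : κ * -(R + S + 4) = 9 := by
      have : κ * -(R + S + 4) = -((y - z) * (1 - y)) - (y - z) * (z - 1) - 4 * ((z - 1) * (1 - y)) := by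
        rw [hb', hc', ha']; ring
      rw [this, hx']; ring
    have p2 : κ * -(S + 1 + 4 * R) = 9 * y ^ 2 := by
      have : κ * -(S + 1 + 4 * R) = -((y - z) * (z - 1)) - (z - 1) * (1 - y) - 4 * ((y - z) * (1 - y)) := by
        rw [hb', hc', ha']; ring
      rw [this, hx']; ring
    have p3 : κ * -(R + 1 + 4 * S) = 9 * z ^ 2 := by
      have : κ * -(R + 1 + 4 * S) = -((y - z) * (1 - y)) - (z - 1) * (1 - y) - 4 * ((y - z) * (z - 1)) := by
        rw [hb', hc', ha']; ring
      rw [this, hx']; ring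
    have hκ0 : κ ≠ 0 := by rintro h; rw [h, zero_mul] at p1; norm_num at p1
    have hP : -(R + S + 4) = 0 := by
      refine lvec r hr m 2 t 6 10 (by omega) (by norm_num) (-(R + S + 4)) (-(S + 1 + 4 * R)) (-(R + 1 + 4 * S)) ?_ ?_ ?_ ?_ ?_
      · apply mul_left_cancel₀ hκ0
        rw [← hy]
        linear_combination p2 - y ^ 2 * p1
      · apply mul_left_cancel₀ hκ0
        rw [← hz]
        linear_combination p3 - z ^ 2 * p1
      · intro v θ hv
        have h4 := (Bd.one hv r t).nsmul hv 4
        push_cast at h4; rw [mul_one] at h4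
        exact (((Bd.rpow hv r t t le_rfl).add hv (Bd.spow hv r t t le_rfl)).add hv h4).neg hv
      · intro v θ hv
        have h4 := (Bd.rpow hv r t t le_rfl).nsmul hv 4
        push_cast at h4
        exact (((Bd.spow hv r t t le_rfl).add hv (Bd.one hv r t)).add hv h4).neg hv
      · intro v θ hv
        have h4 := (Bd.spow hv r t t le_rfl).nsmul hv 4
        push_cast at h4
        exact (((Bd.rpow hv r t t le_rfl).add hv (Bd.one hv r t)).add hv h4).neg hv
    rw [hP, mul_zero] at p1
    norm_num at p1

theorem T2 (hlo : 4 * m + 8 ≤ n) (hhi : n + 16 ≤ 7 * m) : False := by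
  have hr0 : r ≠ 0 := by rintro rfl; simp at hr
  have hs0 : 1 + r ≠ 0 := by intro h; simp [h] at hr
  set y := r ^ m with hy
  set z := -(1 + r) ^ m with hz
  have hx : 1 + y + z = 0 := by rw [hz, ← h1]; ring
  have hx' : z = -1 - y := by linear_combination hx
  have bx := fun v θ hv => (bnd_lin r hr m n h1 h2 v θ hv).1
  have by_ := fun v θ hv => (bnd_lin r hr m n h1 h2 v θ hv).2.1
  have bz := fun v θ hv => (bnd_lin r hr m n h1 h2 v θ hv).2.2
  have bq : ∀ (v : K → ℝ) (θ : ℕ), IsPl v θ → ∀ p q : K, Bd v θ p 1 (MM v r ^ m) →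
      Bd v θ q 1 (MM v r ^ m) → Bd v θ (2 * p ^ 2 - 3 * (p * q) + 2 * q ^ 2) 7 (MM v r ^ (2 * m)) := by
    intro v θ hv p q hp hq
    have a1 := (hp.pow hv 2).nsmul hv 2
    have a2 := (hp.mul hv hq).nsmul hv 3
    have a3 := (hq.pow hv 2).nsmul hv 2
    rw [← pow_mul, mul_comm m 2] at a1 a3
    rw [← pow_add, ← two_mul] at a2
    push_cast at a1 a2 a3
    exact (a1.sub hv a2).add hv a3
  obtain ⟨e, W₁, W₂, W₃, hW, he⟩ : ∃ (e : ℕ) (W₁ W₂ W₃ : K), WV r m 5 e W₁ W₂ W₃ ∧ e + 16 ≤ 2 * m := by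
    by_cases hn : 5 * m ≤ n
    · obtain ⟨t, rfl⟩ : ∃ t, n = 5 * m + t := ⟨n - 5 * m, by omega⟩
      exact ⟨_, _, _, _, wpos r m (5 * m + t) 5 t (by ring) h2, by omega⟩
    · obtain ⟨t, ht⟩ : ∃ t, n + t = 5 * m := ⟨5 * m - n, by omega⟩
      exact ⟨_, _, _, _, wneg r hr0 hs0 m n 5 t ht h2, by omega⟩
  have := cross r hr m 5 e (2 * m) 14 14 _ _ _ hW (2 * y ^ 2 - 3 * (y * z) + 2 * z ^ 2)
    (2 * z ^ 2 - 3 * (z * 1) + 2 * 1 ^ 2) (2 * 1 ^ 2 - 3 * (1 * y) + 2 * y ^ 2)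
    (by rw [← hy, ← hz, hx']; ring) 7 7 7 le_rfl le_rfl le_rfl
    (fun v θ hv => bq v θ hv _ _ (by_ v θ hv) (bz v θ hv))
    (fun v θ hv => bq v θ hv _ _ (bz v θ hv) (bx v θ hv))
    (fun v θ hv => bq v θ hv _ _ (bx v θ hv) (by_ v θ hv))
    (by omega) (by norm_num)
  obtain ⟨ha, hb, hc⟩ := this
  set T₁ := 2 * y ^ 2 - 3 * (y * z) + 2 * z ^ 2 with hT₁
  set T₂ := 2 * z ^ 2 - 3 * (z * 1) + 2 * 1 ^ 2 with hT₂
  set T₃ := (2 * 1 ^ 2 - 3 * (1 * y) + 2 * y ^ 2 : K) with hT₃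
  have hW1 := hW.ne
  set l := T₁ / W₁ with hl
  have l1 : l * W₁ = T₁ := by rw [hl]; field_simp
  have l2 : l * W₂ = T₂ := by rw [hl]; field_simp; linear_combination hc
  have l3 : l * W₃ = T₃ := by rw [hl]; field_simp; linear_combination -hb
  have p1 : l * (7 * W₂ + 7 * W₃ - 4 * W₁) = 55 := by
    have : l * (7 * W₂ + 7 * W₃ - 4 * W₁) = 7 * T₂ + 7 * T₃ - 4 * T₁ := by
      rw [← l1, ← l2, ← l3]; ring
    rw [this, hT₁, hT₂, hT₃, hx']; ring
  have p2 : l * (7 * W₁ + 7 * W₃ - 4 * W₂) = 55 * y ^ 2 := by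
    have : l * (7 * W₁ + 7 * W₃ - 4 * W₂) = 7 * T₁ + 7 * T₃ - 4 * T₂ := by
      rw [← l1, ← l2, ← l3]; ring
    rw [this, hT₁, hT₂, hT₃, hx']; ring
  have p3 : l * (7 * W₁ + 7 * W₂ - 4 * W₃) = 55 * z ^ 2 := by
    have : l * (7 * W₁ + 7 * W₂ - 4 * W₃) = 7 * T₁ + 7 * T₂ - 4 * T₃ := by
      rw [← l1, ← l2, ← l3]; ring
    rw [this, hT₁, hT₂, hT₃, hx']; ring
  have hl0 : l ≠ 0 := by rintro h; rw [h, zero_mul] at p1; norm_num at p1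
  have bb : ∀ (v : K → ℝ) (θ : ℕ), IsPl v θ → ∀ p q w : K, Bd v θ p 1 (MM v r ^ e) →
      Bd v θ q 1 (MM v r ^ e) → Bd v θ w 1 (MM v r ^ e) →
      Bd v θ (7 * p + 7 * q - 4 * w) 18 (MM v r ^ e) := by
    intro v θ hv p q w hp hq hw
    have a1 := hp.nsmul hv 7
    have a2 := hq.nsmul hv 7
    have a3 := hw.nsmul hv 4
    push_cast at a1 a2 a3
    exact (a1.add hv a2).sub hv a3
  have hP : 7 * W₂ + 7 * W₃ - 4 * W₁ = 0 := by
    refine lvec r hr m 2 e 18 16 (by omega) (by norm_num) _ _ _ ?_ ?_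
      (fun v θ hv => bb v θ hv _ _ _ (hW.b2 v θ hv) (hW.b3 v θ hv) (hW.b1 v θ hv))
      (fun v θ hv => bb v θ hv _ _ _ (hW.b1 v θ hv) (hW.b3 v θ hv) (hW.b2 v θ hv))
      (fun v θ hv => bb v θ hv _ _ _ (hW.b1 v θ hv) (hW.b2 v θ hv) (hW.b3 v θ hv))
    · apply mul_left_cancel₀ hl0
      rw [← hy]
      linear_combination p2 - y ^ 2 * p1
    · apply mul_left_cancel₀ hl0
      rw [← hz]
      linear_combination p3 - z ^ 2 * p1
  rw [hP, mul_zero] at p1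
  norm_num at p1
end

end Beukers


namespace Beukers

/-- coefficient of `u^n` in `(1 - p u)^(-j) (1 - q u)^(-k)` -/
def g {R : Type*} [CommRing R] (p q : R) : ℕ → ℕ → ℕ → R
  | 0, _, _ => 1
  | _ + 1, 0, 0 => 0
  | n + 1, 0, k + 1 => q * g p q n 0 (k + 1) + g p q (n + 1) 0 k
  | n + 1, j + 1, k => p * g p q n (j + 1) k + g p q (n + 1) j k
termination_by n j k => (n, j, k)

section ring
variable {R : Type*} [CommRing R] (p q : R)

theorem g_zero (j k : ℕ) : g p q 0 j k = 1 := by rw [g]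
theorem g_00 (n : ℕ) : g p q (n + 1) 0 0 = 0 := by rw [g]
theorem g_0k (n k : ℕ) : g p q (n + 1) 0 (k + 1) = q * g p q n 0 (k + 1) + g p q (n + 1) 0 k := by
  rw [g]
theorem g_j (n j k : ℕ) : g p q (n + 1) (j + 1) k = p * g p q n (j + 1) k + g p q (n + 1) j k := by
  rw [g]

theorem g_k (n j k : ℕ) : g p q (n + 1) j (k + 1) = q * g p q n j (k + 1) + g p q (n + 1) j k := by
  induction n generalizing j with
  | zero =>
    induction j with
    | zero => exact g_0k p q 0 k
    | succ j ih =>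
      rw [g_j, ih, g_j p q 0 j k]
      simp only [g_zero]; ring
  | succ n ihn =>
    induction j with
    | zero => exact g_0k p q _ k
    | succ j ih =>
      have e1 := g_j p q n j (k + 1)
      have e2 := ihn (j + 1)
      rw [g_j p q (n + 1) j (k + 1), ih, g_j p q (n + 1) j k]
      linear_combination p * e2 - q * e1

theorem g_map {S : Type*} [CommRing S] (f : R →+* S) (n j k : ℕ) :
    f (g p q n j k) = g (f p) (f q) n j k := by
  induction n generalizing j k with
  | zero => simp [g_zero]
  | succ n ihn =>
    induction j with
    | zero =>
      induction k with
      | zero => simp [g_00]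
      | succ k ih => rw [g_0k, g_0k, map_add, map_mul, ihn, ih]
    | succ j ih => rw [g_j, g_j, map_add, map_mul, ihn, ih]

theorem g_smul (c : R) (n j k : ℕ) : g (c * p) (c * q) n j k = c ^ n * g p q n j k := by
  induction n generalizing j k with
  | zero => simp [g_zero]
  | succ n ihn =>
    induction j with
    | zero =>
      induction k with
      | zero => simp [g_00]
      | succ k ih => rw [g_0k, g_0k, ihn, ih]; ring
    | succ j ih => rw [g_j, g_j, ihn, ih]; ring

theorem g_j0 (n j : ℕ) : g p q n j 0 = (Nat.multichoose j n : R) * p ^ n := by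
  induction n generalizing j with
  | zero => simp [g_zero]
  | succ n ihn =>
    induction j with
    | zero => simp [g_00]
    | succ j ih => rw [g_j, ihn, ih, Nat.multichoose_succ_succ]; push_cast; ring

theorem g_0k' (n k : ℕ) : g p q n 0 k = (Nat.multichoose k n : R) * q ^ n := by
  induction n generalizing k with
  | zero => simp [g_zero]
  | succ n ihn =>
    induction k with
    | zero => simp [g_00]
    | succ k ih => rw [g_0k, ihn, ih, Nat.multichoose_succ_succ]; push_cast; ring

theorem g_q0 (n j k : ℕ) : g p 0 n j k = (Nat.multichoose j n : R) * p ^ n := by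
  rw [← g_j0 p 0]
  cases n with
  | zero => simp [g_zero]
  | succ n =>
    induction k with
    | zero => rfl
    | succ k ih => rw [g_k, ih]; ring

theorem g_11 (n j k : ℕ) : g (1 : R) 1 n j k = (Nat.multichoose (j + k) n : R) := by
  induction n generalizing j k with
  | zero => simp [g_zero]
  | succ n ihn =>
    induction j with
    | zero => rw [g_0k']; simp
    | succ j ih =>
      rw [g_j, ihn, ih, show j + 1 + k = (j + k) + 1 by ring, Nat.multichoose_succ_succ]
      push_cast; ring

end ring

theorem g_bd {K : Type*} [Field K] {v : K → ℝ} {θ : ℕ} (h : IsPl v θ) {p q : K} {B : ℝ}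
    (hB : 0 ≤ B) (hp : Bd v θ p 1 B) (hq : Bd v θ q 1 B) (n j k : ℕ) :
    Bd v θ (g p q n j k) (Nat.multichoose (j + k) n) (B ^ n) := by
  induction n generalizing j k with
  | zero => simp [g_zero, Bd, h.one]
  | succ n ihn =>
    induction j with
    | zero =>
      induction k with
      | zero => rw [g_00]; simp only [Bd, h.zero]; positivity
      | succ k ih =>
        rw [g_0k]
        have := (hq.mul h (ihn 0 (k + 1))).add h (by rw [← pow_succ']; exact ih)
        rw [← pow_succ', one_mul] at this
        rw [show 0 + (k + 1) = (0 + k) + 1 by ring, Nat.multichoose_succ_succ,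
          add_comm (Nat.multichoose _ _)]
        exact this
    | succ j ih =>
      rw [g_j]
      have := (hp.mul h (ihn (j + 1) k)).add h (by rw [← pow_succ']; exact ih)
      rw [← pow_succ', one_mul] at this
      rw [show (j + 1) + k = (j + k) + 1 by ring, Nat.multichoose_succ_succ,
        add_comm (Nat.multichoose _ _), show (j + k) + 1 = (j + 1) + k by ring]
      exact this

open Polynomial in
theorem g_deg (p q : ℚ[X]) (hp : p.natDegree ≤ 1) (hq : q.natDegree ≤ 1) (n j k : ℕ) :
    (g p q n j k).natDegree ≤ n := by
  induction n generalizing j k with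
  | zero => simp [g_zero]
  | succ n ihn =>
    have key : ∀ a b : ℚ[X], a.natDegree ≤ 1 → b.natDegree ≤ n → (a * b).natDegree ≤ n + 1 := by
      intro a b ha hb
      exact natDegree_mul_le.trans (by omega)
    induction j with
    | zero =>
      induction k with
      | zero => simp [g_00]
      | succ k ih => rw [g_0k]; exact natDegree_add_le_of_degree_le (key _ _ hq (ihn _ _)) ih
    | succ j ih => rw [g_j]; exact natDegree_add_le_of_degree_le (key _ _ hp (ihn _ _)) ih

section pade
variable {K : Type*} [Field K]

/-- the residue at `ℓ_x = 0` -/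
noncomputable def tau (y z : K) : ℕ → ℕ → ℕ → K
  | 0, _, _ => 0
  | α + 1, β, γ => (z ^ β)⁻¹ * ((-y) ^ γ)⁻¹ * g (-z⁻¹) y⁻¹ α β γ

theorem tau_rec (x y z : K) (hy : y ≠ 0) (hz : z ≠ 0) (h : x + y + z = 0) (α β γ : ℕ) :
    x * tau y z α (β + 1) (γ + 1) + y * tau y z (α + 1) β (γ + 1)
      + z * tau y z (α + 1) (β + 1) γ = 0 := by
  have hx : x = -y - z := by linear_combination h
  cases α with
  | zero =>
    simp only [tau, g_zero]
    have : -y ≠ 0 := neg_ne_zero.2 hy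
    rw [pow_succ, pow_succ]
    field_simp
    ring
  | succ a =>
    have e1 := g_j (-z⁻¹) y⁻¹ a β (γ + 1)
    have e2 := g_k (-z⁻¹) y⁻¹ a (β + 1) γ
    have hny : -y ≠ 0 := neg_ne_zero.2 hy
    simp only [tau]
    have e1' : g (-z⁻¹) y⁻¹ (a + 1) β (γ + 1) = g (-z⁻¹) y⁻¹ (a + 1) (β + 1) (γ + 1)
      + z⁻¹ * g (-z⁻¹) y⁻¹ a (β + 1) (γ + 1) := by rw [e1]; ring
    have e2' : g (-z⁻¹) y⁻¹ (a + 1) (β + 1) γ = g (-z⁻¹) y⁻¹ (a + 1) (β + 1) (γ + 1)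
      - y⁻¹ * g (-z⁻¹) y⁻¹ a (β + 1) (γ + 1) := by rw [e2]; ring
    rw [e1', e2']
    generalize g (-z⁻¹) y⁻¹ (a + 1) (β + 1) (γ + 1) = A
    generalize g (-z⁻¹) y⁻¹ a (β + 1) (γ + 1) = B
    rw [hx, pow_succ, pow_succ]
    field_simp
    ring

theorem multichoose_symm (a b : ℕ) : Nat.multichoose (a + 1) b = Nat.multichoose (b + 1) a := by
  rw [Nat.multichoose_eq, Nat.multichoose_eq]
  rw [show a + 1 + b - 1 = a + b by omega, show b + 1 + a - 1 = a + b by omega]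
  exact (Nat.choose_symm_add (a := a) (b := b)).symm

/-- sum of the residues -/
noncomputable def F (x y z : K) (α β γ : ℕ) : K := tau y z α β γ + tau z x β γ α + tau x y γ α β

theorem F_bdry (x y z : K) (hz : z ≠ 0) (α β : ℕ) (h : 2 ≤ α + β) : F x y z α β 0 = 0 := by
  unfold F
  cases α with
  | zero =>
    obtain ⟨b, rfl⟩ : ∃ b, β = b + 2 := ⟨β - 2, by omega⟩
    simp [tau, g_00]
  | succ a =>
    cases β with
    | zero =>
      obtain ⟨b, rfl⟩ : ∃ b, a = b + 1 := ⟨a - 1, by omega⟩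
      simp [tau, g_00]
    | succ b =>
      simp only [tau]
      rw [g_j0, g_0k', multichoose_symm]
      have : -z ≠ 0 := neg_ne_zero.2 hz
      rw [neg_pow z, neg_pow z⁻¹]
      have e : ((-1 : K) ^ (a + 1))⁻¹ = -(-1) ^ a := by
        rw [← inv_pow, pow_succ]; norm_num
      rw [mul_inv, e, pow_succ, pow_succ]
      simp only [inv_pow, pow_zero, inv_one, mul_one, one_mul, add_zero]
      field_simp
      ring

theorem F_cyc (x y z : K) (α β γ : ℕ) : F x y z α β γ = F y z x β γ α := by
  unfold F; ring

theorem F_rec (x y z : K) (hx : x ≠ 0) (hy : y ≠ 0) (hz : z ≠ 0) (h : x + y + z = 0) (α β γ : ℕ) :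
    x * F x y z α (β + 1) (γ + 1) + y * F x y z (α + 1) β (γ + 1)
      + z * F x y z (α + 1) (β + 1) γ = 0 := by
  have h1 := tau_rec x y z hy hz h α β γ
  have h2 := tau_rec y z x hz hx (by linear_combination h) β γ α
  have h3 := tau_rec z x y hx hy (by linear_combination h) γ α β
  unfold F
  linear_combination h1 + h2 + h3

theorem F_zero (x y z : K) (hx : x ≠ 0) (hy : y ≠ 0) (hz : z ≠ 0) (h : x + y + z = 0) (k : ℕ) :
    ∀ α β γ : ℕ, α + β = k → 2 ≤ α + β + γ → F x y z α β γ = 0 := by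
  induction k with
  | zero =>
    intro α β γ h1 h2
    obtain ⟨rfl, rfl⟩ : α = 0 ∧ β = 0 := by omega
    rw [F_cyc]
    exact F_bdry _ _ _ hx _ _ (by omega)
  | succ k ih =>
    intro α β γ h1 h2
    cases α with
    | zero =>
      rw [F_cyc]; exact F_bdry _ _ _ hx _ _ (by omega)
    | succ a =>
      cases β with
      | zero => rw [← F_cyc z x y]; exact F_bdry _ _ _ hy _ _ (by omega)
      | succ b =>
        have := F_rec x y z hx hy hz h a b γ
        rw [ih a (b + 1) (γ + 1) (by omega) (by omega), ih (a + 1) b (γ + 1) (by omega) (by omega)] at this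
        simpa [hz] using this

theorem pade_field (x y z : K) (hx : x ≠ 0) (hy : y ≠ 0) (hz : z ≠ 0) (h : x + y + z = 0) (k : ℕ) :
    x ^ (2 * (k + 1)) * (y * g (-y) z k (k + 2) (k + 1)) + y ^ (2 * (k + 1)) * g (-z) x (k + 1) (k + 1) (k + 1)
      - z ^ (2 * (k + 1)) * (y * g (-x) y k (k + 1) (k + 2)) = 0 := by
  have hF := F_zero x y z hx hy hz h _ (k + 1) (k + 2) (k + 1) rfl (by omega)
  unfold F at hF
  simp only [tau] at hF
  have s : ∀ a b : K, a ≠ 0 → b ≠ 0 → ∀ n i j, g (-b⁻¹) a⁻¹ n i j = ((a * b) ^ n)⁻¹ * g (-a) b n i j := by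
    intro a b ha hb n i j
    rw [← inv_pow, ← g_smul]
    congr 1 <;> field_simp
  rw [s y z hy hz, s z x hz hx, s x y hx hy] at hF
  generalize g (-y) z k (k + 2) (k + 1) = G1 at *
  generalize g (-z) x (k + 1) (k + 1) (k + 1) = G2 at *
  generalize g (-x) y k (k + 1) (k + 2) = G3 at *
  have e : ∀ n : ℕ, ((-1 : K) ^ n)⁻¹ = (-1) ^ n := by
    intro n; rw [← inv_pow]; norm_num
  have ee : (-1 : K) ^ (k + 1) * (-1) ^ (k + 1) = 1 := by rw [← mul_pow]; simp
  have key : (-1 : K) ^ (k + 1) * x ^ (2 * (k + 1)) * y ^ (2 * (k + 1)) * z ^ (2 * (k + 1)) *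
    ((z ^ (k + 2))⁻¹ * ((-y) ^ (k + 1))⁻¹ * (((y * z) ^ k)⁻¹ * G1) +
      (x ^ (k + 1))⁻¹ * ((-z) ^ (k + 1))⁻¹ * (((z * x) ^ (k + 1))⁻¹ * G2) +
      (y ^ (k + 1))⁻¹ * ((-x) ^ (k + 2))⁻¹ * (((x * y) ^ k)⁻¹ * G3)) = 0 := by rw [hF, mul_zero]
  rw [← key]
  rw [neg_pow y, neg_pow z, neg_pow x, mul_inv, mul_inv, mul_inv, e, e]
  have q1 : x ^ (2 * (k + 1)) * (y * G1) = ((-1 : K) ^ (k + 1) * (-1) ^ (k + 1)) * (x ^ (2 * (k + 1)) * y ^ (2 * (k + 1)) * z ^ (2 * (k + 1)) *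
    ((z ^ (k + 2))⁻¹ * ((y) ^ (k + 1))⁻¹ * (((y * z) ^ k)⁻¹ * G1))) := by
    rw [ee, one_mul, mul_pow]
    field_simp
    ring
  have q2 : y ^ (2 * (k + 1)) * (G2) = ((-1 : K) ^ (k + 1) * (-1) ^ (k + 1)) * (x ^ (2 * (k + 1)) * y ^ (2 * (k + 1)) * z ^ (2 * (k + 1)) *
    ((x ^ (k + 1))⁻¹ * ((z) ^ (k + 1))⁻¹ * (((z * x) ^ (k + 1))⁻¹ * G2))) := by
    rw [ee, one_mul, mul_pow]
    field_simp
    ring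
  have q3 : z ^ (2 * (k + 1)) * (y * G3) = ((-1 : K) ^ (k + 1) * (-1) ^ (k + 1)) * (x ^ (2 * (k + 1)) * y ^ (2 * (k + 1)) * z ^ (2 * (k + 1)) *
    ((y ^ (k + 1))⁻¹ * ((x) ^ (k + 2))⁻¹ * (((x * y) ^ k)⁻¹ * G3))) := by
    rw [ee, one_mul, mul_pow]
    field_simp
    ring
  rw [q1, q2, q3]
  have e3 : (-1 : K) ^ (k + 2) = - (-1) ^ (k + 1) := by rw [pow_succ]; ring
  rw [e3]
  ring

theorem pade {R : Type*} [CommRing R] [IsDomain R] (x y z : R) (hx : x ≠ 0) (hy : y ≠ 0)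
    (hz : z ≠ 0) (h : x + y + z = 0) (k : ℕ) :
    x ^ (2 * (k + 1)) * (y * g (-y) z k (k + 2) (k + 1)) + y ^ (2 * (k + 1)) * g (-z) x (k + 1) (k + 1) (k + 1)
      + z ^ (2 * (k + 1)) * -(y * g (-x) y k (k + 1) (k + 2)) = 0 := by
  let f := algebraMap R (FractionRing R)
  have hf : Function.Injective f := IsFractionRing.injective R (FractionRing R)
  have := pade_field (f x) (f y) (f z) ((map_ne_zero_iff f hf).2 hx) ((map_ne_zero_iff f hf).2 hy)
    ((map_ne_zero_iff f hf).2 hz) (by rw [← map_add, ← map_add, h, map_zero]) k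
  apply hf
  simp only [map_add, map_mul, map_pow, map_neg, g_map, map_zero]
  linear_combination this

open Polynomial in
theorem pade_det (k : ℕ) (y : K) [CharZero K] :
    g (-(-1 - y)) 1 (k + 1) (k + 1) (k + 1) * g (-1) y (k + 1) (k + 1) (k + 1)
    - (-(y * g (-1) y k (k + 1) (k + 2))) * ((-1 - y) * g (-(-1 - y)) 1 k (k + 2) (k + 1)) ≠ 0 := by
  set x : ℚ[X] := 1 with hx
  set z : ℚ[X] := -1 - X with hz
  have hz0 : z ≠ 0 := by
    intro h
    have := congrArg (eval 0) h
    simp [hz] at this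
  have p1 := pade x X z one_ne_zero X_ne_zero hz0 (by rw [hx, hz]; ring) k
  have p2 := pade X z x X_ne_zero hz0 one_ne_zero (by rw [hx, hz]; ring) k
  set A1 := X * g (-X) z k (k + 2) (k + 1)
  set A2 := g (-z) x (k + 1) (k + 1) (k + 1) with hA2
  set A3 := -(X * g (-x) X k (k + 1) (k + 2)) with hA3
  set B1 := -(z * g (-X) z k (k + 1) (k + 2))
  set B2 := z * g (-z) x k (k + 2) (k + 1) with hB2
  set B3 := g (-x) X (k + 1) (k + 1) (k + 1) with hB3
  set D := A2 * B3 - A3 * B2 with hD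
  have e : A3 * B1 - A1 * B3 = D * X ^ (2 * (k + 1)) := by
    rw [hx, one_pow] at p1 p2
    rw [hD]
    linear_combination A3 * p2 - B3 * p1
  have dx : (-x).natDegree ≤ 1 := by rw [hx]; simp
  have dx' : (x).natDegree ≤ 1 := by rw [hx]; simp
  have dX : (-X : ℚ[X]).natDegree ≤ 1 := by simp
  have dX' : (X : ℚ[X]).natDegree ≤ 1 := by simp
  have dz : z.natDegree ≤ 1 := by
    rw [hz]
    refine (natDegree_sub_le _ _).trans ?_
    simp
  have dl : (A3 * B1 - A1 * B3).natDegree ≤ 2 * (k + 1) := by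
    have key : ∀ a b : ℚ[X], a.natDegree ≤ 1 → b.natDegree ≤ k → (a * b).natDegree ≤ k + 1 := by
      intro a b ha hb
      exact natDegree_mul_le.trans (by omega)
    have d1 : A1.natDegree ≤ k + 1 := key _ _ dX' (g_deg _ _ dX dz _ _ _)
    have d3 : A3.natDegree ≤ k + 1 := by
      rw [hA3, natDegree_neg]; exact key _ _ dX' (g_deg _ _ dx dX' _ _ _)
    have f1 : B1.natDegree ≤ k + 1 := by
      rw [natDegree_neg]; exact key _ _ dz (g_deg _ _ dX dz _ _ _)
    have f3 : B3.natDegree ≤ k + 1 := g_deg _ _ dx dX' _ _ _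
    refine (natDegree_sub_le _ _).trans (max_le ?_ ?_)
    · exact natDegree_mul_le.trans (by omega)
    · exact natDegree_mul_le.trans (by omega)
  have hD0 : D.eval 0 ≠ 0 := by
    have t2 : eval 0 A2 = (Nat.multichoose (k + 1 + (k + 1)) (k + 1) : ℚ) := by
      rw [← g_11, hA2, ← coe_evalRingHom, g_map]
      simp [hz, hx]
    have t3 : eval 0 B3 = (Nat.multichoose (k + 1) (k + 1) : ℚ) * (-1) ^ (k + 1) := by
      rw [← g_q0 _ (k + 1) (k + 1) (k + 1), hB3, ← coe_evalRingHom, g_map]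
      simp [hx]
    have t4 : eval 0 A3 = 0 := by rw [hA3]; simp
    rw [hD, eval_sub, eval_mul, eval_mul, t2, t3, t4, zero_mul, sub_zero]
    have hm : ∀ a b : ℕ, Nat.multichoose (a + 1) b ≠ 0 := by
      intro a b
      rw [Nat.multichoose_eq]
      exact (Nat.choose_pos (by omega)).ne'
    refine mul_ne_zero (Nat.cast_ne_zero.2 (hm _ _)) (mul_ne_zero (Nat.cast_ne_zero.2 (hm _ _)) ?_)
    exact pow_ne_zero _ (by norm_num)
  have hDne : D ≠ 0 := by rintro h; simp [h] at hD0
  have hdeg : D.natDegree = 0 := by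
    rw [e, natDegree_mul hDne (pow_ne_zero _ X_ne_zero), natDegree_X_pow] at dl
    omega
  obtain ⟨c, hc⟩ := natDegree_eq_zero.1 hdeg
  have hc0 : c ≠ 0 := by rintro rfl; simp at hc; exact hDne hc.symm
  have hev : aeval y D = algebraMap ℚ K c := by rw [← hc]; simp
  have hev2 : aeval y D = g (-(-1 - y)) 1 (k + 1) (k + 1) (k + 1) * g (-1) y (k + 1) (k + 1) (k + 1)
    - (-(y * g (-1) y k (k + 1) (k + 2))) * ((-1 - y) * g (-(-1 - y)) 1 k (k + 2) (k + 1)) := by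
    rw [hD, hA2, hA3, hB2, hB3]
    have gm : ∀ (p q : ℚ[X]) (n i j : ℕ), aeval y (g p q n i j) = g (aeval y p) (aeval y q) n i j :=
      fun p q n i j => g_map p q (aeval y : ℚ[X] →ₐ[ℚ] K).toRingHom n i j
    simp only [map_sub, map_mul, map_neg, gm, hz, hx, map_one, aeval_X]
  rw [← hev2, hev]
  simpa using hc0

end pade

theorem SN {K : Type*} [Field K] [NumberField K] (r : K)
    (hr : r * (1 + r) * (r ^ 2 + r + 1) ≠ 0) (m n : ℕ)
    (h1 : 1 + r ^ m = (1 + r) ^ m) (h2 : 1 + r ^ n = (1 + r) ^ n) (N D : ℕ) (hN : 1 ≤ N)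
    (hD1 : n + D ≤ 3 * (N * m)) (hD2 : 3 * (N * m) + D ≤ 2 * n)
    (hC : (Nat.choose (3 * N) N : ℝ) ^ 10 < (27 / 4) ^ D) : False := by
  obtain ⟨k, rfl⟩ : ∃ k, N = k + 1 := ⟨N - 1, by omega⟩
  have hr0 : r ≠ 0 := by rintro rfl; simp at hr
  have hs0 : 1 + r ≠ 0 := by intro h; simp [h] at hr
  obtain ⟨e, W₁, W₂, W₃, hW, he⟩ : ∃ (e : ℕ) (W₁ W₂ W₃ : K), WV r m (2 * (k + 1)) e W₁ W₂ W₃ ∧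
      (k + 1) * m + e + D ≤ 2 * (k + 1) * m := by
    have q : 2 * (k + 1) * m = 2 * ((k + 1) * m) := by ring
    by_cases hn : 2 * (k + 1) * m ≤ n
    · obtain ⟨t, ht⟩ : ∃ t, n = 2 * (k + 1) * m + t := ⟨n - 2 * (k + 1) * m, by omega⟩
      exact ⟨_, _, _, _, wpos r m n _ t ht h2, by omega⟩
    · obtain ⟨t, ht⟩ : ∃ t, n + t = 2 * (k + 1) * m := ⟨2 * (k + 1) * m - n, by omega⟩
      exact ⟨_, _, _, _, wneg r hr0 hs0 m n _ t ht h2, by omega⟩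
  set y := r ^ m with hy
  set z := -(1 + r) ^ m with hz
  have hx : 1 + y + z = 0 := by rw [hz, ← h1]; ring
  have hx' : z = -1 - y := by linear_combination hx
  have bx : ∀ (v : K → ℝ) (θ : ℕ), IsPl v θ → Bd v θ 1 1 (MM v r ^ m) :=
    fun v θ hv => Bd.one hv r m
  have by_ : ∀ (v : K → ℝ) (θ : ℕ), IsPl v θ → Bd v θ y 1 (MM v r ^ m) :=
    fun v θ hv => Bd.rpow hv r m m le_rfl
  have bz : ∀ (v : K → ℝ) (θ : ℕ), IsPl v θ → Bd v θ z 1 (MM v r ^ m) :=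
    fun v θ hv => (Bd.spow hv r m m le_rfl).neg hv
  have hy0 : y ≠ 0 := pow_ne_zero _ hr0
  have hz0 : z ≠ 0 := neg_ne_zero.2 (pow_ne_zero _ hs0)
  have p1 := pade 1 y z one_ne_zero hy0 hz0 hx k
  have p2 := pade y z 1 hy0 hz0 one_ne_zero (by linear_combination hx) k
  -- constants
  set c1 := Nat.multichoose (2 * k + 3) k with hc1
  set c2 := Nat.multichoose (2 * k + 2) (k + 1) with hc2
  have c1' : c1 = Nat.choose (3 * k + 2) k := by rw [hc1, Nat.multichoose_eq]; congr 1; omega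
  have c2' : c2 = Nat.choose (3 * k + 2) (k + 1) := by rw [hc2, Nat.multichoose_eq]; congr 1; omega
  have c12 : c1 + c2 = Nat.choose (3 * (k + 1)) (k + 1) := by
    rw [c1', c2', show 3 * (k + 1) = (3 * k + 2) + 1 by ring, Nat.choose_succ_succ (3 * k + 2) k]
  have c11 : c1 ≤ c2 := by
    rw [c1', c2']; exact Nat.choose_le_succ_of_lt_half_left (by omega)
  have bg : ∀ (v : K → ℝ) (θ : ℕ), IsPl v θ → ∀ w p q : K, Bd v θ w 1 (MM v r ^ m) → Bd v θ p 1 (MM v r ^ m) →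
      Bd v θ q 1 (MM v r ^ m) → Bd v θ (w * g p q k (k + 2) (k + 1)) c1 (MM v r ^ ((k + 1) * m)) := by
    intro v θ hv w p q hw hp hq
    have hM := one_le_MM v r
    have := hw.mul hv (g_bd hv (by positivity) hp hq k (k + 2) (k + 1))
    rwa [one_mul, ← pow_succ', ← pow_mul, mul_comm m, show k + 2 + (k + 1) = 2 * k + 3 by ring] at this
  have bg' : ∀ (v : K → ℝ) (θ : ℕ), IsPl v θ → ∀ w p q : K, Bd v θ w 1 (MM v r ^ m) → Bd v θ p 1 (MM v r ^ m) →
      Bd v θ q 1 (MM v r ^ m) → Bd v θ (-(w * g p q k (k + 1) (k + 2))) c1 (MM v r ^ ((k + 1) * m)) := by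
    intro v θ hv w p q hw hp hq
    have hM := one_le_MM v r
    have := hw.mul hv (g_bd hv (by positivity) hp hq k (k + 1) (k + 2))
    rw [one_mul, ← pow_succ', ← pow_mul, mul_comm m, show k + 1 + (k + 2) = 2 * k + 3 by ring] at this
    exact this.neg hv
  have bg2 : ∀ (v : K → ℝ) (θ : ℕ), IsPl v θ → ∀ p q : K, Bd v θ p 1 (MM v r ^ m) →
      Bd v θ q 1 (MM v r ^ m) → Bd v θ (g p q (k + 1) (k + 1) (k + 1)) c2 (MM v r ^ ((k + 1) * m)) := by
    intro v θ hv p q hp hq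
    have hM := one_le_MM v r
    have := (g_bd hv (by positivity) hp hq (k + 1) (k + 1) (k + 1))
    rwa [← pow_mul, mul_comm m, show k + 1 + (k + 1) = 2 * k + 2 by ring] at this
  rw [one_pow] at p1 p2
  obtain ⟨a1, a2, a3⟩ := cross r hr m (2 * (k + 1)) e ((k + 1) * m) _ D _ _ _ hW
    (y * g (-y) z k (k + 2) (k + 1)) (g (-z) 1 (k + 1) (k + 1) (k + 1)) (-(y * g (-1) y k (k + 1) (k + 2)))
    (by linear_combination p1) c1 c2 c1 c12.le (by omega) (by omega)
    (fun v θ hv => bg v θ hv _ _ _ (by_ v θ hv) ((by_ v θ hv).neg hv) (bz v θ hv))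
    (fun v θ hv => bg2 v θ hv _ _ ((bz v θ hv).neg hv) (bx v θ hv))
    (fun v θ hv => bg' v θ hv _ _ _ (by_ v θ hv) ((bx v θ hv).neg hv) (by_ v θ hv))
    he hC
  obtain ⟨b1, b2, b3⟩ := cross r hr m (2 * (k + 1)) e ((k + 1) * m) _ D _ _ _ hW
    (-(z * g (-y) z k (k + 1) (k + 2))) (z * g (-z) 1 k (k + 2) (k + 1)) (g (-1) y (k + 1) (k + 1) (k + 1))
    (by linear_combination p2) c1 c1 c2 (by omega) (by omega) (by omega)
    (fun v θ hv => bg' v θ hv _ _ _ (bz v θ hv) ((by_ v θ hv).neg hv) (bz v θ hv))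
    (fun v θ hv => bg v θ hv _ _ _ (bz v θ hv) ((bz v θ hv).neg hv) (bx v θ hv))
    (fun v θ hv => bg2 v θ hv _ _ ((bx v θ hv).neg hv) (by_ v θ hv))
    he hC
  have hdet := pade_det k y
  rw [← hx'] at hdet
  generalize g (-z) 1 (k + 1) (k + 1) (k + 1) = S2 at *
  generalize g (-1) y (k + 1) (k + 1) (k + 1) = S3' at *
  generalize -(y * g (-1) y k (k + 1) (k + 2)) = S3 at *
  generalize z * g (-z) 1 k (k + 2) (k + 1) = S2' at *
  generalize y * g (-y) z k (k + 2) (k + 1) = S1 at *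
  generalize -(z * g (-y) z k (k + 1) (k + 2)) = S1' at *
  apply hdet
  have : W₁ ^ 2 * (S2 * S3' - S3 * S2') = 0 := by
    linear_combination -a3 * S3' * W₁ + b2 * S1 * W₂ - a2 * S2' * W₁ + b3 * S1 * W₃
  rcases mul_eq_zero.1 this with h | h
  · exact absurd h (pow_ne_zero _ hW.ne)
  · exact h

end Beukers


namespace Beukers

theorem choose_ratio (N : ℕ) :
    4 * Nat.choose (3 * (N + 1)) (N + 1) ≤ 27 * Nat.choose (3 * N) N := by
  have h1 := Nat.add_choose_mul_factorial_mul_factorial (2 * N) N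
  have h2 := Nat.add_choose_mul_factorial_mul_factorial (2 * N + 2) (N + 1)
  rw [show 2 * N + N = 3 * N by ring] at h1
  rw [show 2 * N + 2 + (N + 1) = 3 * N + 3 by ring] at h2
  rw [show 3 * (N + 1) = 3 * N + 3 by ring]
  simp only [Nat.factorial_succ] at h2
  set a := (3 * N).choose N
  set b := (3 * N + 3).choose (N + 1)
  have f1 := Nat.factorial_pos N
  have f2 := Nat.factorial_pos (2 * N)
  rw [← h1] at h2
  have h3 : (N.factorial * (2 * N).factorial * (N + 1)) * (b * ((2 * N + 2) * (2 * N + 1))) =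
      (N.factorial * (2 * N).factorial * (N + 1)) * (3 * ((3 * N + 2) * (3 * N + 1)) * a) := by
    linear_combination h2
  have h4 := Nat.eq_of_mul_eq_mul_left (by positivity) h3
  have h5 : ((2 * N + 2) * (2 * N + 1)) * (4 * b) ≤ ((2 * N + 2) * (2 * N + 1)) * (27 * a) := by
    calc ((2 * N + 2) * (2 * N + 1)) * (4 * b) = 4 * (b * ((2 * N + 2) * (2 * N + 1))) := by ring
      _ = 4 * (3 * ((3 * N + 2) * (3 * N + 1)) * a) := by rw [h4]
      _ = (4 * 3 * ((3 * N + 2) * (3 * N + 1))) * a := by ring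
      _ ≤ (27 * ((2 * N + 2) * (2 * N + 1))) * a := by gcongr ?_ * a; nlinarith
      _ = _ := by ring
  exact Nat.le_of_mul_le_mul_left h5 (by positivity)

theorem choose_ratio' (N : ℕ) (D : ℕ)
    (h : (Nat.choose (3 * N) N : ℝ) ^ 10 < (27 / 4) ^ D) :
    (Nat.choose (3 * (N + 1)) (N + 1) : ℝ) ^ 10 < (27 / 4) ^ (D + 10) := by
  have h1 : (4 : ℝ) * Nat.choose (3 * (N + 1)) (N + 1) ≤ 27 * Nat.choose (3 * N) N := by
    exact_mod_cast choose_ratio N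
  have h2 : (Nat.choose (3 * (N + 1)) (N + 1) : ℝ) ≤ 27 / 4 * Nat.choose (3 * N) N := by linarith
  calc (Nat.choose (3 * (N + 1)) (N + 1) : ℝ) ^ 10 ≤ (27 / 4 * Nat.choose (3 * N) N) ^ 10 := by gcongr
    _ = (Nat.choose (3 * N) N : ℝ) ^ 10 * (27 / 4) ^ 10 := by ring
    _ < (27 / 4) ^ D * (27 / 4) ^ 10 := by gcongr
    _ = _ := by rw [pow_add]

theorem ch1 : (Nat.choose (3 * 1) 1 : ℝ) ^ 10 < (27 / 4) ^ 6 := by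
  rw [show Nat.choose (3 * 1) 1 = 3 by decide]; norm_num
theorem ch2 : (Nat.choose (3 * 2) 2 : ℝ) ^ 10 < (27 / 4) ^ 15 := by
  rw [show Nat.choose (3 * 2) 2 = 15 by decide]; norm_num
theorem ch3 : (Nat.choose (3 * 3) 3 : ℝ) ^ 10 < (27 / 4) ^ 24 := by
  rw [show Nat.choose (3 * 3) 3 = 84 by decide]; norm_num
theorem ch4 : (Nat.choose (3 * 4) 4 : ℝ) ^ 10 < (27 / 4) ^ 33 := by
  rw [show Nat.choose (3 * 4) 4 = 495 by decide]; norm_num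
theorem ch5 : (Nat.choose (3 * 5) 5 : ℝ) ^ 10 < (27 / 4) ^ 42 := by
  rw [show Nat.choose (3 * 5) 5 = 3003 by decide]; norm_num
theorem ch6 : (Nat.choose (3 * 6) 6 : ℝ) ^ 10 < (27 / 4) ^ 52 := by
  rw [show Nat.choose (3 * 6) 6 = 18564 by decide]; norm_num
theorem ch7 : (Nat.choose (3 * 7) 7 : ℝ) ^ 10 < (27 / 4) ^ 62 := by
  rw [show Nat.choose (3 * 7) 7 = 116280 by decide +kernel]; norm_num

theorem chN (N : ℕ) : (Nat.choose (3 * (N + 4)) (N + 4) : ℝ) ^ 10 < (27 / 4) ^ (10 * N + 33) := by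
  induction N with
  | zero => exact ch4
  | succ N ih => exact choose_ratio' _ _ ih

theorem chN' (N : ℕ) : (Nat.choose (3 * (N + 7)) (N + 7) : ℝ) ^ 10 < (27 / 4) ^ (10 * N + 62) := by
  induction N with
  | zero => exact ch7
  | succ N ih => exact choose_ratio' _ _ ih

section
variable {K : Type*} [Field K] [NumberField K] (r : K)
    (hr : r * (1 + r) * (r ^ 2 + r + 1) ≠ 0) (m n : ℕ)
    (h1 : 1 + r ^ m = (1 + r) ^ m) (h2 : 1 + r ^ n = (1 + r) ^ n) (hmn : m < n)
include hr h1 h2 hmn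

theorem chain12 (hm : 12 ≤ m) : (m = 12 ∧ 85 ≤ n ∧ n ≤ 88) ∨ (m = 13 ∧ n = 94) := by
  by_contra hcon
  by_cases c0 : n + 4 ≤ 2 * m
  · exact T0 r hr m n h1 h2 hmn c0
  by_cases c1 : n + 6 ≤ 3 * m
  · exact SN r hr m n h1 h2 1 6 le_rfl (by omega) (by omega) ch1
  by_cases c2 : n + 4 ≤ 4 * m
  · exact T1 r hr m n h1 h2 (by omega) (by omega) c2
  by_cases c3 : n + 15 ≤ 6 * m
  · exact SN r hr m n h1 h2 2 15 (by norm_num) (by omega) (by omega) ch2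
  by_cases c4 : n + 16 ≤ 7 * m
  · exact T2 r hr m n h1 h2 (by omega) c4
  by_cases c5 : n + 24 ≤ 9 * m
  · exact SN r hr m n h1 h2 3 24 (by norm_num) (by omega) (by omega) ch3
  -- now 2 n ≥ 12 m + 33
  have c6 : 12 * m + 33 ≤ 2 * n := by omega
  have hpos : 0 < 3 * m + 10 := by omega
  have hN4 : 4 ≤ (2 * n + 7) / (3 * m + 10) := by
    rw [Nat.le_div_iff_mul_le hpos]; omega
  have hlo := Nat.div_mul_le_self (2 * n + 7) (3 * m + 10)
  have hhi := Nat.lt_mul_div_succ (2 * n + 7) hpos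
  obtain ⟨N, hN⟩ : ∃ N, (2 * n + 7) / (3 * m + 10) = N + 4 :=
    ⟨(2 * n + 7) / (3 * m + 10) - 4, by omega⟩
  rw [hN] at hlo hhi
  have hNm : 12 * N ≤ N * m := by nlinarith
  refine SN r hr m n h1 h2 (N + 4) (10 * N + 33) (by omega) ?_ ?_ (chN N)
  · have e1 : (3 * m + 10) * (N + 4 + 1) = 3 * (N * m) + 15 * m + 10 * N + 50 := by ring
    have e2 : 3 * ((N + 4) * m) = 3 * (N * m) + 12 * m := by ring
    omega
  · have e1 : (N + 4) * (3 * m + 10) = 3 * (N * m) + 12 * m + 10 * N + 40 := by ring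
    have e2 : 3 * ((N + 4) * m) = 3 * (N * m) + 12 * m := by ring
    omega

theorem chain11 (hm : m = 11) : n = 19 ∨ (76 ≤ n ∧ n ≤ 82) ∨ (100 ≤ n ∧ n ≤ 103) ∨ n = 124 := by
  by_contra hcon
  subst hm
  by_cases c0 : n + 4 ≤ 2 * 11
  · exact T0 r hr 11 n h1 h2 hmn c0
  by_cases c1 : n + 6 ≤ 3 * 11
  · exact SN r hr 11 n h1 h2 1 6 le_rfl (by omega) (by omega) ch1
  by_cases c2 : n + 4 ≤ 4 * 11
  · exact T1 r hr 11 n h1 h2 (by omega) (by omega) c2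
  by_cases c3 : n + 15 ≤ 6 * 11
  · exact SN r hr 11 n h1 h2 2 15 (by norm_num) (by omega) (by omega) ch2
  by_cases c4 : n + 16 ≤ 7 * 11
  · exact T2 r hr 11 n h1 h2 (by omega) c4
  by_cases c5 : n + 24 ≤ 9 * 11
  · exact SN r hr 11 n h1 h2 3 24 (by norm_num) (by omega) (by omega) ch3
  by_cases c6 : n + 33 ≤ 12 * 11
  · exact SN r hr 11 n h1 h2 4 33 (by norm_num) (by omega) (by omega) ch4
  by_cases c7 : n + 42 ≤ 15 * 11
  · exact SN r hr 11 n h1 h2 5 42 (by norm_num) (by omega) (by omega) ch5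
  by_cases c8 : n + 52 ≤ 18 * 11
  · exact SN r hr 11 n h1 h2 6 52 (by norm_num) (by omega) (by omega) ch6
  obtain ⟨N, hN⟩ : ∃ N, (2 * n + 8) / 43 = N + 7 := ⟨(2 * n + 8) / 43 - 7, by omega⟩
  exact SN r hr 11 n h1 h2 (N + 7) (10 * N + 62) (by omega) (by omega) (by omega) (chN' N)
end

end Beukers


namespace Beukers

/-- linear recurrence of order three -/
def lrec (c0 c1 c2 : ℤ) : ℕ → ℤ → ℤ → ℤ → ℤ
  | 0, p, _, _ => p
  | n + 1, p, q, s => lrec c0 c1 c2 n q s (c0 * p + c1 * q + c2 * s)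

theorem lrec_spec (c0 c1 c2 : ℤ) (x y z : ℂ) (hx : x ^ 3 = c0 + c1 * x + c2 * x ^ 2)
    (hy : y ^ 3 = c0 + c1 * y + c2 * y ^ 2) (hz : z ^ 3 = c0 + c1 * z + c2 * z ^ 2) (n : ℕ) :
    ∀ (k : ℕ) (p q s : ℤ), (p : ℂ) = x ^ k + y ^ k + z ^ k →
    (q : ℂ) = x ^ (k + 1) + y ^ (k + 1) + z ^ (k + 1) →
    (s : ℂ) = x ^ (k + 2) + y ^ (k + 2) + z ^ (k + 2) →
    (lrec c0 c1 c2 n p q s : ℂ) = x ^ (k + n) + y ^ (k + n) + z ^ (k + n) := by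
  induction n with
  | zero => intro k p q s h1 h2 h3; simpa [lrec] using h1
  | succ n ih =>
    intro k p q s h1 h2 h3
    rw [lrec, show k + (n + 1) = (k + 1) + n by ring]
    apply ih (k + 1) _ _ _ h2 h3
    push_cast
    rw [h1, h2, h3]
    linear_combination (-x ^ k) * hx - y ^ k * hy - z ^ k * hz

theorem eleven (r : ℂ) (hr : r * (r + 1) * (r ^ 2 + r + 1) ≠ 0) (n : ℕ)
    (h1 : 1 + r ^ 11 = (1 + r) ^ 11) (h2 : 1 + r ^ n = (1 + r) ^ n)
    (hn : n = 19 ∨ (76 ≤ n ∧ n ≤ 82) ∨ (100 ≤ n ∧ n ≤ 103) ∨ n = 124) : False := by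
  have hq0 : r ^ 2 + r + 1 ≠ 0 := fun h => hr (by rw [h, mul_zero])
  have hs0 : r + 1 ≠ 0 := fun h => hr (by rw [h]; ring)
  have hr0 : r ≠ 0 := fun h => hr (by rw [h]; ring)
  have hcub : (r ^ 2 + r + 1) ^ 3 = -(r * (r + 1)) ^ 2 := by
    have : (11 * (r * (r + 1) * (r ^ 2 + r + 1))) * ((r ^ 2 + r + 1) ^ 3 + (r * (r + 1)) ^ 2) = 0 := by
      linear_combination -h1
    rcases mul_eq_zero.1 this with h | h
    · exact absurd h (mul_ne_zero (by norm_num) hr)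
    · linear_combination h
  set q := r ^ 2 + r + 1 with hq
  obtain ⟨c, hc⟩ : ∃ c, c = q / (r * (r + 1)) := ⟨_, rfl⟩
  have hc0 : c ≠ 0 := by rw [hc]; exact div_ne_zero hq0 (mul_ne_zero hr0 hs0)
  have hcq : c * (r * (r + 1)) = q := by rw [hc]; field_simp
  have e2 : c ^ 2 * q = -1 := by
    rw [hc]; field_simp; linear_combination hcub
  have e3 : c ^ 3 * (r * (r + 1)) = -1 := by rw [← e2, ← hcq]; ring
  set x := c with hx
  obtain ⟨y, hy⟩ : ∃ y, y = c * r := ⟨_, rfl⟩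
  obtain ⟨z, hz⟩ : ∃ z, z = -(c * (1 + r)) := ⟨_, rfl⟩
  have s1 : x + y + z = 0 := by rw [hy, hz]; ring
  have s2 : x * y + y * z + z * x = 1 := by rw [hy, hz]; linear_combination -e2
  have s3 : x * y * z = 1 := by rw [hy, hz]; linear_combination -e3
  have hzz : z = -x - y := by linear_combination s1
  have cub : ∀ t, (t - x) * (t - y) * (t - z) = t ^ 3 + t - 1 := by
    intro t; linear_combination (-t ^ 2) * s1 + t * s2 - s3
  have cx : x ^ 3 = ((1 : ℤ) : ℂ) + ((-1 : ℤ) : ℂ) * x + ((0 : ℤ) : ℂ) * x ^ 2 := by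
    push_cast; linear_combination -cub x
  have cy : y ^ 3 = ((1 : ℤ) : ℂ) + ((-1 : ℤ) : ℂ) * y + ((0 : ℤ) : ℂ) * y ^ 2 := by
    push_cast; linear_combination -cub y
  have cz : z ^ 3 = ((1 : ℤ) : ℂ) + ((-1 : ℤ) : ℂ) * z + ((0 : ℤ) : ℂ) * z ^ 2 := by
    push_cast; linear_combination -cub z
  have ha := lrec_spec 1 (-1) 0 x y z cx cy cz n 0 3 0 (-2) (by norm_num)
    (by push_cast; linear_combination -s1)
    (by push_cast; linear_combination -(x + y + z) * s1 + 2 * s2)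
  rw [zero_add] at ha
  have cub' : ∀ t, (t - x * y) * (t - y * z) * (t - z * x) = t ^ 3 - t ^ 2 - 1 := by
    intro t
    linear_combination (-t ^ 2) * s2 + t * s1 * x * y * z - (x * y * z + 1) * s3
  have dx : (x * y) ^ 3 = ((1 : ℤ) : ℂ) + ((0 : ℤ) : ℂ) * (x * y) + ((1 : ℤ) : ℂ) * (x * y) ^ 2 := by
    push_cast; linear_combination -cub' (x * y)
  have dy : (y * z) ^ 3 = ((1 : ℤ) : ℂ) + ((0 : ℤ) : ℂ) * (y * z) + ((1 : ℤ) : ℂ) * (y * z) ^ 2 := by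
    push_cast; linear_combination -cub' (y * z)
  have dz : (z * x) ^ 3 = ((1 : ℤ) : ℂ) + ((0 : ℤ) : ℂ) * (z * x) + ((1 : ℤ) : ℂ) * (z * x) ^ 2 := by
    push_cast; linear_combination -cub' (z * x)
  have hb := lrec_spec 1 0 1 _ _ _ dx dy dz n 0 3 1 1 (by norm_num)
    (by push_cast; linear_combination -s2)
    (by push_cast; linear_combination -(x * y + y * z + z * x + 1) * s2 + 2 * x * y * z * s1)
  rw [zero_add] at hb
  have hyn : y ^ n = c ^ n * r ^ n := by rw [hy, mul_pow]
  rcases Nat.even_or_odd n with hev | hodd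
  · have hzn : z ^ n = c ^ n * (1 + r) ^ n := by rw [hz, hev.neg_pow, mul_pow]
    have hu : x ^ n + y ^ n = z ^ n := by rw [hyn, hzn, ← h2]; ring
    have s3n : x ^ n * y ^ n * z ^ n = 1 := by rw [← mul_pow, ← mul_pow, s3, one_pow]
    simp only [mul_pow] at hb
    have key : ((lrec 1 (-1) 0 n 3 0 (-2) * (4 * lrec 1 0 1 n 3 1 1 - lrec 1 (-1) 0 n 3 0 (-2) ^ 2) : ℤ) : ℂ) = ((8 : ℤ) : ℂ) := by
      push_cast
      rw [ha, hb, hu]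
      have : x ^ n * y ^ n + y ^ n * z ^ n + z ^ n * x ^ n = x ^ n * y ^ n + z ^ n * z ^ n := by
        rw [← hu]; ring
      rw [this]
      linear_combination 8 * s3n
    have key' : lrec 1 (-1) 0 n 3 0 (-2) ∣ 8 := Dvd.intro _ (by exact_mod_cast key)
    rcases hn with rfl | ⟨ha, hb⟩ | ⟨ha, hb⟩ | rfl
    · exact absurd hev (by decide)
    · clear * - key' ha hb hev
      interval_cases n <;> first | exact absurd hev (by decide) | exact absurd key' (by decide +kernel)
    · clear * - key' ha hb hev
      interval_cases n <;> first | exact absurd hev (by decide) | exact absurd key' (by decide +kernel)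
    · exact absurd key' (by decide +kernel)
  · have hzn : z ^ n = -(c ^ n * (1 + r) ^ n) := by rw [hz, hodd.neg_pow, mul_pow]
    have hu : x ^ n + y ^ n + z ^ n = 0 := by rw [hyn, hzn, ← h2]; ring
    rw [hu] at ha
    have key' : lrec 1 (-1) 0 n 3 0 (-2) = 0 := by exact_mod_cast ha
    rcases hn with rfl | ⟨ha, hb⟩ | ⟨ha, hb⟩ | rfl
    · exact absurd key' (by decide +kernel)
    · clear * - key' ha hb hodd
      interval_cases n <;> first | exact absurd hodd (by decide) | exact absurd key' (by decide +kernel)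
    · clear * - key' ha hb hodd
      interval_cases n <;> first | exact absurd hodd (by decide) | exact absurd key' (by decide +kernel)
    · exact absurd hodd (by decide)

end Beukers

namespace Beukers
section loc
set_option linter.unusedSectionVars false
variable {L : Type*} [NormedField L] [IsUltrametricDist L]

lemma u_add {x y : L} {c : ℝ} (hx : ‖x‖ ≤ c) (hy : ‖y‖ ≤ c) : ‖x + y‖ ≤ c :=
  (IsUltrametricDist.norm_add_le_max x y).trans (max_le hx hy)

lemma u_dom {x y : L} (h : ‖y‖ < ‖x‖) : ‖x + y‖ = ‖x‖ := by
  rw [IsUltrametricDist.norm_add_eq_max_of_norm_ne_norm h.ne', max_eq_left h.le]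

lemma u_nat (k : ℕ) : ‖(k : L)‖ ≤ 1 := IsUltrametricDist.norm_natCast_le_one L k

lemma u_mul {x y : L} (hx : ‖x‖ ≤ 1) (hy : ‖y‖ ≤ 1) : ‖x * y‖ ≤ 1 := by
  rw [norm_mul]; exact mul_le_one₀ hx (norm_nonneg _) hy

lemma u_pow {x : L} (hx : ‖x‖ ≤ 1) (k : ℕ) : ‖x ^ k‖ ≤ 1 := by
  rw [norm_pow]; exact pow_le_one₀ (norm_nonneg _) hx

lemma u_ofNat (k : ℕ) [k.AtLeastTwo] : ‖(OfNat.ofNat k : L)‖ ≤ 1 := by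
  have h : ((OfNat.ofNat k : ℕ) : L) = OfNat.ofNat k := Nat.cast_ofNat
  rw [← h]
  exact u_nat _

lemma u_unit {u r z : L} (hu : ‖u‖ = 1) (hz : ‖z‖ ≤ 1) (hr : ‖r‖ < 1) : ‖u + r * z‖ = 1 := by
  rw [u_dom, hu]
  rw [hu, norm_mul]
  exact (mul_le_of_le_one_right (norm_nonneg _) hz).trans_lt hr

lemma expand (d : L) (hd : ‖d‖ ≤ 1) (k : ℕ) :
    ∃ w : L, ‖w‖ ≤ 1 ∧ (1 + d) ^ k = 1 + k * d + d ^ 2 * w := by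
  induction k with
  | zero => exact ⟨0, by simp, by simp⟩
  | succ k ih =>
    obtain ⟨w, hw, h⟩ := ih
    refine ⟨w + k + d * w, u_add (u_add hw (u_nat k)) (u_mul hd hw), ?_⟩
    rw [pow_succ, h]; push_cast; ring

lemma coprime_pow {p : ℕ} (hp2 : ∀ k : ℕ, ¬ p ∣ k → ‖(k : L)‖ = 1) (d : L) (hd : ‖d‖ < 1)
    (k : ℕ) (hk : ¬ p ∣ k) : ‖(1 + d) ^ k - 1‖ = ‖d‖ := by
  obtain ⟨w, hw, h⟩ := expand d hd.le k
  have : (1 + d) ^ k - 1 = d * (k + d * w) := by rw [h]; ring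
  rw [this, norm_mul, u_unit (hp2 k hk) hw hd, mul_one]

/-- shape of `(1+d)^p` for the primes we need -/
lemma prime_shape {p : ℕ} (hp : p = 2 ∨ p = 3 ∨ p = 5) (d : L) (hd : ‖d‖ ≤ 1) :
    ∃ w : L, ‖w‖ ≤ 1 ∧ (1 + d) ^ p - 1 = p * (d * (1 + d * w)) + d ^ p := by
  rcases hp with rfl | rfl | rfl
  · exact ⟨0, by simp, by push_cast; ring⟩
  · exact ⟨1, by simp, by push_cast; ring⟩
  · refine ⟨2 + 2 * d + d ^ 2, u_add (u_add (u_ofNat 2) (u_mul (u_ofNat 2) hd)) (u_pow hd 2), ?_⟩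
    push_cast; ring

lemma small_p {p : ℕ} (hp : p = 2 ∨ p = 3 ∨ p = 5) (d : L) (hd : ‖d‖ ^ (p - 1) < ‖(p : L)‖) :
    ‖(1 + d) ^ p - 1‖ = ‖(p : L)‖ * ‖d‖ := by
  have hd1 : ‖d‖ < 1 := by
    by_contra h
    push Not at h
    exact absurd (hd.trans_le (u_nat p)) (not_lt.2 (one_le_pow₀ h))
  obtain ⟨w, hw, h⟩ := prime_shape hp d hd1.le
  by_cases h0 : d = 0
  · subst h0; simp
  have e : ‖(p : L) * (d * (1 + d * w))‖ = ‖(p : L)‖ * ‖d‖ := by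
    rw [norm_mul, norm_mul, u_unit norm_one hw hd1, mul_one]
  rw [h, u_dom, e]
  rw [e, norm_pow]
  have : p = (p - 1) + 1 := by omega
  calc ‖d‖ ^ p = ‖d‖ ^ (p - 1) * ‖d‖ := by rw [← pow_succ, ← this]
    _ < _ := by
      have : 0 < ‖d‖ := norm_pos_iff.2 h0
      gcongr

lemma small_pow {p : ℕ} (hp : p = 2 ∨ p = 3 ∨ p = 5) (hp2 : ∀ k : ℕ, ¬ p ∣ k → ‖(k : L)‖ = 1)
    (k : ℕ) : ∀ (d : L), ‖d‖ ^ (p - 1) < ‖(p : L)‖ → ‖(1 + d) ^ k - 1‖ = ‖(k : L)‖ * ‖d‖ := by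
  induction k using Nat.strong_induction_on with
  | _ k ih =>
    intro d hd
    have hd1 : ‖d‖ < 1 := by
      by_contra h
      push Not at h
      exact absurd (hd.trans_le (u_nat p)) (not_lt.2 (one_le_pow₀ h))
    by_cases hk : p ∣ k
    · obtain ⟨j, rfl⟩ := hk
      rcases Nat.eq_zero_or_pos j with rfl | hj
      · simp
      have e := small_p hp d hd
      have := ih j (by rcases hp with rfl | rfl | rfl <;> omega) ((1 + d) ^ p - 1) (by
        refine lt_of_le_of_lt ?_ hd
        rw [e]
        gcongr
        exact mul_le_of_le_one_left (norm_nonneg _) (u_nat p))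
      rw [e, add_sub_cancel, ← pow_mul] at this
      rw [this]; push_cast; rw [norm_mul]; ring
    · rw [coprime_pow hp2 d hd1 k hk, hp2 k hk, one_mul]

lemma pow_inj' {x : ℝ} (h0 : 0 < x) (h1 : x < 1) {a b : ℕ} (h : x ^ a = x ^ b) : a = b :=
  (pow_right_strictAnti₀ h0 h1).injective h

lemma nat_lower {p : ℕ} (hp : p.Prime) (hp1 : ‖(p : L)‖ = (p : ℝ)⁻¹)
    (hp2 : ∀ k : ℕ, ¬ p ∣ k → ‖(k : L)‖ = 1) (k : ℕ) (hk : 0 < k) : 1 ≤ ‖(k : L)‖ * k := by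
  induction k using Nat.strong_induction_on with
  | _ k ih =>
    by_cases h : p ∣ k
    · obtain ⟨j, rfl⟩ := h
      have hj : 0 < j := Nat.pos_of_mul_pos_left hk
      have := ih j (by nlinarith [hp.two_le]) hj
      push_cast
      rw [norm_mul, hp1]
      have : (p : ℝ) ≠ 0 := by exact_mod_cast hp.ne_zero
      field_simp
      linarith
    · rw [hp2 k h, one_mul]; exact_mod_cast hk

lemma loc_main {p : ℕ} (hp : p = 2 ∨ p = 3 ∨ p = 5) (hp1 : ‖(p : L)‖ = (p : ℝ)⁻¹)
    (hp2 : ∀ k : ℕ, ¬ p ∣ k → ‖(k : L)‖ = 1) (r : L) (hr : ‖r‖ ^ (p - 1) = ‖(p : L)‖)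
    (M n : ℕ) (hM : 0 < M) (hn : p * M < n)
    (h1 : 1 + r ^ (p * M) = (1 + r) ^ (p * M)) (h2 : 1 + r ^ n = (1 + r) ^ n) :
    ∃ N, n = p * N ∧ (p : ℝ) ^ (p * N - p * M) ≤ (‖(M : L)‖ * N) ^ (p - 1) := by
  have hpp : p.Prime := by rcases hp with rfl | rfl | rfl <;> norm_num
  have hp0 : (0 : ℝ) < p := by exact_mod_cast hpp.pos
  have hplt : ‖(p : L)‖ < 1 := by
    rw [hp1]; exact inv_lt_one_of_one_lt₀ (by exact_mod_cast hpp.one_lt)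
  have hppos : 0 < ‖(p : L)‖ := by rw [hp1]; positivity
  have hr1 : ‖r‖ < 1 := by
    by_contra h
    push Not at h
    exact absurd hplt (not_lt.2 (hr ▸ one_le_pow₀ h))
  have hr0 : 0 < ‖r‖ := by
    rcases (norm_nonneg r).lt_or_eq with h | h
    · exact h
    · rw [← h, zero_pow (by have := hpp.two_le; omega)] at hr; linarith
  have hdvd : p ∣ n := by
    by_contra h
    have e := coprime_pow hp2 r hr1 n h
    rw [← h2, add_sub_cancel_left, norm_pow] at e
    have := pow_inj' hr0 hr1 (e.trans (pow_one _).symm)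
    have := hpp.two_le
    nlinarith
  obtain ⟨N, rfl⟩ := hdvd
  refine ⟨N, rfl, ?_⟩
  have hNM : M < N := lt_of_mul_lt_mul_left hn (Nat.zero_le _)
  set d := (1 + r) ^ p - 1 with hd
  have hpow : ‖r‖ ^ p = ‖(p : L)‖ * ‖r‖ := by
    rw [← hr, ← pow_succ]; congr 1; have := hpp.two_le; omega
  have hdle : ‖d‖ ≤ ‖(p : L)‖ * ‖r‖ := by
    obtain ⟨w, hw, h⟩ := prime_shape hp r hr1.le
    rw [hd, h]
    refine u_add ?_ ?_
    · rw [norm_mul, norm_mul, u_unit norm_one hw hr1, mul_one]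
    · rw [norm_pow, hpow]
  have hds : ‖d‖ ^ (p - 1) < ‖(p : L)‖ := by
    calc ‖d‖ ^ (p - 1) ≤ (‖(p : L)‖ * ‖r‖) ^ (p - 1) := by gcongr
      _ = ‖(p : L)‖ ^ (p - 1) * ‖(p : L)‖ := by rw [mul_pow, hr]
      _ < 1 * ‖(p : L)‖ := by
        gcongr
        exact pow_lt_one₀ hppos.le hplt (by have := hpp.two_le; omega)
      _ = _ := one_mul _
  have e1 := small_pow hp hp2 M d hds
  have e2 := small_pow hp hp2 N d hds
  rw [hd, add_sub_cancel, ← pow_mul, ← h1, ← hd, add_sub_cancel_left, norm_pow] at e1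
  rw [hd, add_sub_cancel, ← pow_mul, ← h2, ← hd, add_sub_cancel_left, norm_pow] at e2
  have hMpos : 0 < ‖(M : L)‖ := by
    have := nat_lower hpp hp1 hp2 M hM
    by_contra h
    have h0 : ‖(M : L)‖ = 0 := le_antisymm (not_lt.1 h) (norm_nonneg _)
    rw [h0] at this
    linarith
  have hd0 : 0 < ‖d‖ := by
    rcases (norm_nonneg d).lt_or_eq with h | h
    · exact h
    · rw [← h, mul_zero] at e1
      exact absurd e1 (by positivity)
  have hsplit : ‖r‖ ^ (p * N) = ‖r‖ ^ (p * N - p * M) * ‖r‖ ^ (p * M) := by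
    rw [← pow_add]; congr 1; have := Nat.mul_le_mul_left p hNM.le; omega
  rw [hsplit, e1] at e2
  have e3 : ‖r‖ ^ (p * N - p * M) * ‖(M : L)‖ = ‖(N : L)‖ := by
    apply mul_right_cancel₀ hd0.ne'
    linarith
  have hN := nat_lower hpp hp1 hp2 N (by omega)
  rw [← e3] at hN
  have e4 : 1 ≤ (‖r‖ ^ (p * N - p * M) * ‖(M : L)‖ * N) ^ (p - 1) := one_le_pow₀ hN
  rw [mul_assoc, mul_pow, ← pow_mul, mul_comm (p * N - p * M) (p - 1), pow_mul, hr, hp1, inv_pow] at e4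
  rwa [inv_mul_eq_div, one_le_div (by positivity)] at e4

lemma loc_false {p : ℕ} (hp : p = 2 ∨ p = 3 ∨ p = 5) (hp1 : ‖(p : L)‖ = (p : ℝ)⁻¹)
    (hp2 : ∀ k : ℕ, ¬ p ∣ k → ‖(k : L)‖ = 1) (r : L) (hr : ‖r‖ ^ (p - 1) = ‖(p : L)‖)
    (M n : ℕ) (hM : 0 < M) (hM2 : ‖(M : L)‖ * M ≤ 2) (hn : p * M < n)
    (h1 : 1 + r ^ (p * M) = (1 + r) ^ (p * M)) (h2 : 1 + r ^ n = (1 + r) ^ n) : False := by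
  obtain ⟨N, rfl, h⟩ := loc_main hp hp1 hp2 r hr M n hM hn h1 h2
  have hNM : M < N := lt_of_mul_lt_mul_left hn (Nat.zero_le _)
  obtain ⟨j, rfl⟩ := Nat.exists_eq_add_of_lt hNM
  have e : p * (M + j + 1) - p * M = p * (j + 1) := by
    rw [Nat.add_assoc, Nat.mul_add]; omega
  rw [e, pow_mul] at h
  have h4 : ((4 : ℝ) ^ (j + 1)) ^ (p - 1) ≤ ((p : ℝ) ^ p) ^ (j + 1) := by
    rw [← pow_mul, mul_comm (j + 1), pow_mul]
    gcongr
    rcases hp with rfl | rfl | rfl <;> norm_num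
  have h5 := h4.trans h
  have h6 : (4 : ℝ) ^ (j + 1) ≤ ‖(M : L)‖ * ((M + j + 1 : ℕ) : ℝ) :=
    le_of_pow_le_pow_left₀ (by rcases hp with rfl | rfl | rfl <;> norm_num) (by positivity) h5
  have h7 : ((j : ℝ) + 1) ≤ 4 ^ j := by
    have : j + 1 ≤ 4 ^ j := Nat.lt_pow_self (by norm_num)
    exact_mod_cast this
  have h8 : ‖(M : L)‖ * (j + 1) ≤ 1 * (j + 1) := by
    gcongr; exact u_nat M
  push_cast at h6
  rw [pow_succ] at h6
  nlinarith

end loc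
end Beukers

namespace Beukers
section loc2
set_option linter.unusedSectionVars false
variable {L : Type*} [NormedField L] [IsUltrametricDist L]

lemma inv_eqn {r : L} (h0 : r ≠ 0) {n : ℕ} (h : 1 + r ^ n = (1 + r) ^ n) :
    1 + r⁻¹ ^ n = (1 + r⁻¹) ^ n := by
  have : 1 + r⁻¹ = (1 + r) * r⁻¹ := by field_simp; ring
  rw [this, mul_pow, ← h, add_mul, ← mul_pow, mul_inv_cancel₀ h0]; ring

lemma lt_one_of_pow {x : ℝ} (k : ℕ) (h : x ^ k < 1) : x < 1 := by
  by_contra h'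
  push Not at h'
  exact absurd h (not_lt.2 (one_le_pow₀ h'))

lemma four_le (hp1 : ‖((2 : ℕ) : L)‖ = ((2 : ℕ) : ℝ)⁻¹)
    (hp2 : ∀ k : ℕ, ¬ 2 ∣ k → ‖(k : L)‖ = 1) (r : L) (h0 : r ≠ 0) (hle : ‖r‖ ≤ 1)
    (n : ℕ) (h1 : 1 + r ^ 4 = (1 + r) ^ 4) (h2 : 1 + r ^ n = (1 + r) ^ n) (hn : 4 < n) : False := by
  have h2' : ((2 : ℕ) : L) ≠ 0 := by
    intro h; rw [h] at hp1; norm_num at hp1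
  have e : ((3 : ℕ) : L) * r = ((2 : ℕ) : L) * (-(1 + r * r)) := by
    have : (((2 : ℕ) : L) * r) * (((3 : ℕ) : L) * r) = (((2 : ℕ) : L) * r) * (((2 : ℕ) : L) * (-(1 + r * r))) := by
      push_cast; linear_combination -h1
    exact mul_left_cancel₀ (mul_ne_zero h2' h0) this
  have e' := congrArg norm e
  rw [norm_mul, norm_mul, hp2 3 (by norm_num), norm_neg, one_mul] at e'
  have hlt : ‖r‖ < 1 := by
    have : ‖1 + r * r‖ ≤ 1 := u_add (by simp) (u_mul hle hle)
    rw [e', hp1]; push_cast; linarith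
  rw [u_unit norm_one hle hlt, mul_one] at e'
  exact loc_false (p := 2) (by simp) hp1 hp2 r (by simpa using e') 2 n (by norm_num)
    (by rw [hp1]; norm_num) hn h1 h2

lemma six_le (hp1 : ‖((3 : ℕ) : L)‖ = ((3 : ℕ) : ℝ)⁻¹)
    (hp2 : ∀ k : ℕ, ¬ 3 ∣ k → ‖(k : L)‖ = 1) (r : L) (h0 : r ≠ 0) (hle : ‖r‖ ≤ 1)
    (n : ℕ) (h1 : 1 + r ^ 6 = (1 + r) ^ 6) (h2 : 1 + r ^ n = (1 + r) ^ n) (hn : 6 < n) : False := by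
  have e : ((20 : ℕ) : L) * r ^ 2 =
      ((3 : ℕ) : L) * (-(((2 : ℕ) : L) + r * (5 + 5 * r ^ 2 + 2 * r ^ 3))) := by
    have : r * (((20 : ℕ) : L) * r ^ 2) =
      r * (((3 : ℕ) : L) * (-(((2 : ℕ) : L) + r * (5 + 5 * r ^ 2 + 2 * r ^ 3)))) := by
      push_cast; linear_combination -h1
    exact mul_left_cancel₀ h0 this
  have e' := congrArg norm e
  have hz : ‖5 + 5 * r ^ 2 + 2 * r ^ 3‖ ≤ 1 :=
    u_add (u_add (u_ofNat 5) (u_mul (u_ofNat 5) (u_pow hle 2))) (u_mul (u_ofNat 2) (u_pow hle 3))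
  rw [norm_mul, norm_mul, hp2 20 (by norm_num), norm_neg, one_mul, norm_pow] at e'
  have hlt : ‖r‖ < 1 := by
    have := u_add (u_nat (L := L) 2) (u_mul hle hz)
    apply lt_one_of_pow 2
    rw [e', hp1]; push_cast at *; linarith
  rw [u_unit (hp2 2 (by norm_num)) hz hlt, mul_one] at e'
  exact loc_false (p := 3) (by simp) hp1 hp2 r (by simpa using e') 2 n (by norm_num)
    (by rw [hp2 2 (by norm_num)]; norm_num) hn h1 h2

lemma ten_le (hp1 : ‖((5 : ℕ) : L)‖ = ((5 : ℕ) : ℝ)⁻¹)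
    (hp2 : ∀ k : ℕ, ¬ 5 ∣ k → ‖(k : L)‖ = 1) (r : L) (h0 : r ≠ 0) (hle : ‖r‖ ≤ 1)
    (n : ℕ) (h1 : 1 + r ^ 10 = (1 + r) ^ 10) (h2 : 1 + r ^ n = (1 + r) ^ n) (hn : 10 < n) :
    False := by
  set z : L := 9 + 24 * r + 42 * r ^ 2 + 42 * r ^ 4 + 24 * r ^ 5 + 9 * r ^ 6 + 2 * r ^ 7 with hzd
  have e : ((252 : ℕ) : L) * r ^ 4 = ((5 : ℕ) : L) * (-(((2 : ℕ) : L) + r * z)) := by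
    have : r * (((252 : ℕ) : L) * r ^ 4) = r * (((5 : ℕ) : L) * (-(((2 : ℕ) : L) + r * z))) := by
      rw [hzd]; push_cast; linear_combination -h1
    exact mul_left_cancel₀ h0 this
  have e' := congrArg norm e
  have hz : ‖z‖ ≤ 1 :=
    u_add (u_add (u_add (u_add (u_add (u_add (u_ofNat 9) (u_mul (u_ofNat _) hle))
      (u_mul (u_ofNat _) (u_pow hle _))) (u_mul (u_ofNat _) (u_pow hle _)))
      (u_mul (u_ofNat _) (u_pow hle _))) (u_mul (u_ofNat _) (u_pow hle _)))
      (u_mul (u_ofNat _) (u_pow hle _))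
  rw [norm_mul, norm_mul, hp2 252 (by norm_num), norm_neg, one_mul, norm_pow] at e'
  have hlt : ‖r‖ < 1 := by
    have := u_add (u_nat (L := L) 2) (u_mul hle hz)
    apply lt_one_of_pow 4
    rw [e', hp1]; push_cast at *; linarith
  rw [u_unit (hp2 2 (by norm_num)) hz hlt, mul_one] at e'
  exact loc_false (p := 5) (by simp) hp1 hp2 r (by simpa using e') 2 n (by norm_num)
    (by rw [hp2 2 (by norm_num)]; norm_num) hn h1 h2

lemma nine_lt (hp1 : ‖((3 : ℕ) : L)‖ = ((3 : ℕ) : ℝ)⁻¹)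
    (hp2 : ∀ k : ℕ, ¬ 3 ∣ k → ‖(k : L)‖ = 1) (r : L) (h0 : r ≠ 0) (hs : 1 + r ≠ 0) (hlt : ‖r‖ < 1)
    (n : ℕ) (h1 : 1 + r ^ 9 = (1 + r) ^ 9) (h2 : 1 + r ^ n = (1 + r) ^ n) (hn : 9 < n) :
    False := by
  have h3 : ((3 : ℕ) : L) ≠ 0 := by
    intro h; rw [h] at hp1; norm_num at hp1
  have e : r ^ 2 * (1 + r * 1) ^ 2 = ((3 : ℕ) : L) * (-(1 + r * (1 + r)) ^ 3) := by
    have : (((3 : ℕ) : L) * r * (1 + r)) * (r ^ 2 * (1 + r * 1) ^ 2) =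
      (((3 : ℕ) : L) * r * (1 + r)) * (((3 : ℕ) : L) * (-(1 + r * (1 + r)) ^ 3)) := by
      push_cast; linear_combination -h1
    exact mul_left_cancel₀ (mul_ne_zero (mul_ne_zero h3 h0) hs) this
  have e' := congrArg norm e
  rw [norm_mul, norm_mul, norm_neg, norm_pow, norm_pow, norm_pow, u_unit norm_one norm_one.le hlt,
    u_unit norm_one (u_add norm_one.le hlt.le) hlt, one_pow, one_pow, mul_one, mul_one] at e'
  exact loc_false (p := 3) (by simp) hp1 hp2 r (by simpa using e') 3 n (by norm_num)
    (by rw [hp1]; norm_num) hn h1 h2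

lemma nine_le (hp1 : ‖((3 : ℕ) : L)‖ = ((3 : ℕ) : ℝ)⁻¹)
    (hp2 : ∀ k : ℕ, ¬ 3 ∣ k → ‖(k : L)‖ = 1) (r : L) (h0 : r ≠ 0) (hs : 1 + r ≠ 0) (hle : ‖r‖ ≤ 1)
    (n : ℕ) (h1 : 1 + r ^ 9 = (1 + r) ^ 9) (h2 : 1 + r ^ n = (1 + r) ^ n) (hn : 9 < n) :
    False := by
  rcases hle.lt_or_eq with h | hr1
  · exact nine_lt hp1 hp2 r h0 hs h n h1 h2 hn
  have h3 : ((3 : ℕ) : L) ≠ 0 := by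
    intro h; rw [h] at hp1; norm_num at hp1
  have e : r ^ 2 * (1 + r) ^ 2 = ((3 : ℕ) : L) * (-(1 + r * (1 + r)) ^ 3) := by
    have : (((3 : ℕ) : L) * r * (1 + r)) * (r ^ 2 * (1 + r) ^ 2) =
      (((3 : ℕ) : L) * r * (1 + r)) * (((3 : ℕ) : L) * (-(1 + r * (1 + r)) ^ 3)) := by
      push_cast; linear_combination -h1
    exact mul_left_cancel₀ (mul_ne_zero (mul_ne_zero h3 h0) hs) this
  have e' := congrArg norm e
  have hz : ‖(1 + r * (1 + r)) ^ 3‖ ≤ 1 :=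
    u_pow (u_add norm_one.le (u_mul hle (u_add norm_one.le hle))) 3
  rw [norm_mul, norm_mul, norm_neg, norm_pow, norm_pow, hr1, one_pow, one_mul] at e'
  have hslt : ‖1 + r‖ < 1 := by
    apply lt_one_of_pow 2
    rw [e', hp1]; push_cast at *; linarith
  rcases Nat.even_or_odd n with he | ho
  · have hb : ‖r ^ n - 1‖ < 1 := by
      have : r = -(1 + (-(1 + r))) := by ring
      obtain ⟨w, hw, hx⟩ := expand (-(1 + r)) (by rw [norm_neg]; exact hslt.le) n
      rw [this, he.neg_pow, hx]
      have : 1 + (n : L) * -(1 + r) + (-(1 + r)) ^ 2 * w - 1 = (1 + r) * (-(n : L) + (1 + r) * w) := by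
        ring
      rw [this, norm_mul]
      refine lt_of_le_of_lt (mul_le_of_le_one_right (norm_nonneg _) ?_) hslt
      exact u_add (by rw [norm_neg]; exact u_nat n) (u_mul hslt.le hw)
    have h2n := hp2 2 (by norm_num)
    have hc : ((2 : ℕ) : L) + (r ^ n - 1) = (1 + r) ^ n := by rw [← h2]; push_cast; ring
    have := u_dom (x := ((2 : ℕ) : L)) (y := r ^ n - 1) (by rw [h2n]; exact hb)
    rw [hc, h2n, norm_pow] at this
    have := pow_lt_one₀ (norm_nonneg _) hslt (show n ≠ 0 by omega)
    linarith
  · refine nine_lt hp1 hp2 (-(1 + r)) (neg_ne_zero.2 hs) (by simpa using h0)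
      (by rwa [norm_neg]) n ?_ ?_ hn
    · have : 1 + -(1 + r) = -r := by ring
      rw [this]; linear_combination h1
    · have : 1 + -(1 + r) = -r := by ring
      rw [this, ho.neg_pow, ho.neg_pow]; linear_combination h2

end loc2
end Beukers

namespace Beukers
section loc3
set_option linter.unusedSectionVars false
variable {L : Type*} [NormedField L] [IsUltrametricDist L]

lemma u_aeval (r : L) (hle : ‖r‖ ≤ 1) (f : Polynomial ℤ) : ‖Polynomial.aeval r f‖ ≤ 1 := by
  induction f using Polynomial.induction_on' with
  | add p q hp hq => rw [map_add]; exact u_add hp hq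
  | monomial n a =>
    rw [Polynomial.aeval_monomial]
    refine u_mul ?_ (u_pow hle n)
    simpa using IsUltrametricDist.norm_intCast_le_one L a

lemma thirteen_le (hp1 : ‖((47 : ℕ) : L)‖ = ((47 : ℕ) : ℝ)⁻¹)
    (hp2 : ∀ k : ℕ, ¬ 47 ∣ k → ‖(k : L)‖ = 1) (r : L) (h0 : r ≠ 0) (hle : ‖r‖ ≤ 1)
    (h1 : 1 + r ^ 13 = (1 + r) ^ 13) (h2 : 1 + r ^ 94 = (1 + r) ^ 94) : False := by
  have h13 : ((13 : ℕ) : L) ≠ 0 := by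
    intro h; have := hp2 13 (by norm_num); rw [h] at this; norm_num at this
  have hr1 : ‖r‖ = 1 := by
    by_contra hne
    have hlt := lt_of_le_of_ne hle hne
    set f : Polynomial ℤ := 6 + 22 * .X + 55 * .X ^ 2 + 99 * .X ^ 3 + 132 * .X ^ 4 + 132 * .X ^ 5
      + 99 * .X ^ 6 + 55 * .X ^ 7 + 22 * .X ^ 8 + 6 * .X ^ 9 + .X ^ 10 with hf
    have e : 1 + r * Polynomial.aeval r f = 0 := by
      have : ((13 : ℕ) : L) * r * (1 + r * Polynomial.aeval r f) = ((13 : ℕ) : L) * r * 0 := by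
        simp only [hf, map_add, map_mul, map_pow, Polynomial.aeval_X, map_ofNat]
        push_cast; linear_combination -h1
      exact mul_left_cancel₀ (mul_ne_zero h13 h0) this
    have := u_unit norm_one (u_aeval r hle f) hlt
    rw [e, norm_zero] at this
    norm_num at this
  obtain ⟨f, hf⟩ := exists_add_pow_prime_eq (show Nat.Prime 47 by norm_num) (1 : Polynomial ℤ) .X
  have hf' := congrArg (Polynomial.aeval r) hf
  simp only [map_add, map_mul, map_pow, Polynomial.aeval_X, map_one, map_natCast, one_pow] at hf'
  obtain ⟨Q, hQd⟩ : ∃ Q, Q = r * Polynomial.aeval r f := ⟨_, rfl⟩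
  have hQ : ‖Q‖ ≤ 1 := by rw [hQd]; exact u_mul hle (u_aeval r hle f)
  rw [mul_one, mul_assoc, ← hQd] at hf'
  have e : ((2 : ℕ) : L) * r ^ 47 = ((47 : ℕ) : L) * (-(2 * Q * (1 + r ^ 47) + ((47 : ℕ) : L) * Q ^ 2)) := by
    have h3 : (1 + r) ^ 94 = ((1 + r) ^ 47) ^ 2 := by rw [← pow_mul]
    rw [hf'] at h3
    rw [h3] at h2
    push_cast at *
    linear_combination -h2
  have e' := congrArg norm e
  rw [norm_mul, norm_mul, hp2 2 (by norm_num), norm_neg, norm_pow, hr1, hp1] at e'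
  have : ‖2 * Q * (1 + r ^ 47) + ((47 : ℕ) : L) * Q ^ 2‖ ≤ 1 :=
    u_add (u_mul (u_mul (u_ofNat 2) hQ) (u_add norm_one.le (u_pow hle _)))
      (u_mul (u_nat 47) (u_pow hQ 2))
  push_cast at *
  linarith

lemma eight_le (hp1 : ‖((2 : ℕ) : L)‖ = ((2 : ℕ) : ℝ)⁻¹)
    (hp2 : ∀ k : ℕ, ¬ 2 ∣ k → ‖(k : L)‖ = 1) (r : L) (h0 : r ≠ 0) (hle : ‖r‖ ≤ 1)
    (n : ℕ) (h1 : 1 + r ^ 8 = (1 + r) ^ 8) (h2 : 1 + r ^ n = (1 + r) ^ n) (hn : 8 < n) : False := by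
  have h2' : ((2 : ℕ) : L) ≠ 0 := by
    intro h; rw [h] at hp1; norm_num at hp1
  have hp1' : ‖(2 : L)‖ = 1 / 2 := by simpa using hp1
  have hrpos : 0 < ‖r‖ := norm_pos_iff.2 h0
  have e : ((35 : ℕ) : L) * r ^ 3 = 2 * (-(2 * (1 + r * (7 * r + 7 * r ^ 3 + r ^ 5)) +
      r * ((7 : ℕ) * (1 + r * r ^ 3)))) := by
    have : (((2 : ℕ) : L) * r) * (((35 : ℕ) : L) * r ^ 3) = (((2 : ℕ) : L) * r) *
      (2 * (-(2 * (1 + r * (7 * r + 7 * r ^ 3 + r ^ 5)) + r * ((7 : ℕ) * (1 + r * r ^ 3))))) := by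
      push_cast; linear_combination -h1
    exact mul_left_cancel₀ (mul_ne_zero h2' h0) this
  have e' := congrArg norm e
  have hy : ‖7 * r + 7 * r ^ 3 + r ^ 5‖ ≤ 1 :=
    u_add (u_add (u_mul (u_ofNat 7) hle) (u_mul (u_ofNat 7) (u_pow hle 3))) (u_pow hle 5)
  rw [norm_mul, norm_mul, hp2 35 (by norm_num), norm_neg, one_mul, norm_pow, hp1'] at e'
  have hlt : ‖r‖ < 1 := by
    apply lt_one_of_pow 3
    have : ‖2 * (1 + r * (7 * r + 7 * r ^ 3 + r ^ 5)) + r * ((7 : ℕ) * (1 + r * r ^ 3))‖ ≤ 1 :=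
      u_add (u_mul (u_ofNat 2) (u_add norm_one.le (u_mul hle hy)))
        (u_mul hle (u_mul (u_nat 7) (u_add norm_one.le (u_mul hle (u_pow hle 3)))))
    rw [e']; push_cast at this ⊢; linarith
  have a1 : ‖2 * (1 + r * (7 * r + 7 * r ^ 3 + r ^ 5))‖ = 1 / 2 := by
    rw [norm_mul, hp1', u_unit norm_one hy hlt, mul_one]
  have a2 : ‖r * ((7 : ℕ) * (1 + r * r ^ 3))‖ = ‖r‖ := by
    rw [norm_mul, norm_mul, hp2 7 (by norm_num), u_unit norm_one (u_pow hle 3) hlt, mul_one, mul_one]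
  rcases lt_trichotomy ‖r‖ (1 / 2) with hc | hc | hc
  · rw [u_dom (by rw [a1, a2]; exact hc), a1] at e'
    have : ‖r‖ ^ 3 < (1 / 2) ^ 3 := by gcongr
    rw [e'] at this
    norm_num at this
  · refine loc_false (p := 2) (by simp) hp1 hp2 r (by rw [hc, hp1]; norm_num) 4 n (by norm_num)
      ?_ hn h1 h2
    have : ((4 : ℕ) : L) = 2 * 2 := by norm_num
    rw [this, norm_mul, hp1']; norm_num
  rw [add_comm, u_dom (by rw [a1, a2]; exact hc), a2] at e'
  have hr2 : ‖r‖ ^ 2 = 1 / 2 := by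
    apply mul_right_cancel₀ hrpos.ne'
    rw [← pow_succ, e']
  have b1 : ‖(1 + r) ^ 2 - 1‖ = ‖r‖ ^ 2 := by
    have : (1 + r) ^ 2 - 1 = r * (r + 2) := by ring
    rw [this, norm_mul, u_dom (by rw [hp1']; exact hc), pow_two]
  rcases Nat.even_or_odd' n with ⟨k, rfl | rfl⟩
  · rcases Nat.even_or_odd' k with ⟨M, rfl | rfl⟩
    · set d := (1 + r) ^ 4 - 1 with hd
      have hd' : d = ((1 + r) ^ 2 - 1) * (((1 + r) ^ 2 - 1) + 2) := by rw [hd]; ring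
      have hdle : ‖d‖ ≤ 1 / 4 := by
        have : ‖((1 + r) ^ 2 - 1) + 2‖ ≤ 1 / 2 := u_add (by rw [b1, hr2]) hp1'.le
        rw [hd', norm_mul, b1, hr2]; linarith
      have hds : ‖d‖ ^ (2 - 1) < ‖((2 : ℕ) : L)‖ := by
        rw [hp1]; norm_num; linarith
      have e1 := small_pow (p := 2) (by simp) hp2 2 d hds
      have e2 := small_pow (p := 2) (by simp) hp2 M d hds
      rw [hd, add_sub_cancel, ← pow_mul, ← h1, ← hd, add_sub_cancel_left, norm_pow,
        show 8 = 2 * 4 by norm_num, pow_mul, hr2, hp1] at e1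
      have h2'' : 1 + r ^ (4 * M) = (1 + r) ^ (4 * M) := by
        rw [show 4 * M = 2 * (2 * M) by ring]; exact h2
      rw [hd, add_sub_cancel, ← pow_mul, ← h2'', ← hd, add_sub_cancel_left, norm_pow,
        show 4 * M = 2 * (2 * M) by ring, pow_mul, hr2, pow_mul] at e2
      have hM := nat_lower (L := L) Nat.prime_two hp1 hp2 M (by omega)
      obtain ⟨j, rfl⟩ := Nat.exists_eq_add_of_le (show 3 ≤ M by omega)
      have h7 : ((j : ℝ) + 1) ≤ 4 ^ j := by
        have : j + 1 ≤ 4 ^ j := Nat.lt_pow_self (by norm_num)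
        exact_mod_cast this
      have hd8 : ‖d‖ = 1 / 8 := by push_cast at e1; linarith
      rw [hd8] at e2
      have h9 : ((1 / 2 : ℝ) ^ 2) ^ (3 + j) * 4 ^ j = 1 / 64 := by
        rw [pow_add, mul_assoc, ← mul_pow]; norm_num
      rw [e2] at h9
      push_cast at hM
      have : ‖((3 + j : ℕ) : L)‖ * (3 + j) ≤ ‖((3 + j : ℕ) : L)‖ * (3 * 4 ^ j) := by
        gcongr; linarith
      push_cast at *
      linarith
    · have := coprime_pow hp2 ((1 + r) ^ 2 - 1) (by rw [b1, hr2]; norm_num) (2 * M + 1) (by omega)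
      rw [add_sub_cancel, ← pow_mul, ← h2, add_sub_cancel_left, norm_pow, b1] at this
      have := pow_inj' hrpos hlt this
      omega
  · have := coprime_pow hp2 r hlt (2 * k + 1) (by omega)
    rw [← h2, add_sub_cancel_left, norm_pow] at this
    have := pow_inj' hrpos hlt (this.trans (pow_one _).symm)
    omega

lemma twelve_le (hp1 : ‖((2 : ℕ) : L)‖ = ((2 : ℕ) : ℝ)⁻¹)
    (hp2 : ∀ k : ℕ, ¬ 2 ∣ k → ‖(k : L)‖ = 1) (r : L) (h0 : r ≠ 0) (hs0 : 1 + r ≠ 0)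
    (hle : ‖r‖ ≤ 1) (n : ℕ) (h1 : 1 + r ^ 12 = (1 + r) ^ 12) (h2 : 1 + r ^ n = (1 + r) ^ n)
    (hn : 85 ≤ n ∧ n ≤ 88) : False := by
  have hp1' : ‖(2 : L)‖ = 1 / 2 := by simpa using hp1
  have hrpos : 0 < ‖r‖ := norm_pos_iff.2 h0
  have hspos : 0 < ‖1 + r‖ := norm_pos_iff.2 hs0
  rcases hle.lt_or_eq with hlt | hr1
  · -- case |r| < 1
    have pw : ∀ a b : ℕ, a < b → ‖r‖ ^ b < ‖r‖ ^ a := fun a b h => pow_lt_pow_right_of_lt_one₀ hrpos hlt h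
    have hd2 : (1 + r) ^ 2 - 1 = r * (r + 2) := by ring
    have hd4 : (1 + r) ^ 4 - 1 = ((1 + r) ^ 2 - 1) * (2 + ((1 + r) ^ 2 - 1)) := by ring
    have n2 : ‖(1 + r) ^ 2 - 1‖ < 1 := by
      rw [hd2, norm_mul]
      exact (mul_le_of_le_one_right (norm_nonneg _) (u_add hle (u_ofNat 2))).trans_lt hlt
    have n4 : ‖(1 + r) ^ 4 - 1‖ < 1 := by
      rw [hd4, norm_mul]
      exact (mul_le_of_le_one_right (norm_nonneg _) (u_add (u_ofNat 2) n2.le)).trans_lt n2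
    have e12 := coprime_pow hp2 _ n4 3 (by norm_num)
    rw [add_sub_cancel, ← pow_mul, ← h1, add_sub_cancel_left, norm_pow] at e12
    have hodd : 2 ∣ n := by
      by_contra h
      have := coprime_pow hp2 r hlt n h
      rw [← h2, add_sub_cancel_left, norm_pow] at this
      have := pow_inj' hrpos hlt (this.trans (pow_one _).symm)
      omega
    have : n = 86 ∨ n = 88 := by omega
    rcases this with rfl | rfl
    · have e := coprime_pow hp2 _ n2 43 (by norm_num)
      rw [add_sub_cancel, ← pow_mul, ← h2, add_sub_cancel_left, norm_pow] at e
      have hr2 : ‖r‖ = 1 / 2 := by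
        by_contra hne
        have h3 := IsUltrametricDist.norm_add_eq_max_of_norm_ne_norm (x := r) (y := (2 : L))
          (by rw [hp1']; exact hne)
        have h4 : ‖r‖ ≤ ‖r + 2‖ := h3 ▸ le_max_left _ _
        rw [hd2, norm_mul] at e
        have := pw 2 86 (by norm_num)
        nlinarith
      rw [hd4, norm_mul, u_dom (by rw [hp1', ← e, hr2]; norm_num), ← e, hr2, hp1'] at e12
      norm_num at e12
    · have e := coprime_pow hp2 ((1 + r) ^ 8 - 1) (by
        have : (1 + r) ^ 8 - 1 = ((1 + r) ^ 4 - 1) * (2 + ((1 + r) ^ 4 - 1)) := by ring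
        rw [this, norm_mul]
        exact (mul_le_of_le_one_right (norm_nonneg _) (u_add (u_ofNat 2) n4.le)).trans_lt n4)
        11 (by norm_num)
      rw [add_sub_cancel, ← pow_mul, ← h2, add_sub_cancel_left, norm_pow] at e
      have h8 : (1 + r) ^ 8 - 1 = ((1 + r) ^ 4 - 1) * (2 + ((1 + r) ^ 4 - 1)) := by ring
      have hr2 : ‖r‖ ^ 12 = 1 / 2 := by
        by_contra hne
        have h3 := IsUltrametricDist.norm_add_eq_max_of_norm_ne_norm (x := (2 : L))
          (y := (1 + r) ^ 4 - 1) (by rw [hp1', ← e12]; exact Ne.symm hne)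
        have h4 : ‖(1 + r) ^ 4 - 1‖ ≤ ‖2 + ((1 + r) ^ 4 - 1)‖ := h3 ▸ le_max_right _ _
        rw [h8, norm_mul] at e
        rw [← e12] at e h4
        have h5 := pw 24 88 (by norm_num)
        have : ‖r‖ ^ 24 = ‖r‖ ^ 12 * ‖r‖ ^ 12 := by rw [← pow_add]
        have : 0 < ‖r‖ ^ 12 := by positivity
        nlinarith
      have hd : (1 + r) ^ 4 - 1 = r ^ 4 + 2 * (r * (2 * r ^ 2 + 3 * r + 2)) := by ring
      have hsm : ‖2 * (r * (2 * r ^ 2 + 3 * r + 2))‖ < ‖r ^ 4‖ := by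
        have hz : ‖2 * r ^ 2 + 3 * r + 2‖ ≤ 1 := u_add (u_add (u_mul (u_ofNat 2) (u_pow hle 2))
          (u_mul (u_ofNat 3) hle)) (u_ofNat 2)
        rw [norm_mul, norm_mul, hp1', ← hr2, norm_pow, ← mul_assoc, ← pow_succ]
        exact (mul_le_of_le_one_right (by positivity) hz).trans_lt (pw 4 13 (by norm_num))
      rw [hd, u_dom hsm, norm_pow] at e12
      have := pow_inj' hrpos hlt e12
      omega
  · -- case |r| = 1
    set f : Polynomial ℤ := -(6 * .X + 33 * .X ^ 2 + 110 * .X ^ 3 + 247 * .X ^ 4 + 394 * .X ^ 5 +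
      459 * .X ^ 6 + 394 * .X ^ 7 + 247 * .X ^ 8 + 110 * .X ^ 9 + 33 * .X ^ 10 + 6 * .X ^ 11) with hf
    have e : r ^ 4 * (1 + r) ^ 4 = 2 * Polynomial.aeval r f := by
      simp only [hf, map_neg, map_add, map_mul, map_pow, Polynomial.aeval_X, map_ofNat]
      linear_combination -h1
    have e' := congrArg norm e
    rw [norm_mul, norm_mul, norm_pow, hr1, one_pow, one_mul, norm_pow, hp1'] at e'
    have hslt : ‖1 + r‖ < 1 := by
      apply lt_one_of_pow 4
      have := u_aeval r hle f
      linarith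
    obtain ⟨s, hs⟩ : ∃ s, s = 1 + r := ⟨_, rfl⟩
    have hr : r = -(1 + -s) := by rw [hs]; ring
    rw [← hs] at h1 h2 hslt hspos
    have pw : ∀ a b : ℕ, a < b → ‖s‖ ^ b < ‖s‖ ^ a :=
      fun a b h => pow_lt_pow_right_of_lt_one₀ hspos hslt h
    have hodd : 2 ∣ n := by
      by_contra h
      have h3 := coprime_pow hp2 (-s) (by rwa [norm_neg]) n h
      rw [hr, (Nat.not_even_iff_odd.1 (by rwa [even_iff_two_dvd])).neg_pow] at h2
      have : (1 + -s) ^ n - 1 = -(s ^ n) := by linear_combination -h2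
      rw [this, norm_neg, norm_neg, norm_pow] at h3
      have := pow_inj' hspos hslt (h3.trans (pow_one _).symm)
      omega
    rw [hr, (show Even 12 by decide).neg_pow] at h1
    rw [hr, (even_iff_two_dvd.2 hodd).neg_pow] at h2
    obtain ⟨b, hb⟩ : ∃ b, b = 1 + -s := ⟨_, rfl⟩
    rw [← hb] at h1 h2
    have hb1 : ‖b - 1‖ < 1 := by rw [hb]; simpa using hslt
    have hd2 : b ^ 2 - 1 = (b - 1) * (2 + (b - 1)) := by ring
    have hd4 : b ^ 4 - 1 = (b ^ 2 - 1) * (2 + (b ^ 2 - 1)) := by ring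
    have hd8 : b ^ 8 - 1 = (b ^ 4 - 1) * (2 + (b ^ 4 - 1)) := by ring
    have n2 : ‖b ^ 2 - 1‖ < 1 := by
      rw [hd2, norm_mul]
      exact (mul_le_of_le_one_right (norm_nonneg _) (u_add (u_ofNat 2) hb1.le)).trans_lt hb1
    have n4 : ‖b ^ 4 - 1‖ < 1 := by
      rw [hd4, norm_mul]
      exact (mul_le_of_le_one_right (norm_nonneg _) (u_add (u_ofNat 2) n2.le)).trans_lt n2
    have n8 : ‖b ^ 8 - 1‖ < 1 := by
      rw [hd8, norm_mul]
      exact (mul_le_of_le_one_right (norm_nonneg _) (u_add (u_ofNat 2) n4.le)).trans_lt n4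
    have e12 := coprime_pow hp2 _ n4 3 (by norm_num)
    rw [add_sub_cancel, ← pow_mul] at e12
    have hx : b ^ (4 * 3) - 1 = -2 + s ^ 12 := by linear_combination h1
    rw [hx] at e12
    have hm2 : ‖(-2 : L)‖ = 1 / 2 := by rw [norm_neg, hp1']
    have hs12 : ‖s‖ ^ 12 < 1 / 2 := by
      by_contra hge
      push Not at hge
      have hle2 : ‖-2 + s ^ 12‖ ≤ ‖s‖ ^ 12 := u_add (by rwa [hm2]) (by rw [norm_pow])
      have hd : b ^ 4 - 1 = s ^ 4 + 2 * (s * (-2 + 3 * s + -(2 * s ^ 2))) := by rw [hb]; ring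
      have hsm : ‖2 * (s * (-2 + 3 * s + -(2 * s ^ 2)))‖ < ‖s ^ 4‖ := by
        have hz : ‖-2 + 3 * s + -(2 * s ^ 2)‖ ≤ 1 := by
          refine u_add (u_add ?_ (u_mul (u_ofNat 3) hslt.le)) ?_
          · rw [norm_neg]; exact u_ofNat 2
          · rw [norm_neg]; exact u_mul (u_ofNat 2) (u_pow hslt.le 2)
        rw [norm_mul, norm_mul, hp1', norm_pow, ← mul_assoc]
        refine (mul_le_of_le_one_right (by positivity) hz).trans_lt
          (lt_of_le_of_lt ?_ (pw 4 13 (by norm_num)))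
        rw [pow_succ]
        gcongr
      rw [hd, u_dom hsm, norm_pow] at e12
      have := pw 4 12 (by norm_num)
      linarith
    rw [u_dom (by rw [hm2, norm_pow]; exact hs12), hm2] at e12
    have hy : b ^ n - 1 = -2 + s ^ n := by linear_combination h2
    have hyn : ‖b ^ n - 1‖ = 1 / 2 := by
      rw [hy, u_dom, hm2]
      rw [hm2, norm_pow]
      exact (pw 12 n (by omega)).trans hs12
    have : n = 86 ∨ n = 88 := by omega
    rcases this with rfl | rfl
    · have e := coprime_pow hp2 _ n2 43 (by norm_num)
      rw [add_sub_cancel, ← pow_mul, hyn] at e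
      have : ‖2 + (b ^ 2 - 1)‖ ≤ 1 / 2 := u_add hp1'.le e.symm.le
      rw [hd4, norm_mul, ← e] at e12
      linarith
    · have e := coprime_pow hp2 _ n8 11 (by norm_num)
      rw [add_sub_cancel, ← pow_mul, hyn] at e
      have : ‖2 + (b ^ 4 - 1)‖ ≤ 1 / 2 := u_add hp1'.le e12.symm.le
      rw [hd8, norm_mul, ← e12] at e
      linarith

end loc3
end Beukers

namespace Beukers

lemma padic_hp1 (p : ℕ) [Fact p.Prime] : ‖((p : ℕ) : PadicAlgCl p)‖ = (p : ℝ)⁻¹ := by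
  have h := PadicAlgCl.norm_extends p (p : ℚ_[p])
  rw [← Padic.norm_p, ← h]
  simp

lemma padic_hp2 (p : ℕ) [Fact p.Prime] (k : ℕ) (hk : ¬ p ∣ k) : ‖(k : PadicAlgCl p)‖ = 1 := by
  have h := PadicAlgCl.norm_extends p (k : ℚ_[p])
  have h2 : ‖(k : ℚ_[p])‖ = 1 := by
    rw [Padic.norm_natCast_eq_one_iff]
    exact ((Fact.out : p.Prime).coprime_iff_not_dvd).2 hk
  rw [← h2, ← h]
  simp

/-- an integral representative at a prime -/
lemma transfer {K : Type*} [Field K] [NumberField K] (r : K) (h0 : r ≠ 0) (hs : 1 + r ≠ 0)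
    (p : ℕ) [Fact p.Prime] :
    ∃ t : PadicAlgCl p, t ≠ 0 ∧ 1 + t ≠ 0 ∧ ‖t‖ ≤ 1 ∧
      ∀ n : ℕ, 1 + r ^ n = (1 + r) ^ n → 1 + t ^ n = (1 + t) ^ n := by
  have φ : K →ₐ[ℚ] PadicAlgCl p := IsAlgClosed.lift
  have t0 : φ r ≠ 0 := (map_ne_zero φ).2 h0
  have t1 : 1 + φ r ≠ 0 := by
    have := (map_ne_zero φ).2 hs
    simpa using this
  have t2 : ∀ n : ℕ, 1 + r ^ n = (1 + r) ^ n → 1 + (φ r) ^ n = (1 + φ r) ^ n := by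
    intro n h
    have := congrArg φ h
    simpa using this
  rcases le_total ‖φ r‖ 1 with h | h
  · exact ⟨φ r, t0, t1, h, t2⟩
  · refine ⟨(φ r)⁻¹, inv_ne_zero t0, ?_, ?_, fun n hn => inv_eqn t0 (t2 n hn)⟩
    · have : 1 + (φ r)⁻¹ = (1 + φ r) * (φ r)⁻¹ := by field_simp; ring
      rw [this]; exact mul_ne_zero t1 (inv_ne_zero t0)
    · rw [norm_inv]; exact inv_le_one_of_one_le₀ h

lemma no_pair (r : ℂ) (hr : r * (r + 1) * (r ^ 2 + r + 1) ≠ 0)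
    (m n : ℕ) (hm : 1 < m) (hmn : m < n)
    (h1 : 1 + r ^ m = (1 + r) ^ m) (h2 : 1 + r ^ n = (1 + r) ^ n) : False := by
  have hr0 : r ≠ 0 := by rintro rfl; simp at hr
  have hr1 : r + 1 ≠ 0 := by intro h; simp [h] at hr
  have hr2 : r ^ 2 + r + 1 ≠ 0 := by intro h; simp [h] at hr
  have hrInt : IsIntegral ℚ r := by
    rw [← isAlgebraic_iff_isIntegral]
    refine ⟨(1 + Polynomial.X) ^ m - (1 + Polynomial.X ^ m), ?_, ?_⟩
    · intro h
      have := congrArg (fun f => Polynomial.eval 1 f) h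
      simp at this
      have h4 : (2 : ℚ) ^ 2 ≤ (1 + 1) ^ m := by
        norm_num1
        exact (by norm_num : (4 : ℚ) = 2 ^ 2) ▸ pow_le_pow_right₀ (by norm_num) hm
      linarith
    · simp [h1]
  have : FiniteDimensional ℚ (IntermediateField.adjoin ℚ {r}) :=
    IntermediateField.adjoin.finiteDimensional hrInt
  have : NumberField (IntermediateField.adjoin ℚ {r}) := ⟨⟩
  obtain ⟨g, hg⟩ : ∃ g : IntermediateField.adjoin ℚ {r}, (g : ℂ) = r :=
    ⟨IntermediateField.AdjoinSimple.gen ℚ r, IntermediateField.AdjoinSimple.coe_gen ℚ r⟩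
  have g1 : 1 + g ^ m = (1 + g) ^ m := by
    apply Subtype.ext; push_cast; rw [hg]; exact h1
  have g2 : 1 + g ^ n = (1 + g) ^ n := by
    apply Subtype.ext; push_cast; rw [hg]; exact h2
  have gr : g * (1 + g) * (g ^ 2 + g + 1) ≠ 0 := by
    intro h
    apply hr
    have := congrArg (Subtype.val) h
    push_cast at this
    rw [hg] at this
    rw [add_comm r 1]; exact this
  have g0 : g ≠ 0 := by rintro rfl; simp at gr
  have gs : 1 + g ≠ 0 := by intro h; simp [h] at gr
  rcases Nat.lt_or_ge m 12 with hlt | hge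
  · interval_cases m
    · apply hr0
      linear_combination (-1 / 2) * h1
    · apply mul_ne_zero hr0 hr1
      linear_combination (-1 / 3) * h1
    · have : Fact (Nat.Prime 2) := ⟨by norm_num⟩
      obtain ⟨t, t0, t1, tl, te⟩ := transfer g g0 gs 2
      exact four_le (padic_hp1 2) (padic_hp2 2) t t0 tl n (te _ g1) (te _ g2) hmn
    · apply mul_ne_zero (mul_ne_zero hr0 hr1) hr2
      linear_combination (-1 / 5) * h1
    · have : Fact (Nat.Prime 3) := ⟨by norm_num⟩
      obtain ⟨t, t0, t1, tl, te⟩ := transfer g g0 gs 3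
      exact six_le (padic_hp1 3) (padic_hp2 3) t t0 tl n (te _ g1) (te _ g2) hmn
    · apply mul_ne_zero (mul_ne_zero hr0 hr1) (pow_ne_zero 2 hr2)
      linear_combination (-1 / 7) * h1
    · have : Fact (Nat.Prime 2) := ⟨by norm_num⟩
      obtain ⟨t, t0, t1, tl, te⟩ := transfer g g0 gs 2
      exact eight_le (padic_hp1 2) (padic_hp2 2) t t0 tl n (te _ g1) (te _ g2) hmn
    · have : Fact (Nat.Prime 3) := ⟨by norm_num⟩
      obtain ⟨t, t0, t1, tl, te⟩ := transfer g g0 gs 3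
      exact nine_le (padic_hp1 3) (padic_hp2 3) t t0 t1 tl n (te _ g1) (te _ g2) hmn
    · have : Fact (Nat.Prime 5) := ⟨by norm_num⟩
      obtain ⟨t, t0, t1, tl, te⟩ := transfer g g0 gs 5
      exact ten_le (padic_hp1 5) (padic_hp2 5) t t0 tl n (te _ g1) (te _ g2) hmn
    · exact eleven r hr n h1 h2 (chain11 g gr 11 n g1 g2 hmn rfl)
  · rcases chain12 g gr m n g1 g2 hmn hge with ⟨rfl, hn⟩ | ⟨rfl, rfl⟩
    · have : Fact (Nat.Prime 2) := ⟨by norm_num⟩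
      obtain ⟨t, t0, t1, tl, te⟩ := transfer g g0 gs 2
      exact twelve_le (padic_hp1 2) (padic_hp2 2) t t0 t1 tl n (te _ g1) (te _ g2) hn
    · have : Fact (Nat.Prime 47) := ⟨by norm_num⟩
      obtain ⟨t, t0, t1, tl, te⟩ := transfer g g0 gs 47
      exact thirteen_le (padic_hp1 47) (padic_hp2 47) t t0 tl (te _ g1) (te _ g2)

end Beukers

theorem beukers_at_most_one (r : ℂ) (hr : r * (r + 1) * (r ^ 2 + r + 1) ≠ 0)
    (m₁ m₂ : ℕ) (hm₁ : 1 < m₁) (hm₂ : 1 < m₂)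
    (h₁ : 1 + r ^ m₁ = (1 + r) ^ m₁) (h₂ : 1 + r ^ m₂ = (1 + r) ^ m₂) :
    m₁ = m₂ := by
  rcases lt_trichotomy m₁ m₂ with h | h | h
  · exact (Beukers.no_pair r hr m₁ m₂ hm₁ h h₁ h₂).elim
  · exact h
  · exact (Beukers.no_pair r hr m₂ m₁ hm₂ h h₂ h₁).elim
end

section
/- Let r ∈ ℂ. If the equation 1 + r^m - (1 + r)^m = 0 holds for infinitely many m ∈ ℕ, then r = 0, or r = -1, or r is a primitive 3rd root of unity (i.e., r² + r + 1 = 0). -/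
open Finset in
lemma sG_expand {K : Type*} [Field K] [CharZero K] (α : K) (X M : ℕ) (hM : X + 1 ≤ M) :
    (1 + α) ^ (X + 1) - 1 =
      ((X + 1 : ℕ) : K) * α * ∑ j ∈ range M, (X.choose j : K) / ((j : K) + 1) * α ^ j := by
  have h1 : ∑ j ∈ range M, (X.choose j : K) / ((j : K) + 1) * α ^ j
      = ∑ j ∈ range (X + 1), (X.choose j : K) / ((j : K) + 1) * α ^ j := by
    symm
    apply sum_subset (by simpa using hM)
    intro j _ hj
    simp only [mem_range, not_lt] at hj
    rw [Nat.choose_eq_zero_of_lt (by omega)]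
    simp
  rw [h1, add_comm 1 α, add_pow, sum_range_succ', mul_sum]
  simp only [one_pow, mul_one, pow_zero, Nat.choose_zero_right, Nat.cast_one, add_sub_cancel_right]
  apply sum_congr rfl
  intro j _
  have h2 : ((X + 1 : ℕ) : K) * (X.choose j : K) = ((X + 1).choose (j + 1) : K) * ((j : K) + 1) := by
    exact_mod_cast Nat.add_one_mul_choose_eq X j
  have h3 : (j : K) + 1 ≠ 0 := Nat.cast_add_one_ne_zero j
  have h4 : (((X + 1).choose (j + 1) : ℕ) : K) = ((X + 1 : ℕ) : K) * (X.choose j : K) / ((j : K) + 1) := by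
    field_simp
    linear_combination -h2
  rw [h4]
  field_simp
  ring

lemma sG_int_norm_le {K : Type*} [NormedField K] [IsUltrametricDist K] (a b : ℤ) (h : a ∣ b) :
    ‖(b : K)‖ ≤ ‖(a : K)‖ := by
  obtain ⟨c, rfl⟩ := h
  push_cast
  rw [norm_mul]
  exact mul_le_of_le_one_right (norm_nonneg _) (IsUltrametricDist.norm_intCast_le_one K c)

lemma sG_binom {K : Type*} [NormedField K] [IsUltrametricDist K] (X Y i j : ℕ) :
    ‖((i.factorial : K) * j.factorial) *
      ((X.choose i : K) * Y.choose j - X.choose j * Y.choose i)‖ ≤ ‖(Y : K) - X‖ := by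
  have e : ((i.factorial : K) * j.factorial) *
      ((X.choose i : K) * Y.choose j - X.choose j * Y.choose i) =
      (((X.descFactorial i : ℤ) * Y.descFactorial j - X.descFactorial j * Y.descFactorial i : ℤ) : K) := by
    simp only [Nat.descFactorial_eq_factorial_mul_choose]
    push_cast
    ring
  have e2 : (Y : K) - X = (((Y : ℤ) - X : ℤ) : K) := by push_cast; rfl
  rw [e, e2]
  apply sG_int_norm_le
  have hd : ∀ k, (Y : ℤ) - X ∣ (Y.descFactorial k : ℤ) - X.descFactorial k := by
    intro k
    have := Polynomial.sub_dvd_eval_sub (Y : ℤ) (X : ℤ) (descPochhammer ℤ k)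
    rwa [descPochhammer_eval_eq_descFactorial, descPochhammer_eval_eq_descFactorial] at this
  have : (X.descFactorial i : ℤ) * Y.descFactorial j - X.descFactorial j * Y.descFactorial i
      = X.descFactorial i * (Y.descFactorial j - X.descFactorial j)
        - X.descFactorial j * (Y.descFactorial i - X.descFactorial i) := by ring
  rw [this]
  exact dvd_sub ((hd j).mul_left _) ((hd i).mul_left _)

open Finset in
lemma sG_pow_sub {K : Type*} [NormedField K] [IsUltrametricDist K] (α β : K) (ε : ℝ)
    (ha : ‖α‖ ≤ ε) (hb : ‖β‖ ≤ ε) (k : ℕ) : ‖β ^ (k + 1) - α ^ (k + 1)‖ ≤ ‖β - α‖ * ε ^ k := by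
  have h0 : 0 ≤ ε := (norm_nonneg _).trans ha
  rw [← (Commute.all β α).mul_geom_sum₂, norm_mul]
  gcongr
  apply IsUltrametricDist.norm_sum_le_of_forall_le_of_nonneg (by positivity)
  intro i hi
  rw [norm_mul, norm_pow, norm_pow]
  simp only [mem_range] at hi
  calc ‖β‖ ^ i * ‖α‖ ^ (k + 1 - 1 - i) ≤ ε ^ i * ε ^ (k + 1 - 1 - i) := by gcongr
    _ = ε ^ k := by rw [← pow_add]; congr 1; omega

lemma sG_mon {K : Type*} [NormedField K] [IsUltrametricDist K] (α β : K) (ε : ℝ)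
    (ha : ‖α‖ ≤ ε) (hb : ‖β‖ ≤ ε) (i j n : ℕ) (hij : i + j = n + 1) :
    ‖α ^ i * β ^ j - α ^ j * β ^ i‖ ≤ ‖β - α‖ * ε ^ n := by
  have h0 : 0 ≤ ε := (norm_nonneg _).trans ha
  wlog h : i ≤ j generalizing i j
  · rw [norm_sub_rev]
    exact this j i (by omega) (by omega)
  rcases h.eq_or_lt with rfl | h
  · simp; positivity
  · obtain ⟨k, rfl⟩ := Nat.exists_eq_add_of_lt h
    have : α ^ i * β ^ (i + k + 1) - α ^ (i + k + 1) * β ^ i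
      = (α ^ i * β ^ i) * (β ^ (k + 1) - α ^ (k + 1)) := by ring
    rw [this, norm_mul, norm_mul, norm_pow, norm_pow]
    calc ‖α‖ ^ i * ‖β‖ ^ i * ‖β ^ (k + 1) - α ^ (k + 1)‖
        ≤ ε ^ i * ε ^ i * (‖β - α‖ * ε ^ k) := by
          gcongr
          exact sG_pow_sub α β ε ha hb k
      _ = ‖β - α‖ * ε ^ n := by
          have : n = i + i + k := by omega
          rw [this, pow_add, pow_add]; ring

open Finset in
lemma sG_key {K : Type*} [NormedField K] [IsUltrametricDist K] [CharZero K] (q : ℝ) (hq : 1 < q)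
    (hfac : ∀ n : ℕ, 1 ≤ ‖(n.factorial : K)‖ * q ^ n)
    (α β : K) (ha : ‖α‖ ≤ (q ^ 5)⁻¹) (hb : ‖β‖ ≤ (q ^ 5)⁻¹) (hα : α ≠ 0) (hβ : β ≠ 0)
    (X Y : ℕ) (hXY : X ≠ Y)
    (h : ((1 + α) ^ (X + 1) - 1) * ((1 + β) ^ (Y + 1) - 1)
      = ((1 + α) ^ (Y + 1) - 1) * ((1 + β) ^ (X + 1) - 1)) : α = β := by
  by_contra hne
  set M := X + Y + 2 with hM
  set T : ℕ × ℕ → K := fun z => ((X.choose z.1 : K) * Y.choose z.2 - X.choose z.2 * Y.choose z.1)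
      * (α ^ z.1 * β ^ z.2 - α ^ z.2 * β ^ z.1) / (((z.1 : K) + 1) * ((z.2 : K) + 1)) with hT
  have hsum : ∑ z ∈ range M ×ˢ range M, T z = 0 := by
    rw [sG_expand α X M (by omega), sG_expand α Y M (by omega), sG_expand β X M (by omega),
      sG_expand β Y M (by omega)] at h
    have hx : ((X + 1 : ℕ) : K) ≠ 0 := Nat.cast_ne_zero.mpr (by omega)
    have hy : ((Y + 1 : ℕ) : K) ≠ 0 := Nat.cast_ne_zero.mpr (by omega)
    set a := ∑ j ∈ range M, (X.choose j : K) / ((j : K) + 1) * α ^ j with ha'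
    set b := ∑ j ∈ range M, (Y.choose j : K) / ((j : K) + 1) * α ^ j with hb'
    set c := ∑ j ∈ range M, (X.choose j : K) / ((j : K) + 1) * β ^ j with hc'
    set d := ∑ j ∈ range M, (Y.choose j : K) / ((j : K) + 1) * β ^ j with hd'
    have h' : a * d - b * c = 0 := by
      have : (((X + 1 : ℕ) : K) * ((Y + 1 : ℕ) : K) * α * β) * (a * d - b * c) = 0 := by
        linear_combination h
      exact (mul_eq_zero.mp this).resolve_left (by positivity)
    have : ∑ z ∈ range M ×ˢ range M, T z = a * d - c * b - b * c + d * a := by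
      rw [ha', hb', hc', hd']
      simp only [sum_mul_sum, ← sum_product', ← sum_sub_distrib, ← sum_add_distrib]
      apply sum_congr rfl
      intro z _
      simp only [hT, div_eq_mul_inv, mul_inv]
      ring
    rw [this]
    linear_combination 2 * h'
  have hD : 0 < ‖(Y : K) - X‖ * ‖β - α‖ := by
    apply mul_pos
    · rw [norm_pos_iff, sub_ne_zero]; exact_mod_cast hXY.symm
    · rw [norm_pos_iff, sub_ne_zero]; exact fun h => hne h.symm
  have hq0 : 0 < q := by linarith
  have hbound : ∀ z : ℕ × ℕ, z ≠ (0, 1) → z ≠ (1, 0) →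
      ‖T z‖ ≤ ‖(Y : K) - X‖ * ‖β - α‖ * q⁻¹ := by
    rintro ⟨i, j⟩ h1 h2
    by_cases h00 : i + j = 0
    · obtain ⟨rfl, rfl⟩ : i = 0 ∧ j = 0 := by omega
      simp [hT]; positivity
    obtain ⟨n, hn⟩ : ∃ n, i + j = n + 2 := by
      have : i + j ≠ 1 := by
        intro h
        rcases i with _ | i
        · apply h1; simp; omega
        · apply h2; simp; omega
      exact ⟨i + j - 2, by omega⟩
    have A := sG_binom (K := K) X Y i j
    have B := sG_mon α β _ ha hb i j (n + 1) (by omega)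
    have F1 := hfac (i + 1)
    have F2 := hfac (j + 1)
    have hi : (i : K) + 1 ≠ 0 := Nat.cast_add_one_ne_zero i
    have hj : (j : K) + 1 ≠ 0 := Nat.cast_add_one_ne_zero j
    set U := (X.choose i : K) * Y.choose j - X.choose j * Y.choose i with hU
    set V := α ^ i * β ^ j - α ^ j * β ^ i with hV
    have e : (((i + 1).factorial : K) * (j + 1).factorial) * T (i, j)
        = (((i.factorial : K) * j.factorial) * U) * V := by
      simp only [hT, Nat.factorial_succ]
      push_cast
      field_simp
      rw [hU, hV]
    have e' := congrArg norm e
    rw [norm_mul, norm_mul, norm_mul _ V] at e'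
    have F3 : 1 ≤ (‖((i + 1).factorial : K)‖ * q ^ (i + 1)) * (‖((j + 1).factorial : K)‖ * q ^ (j + 1)) :=
      one_le_mul_of_one_le_of_one_le F1 F2
    calc ‖T (i, j)‖ ≤ ((‖((i + 1).factorial : K)‖ * q ^ (i + 1)) *
            (‖((j + 1).factorial : K)‖ * q ^ (j + 1))) * ‖T (i, j)‖ :=
          le_mul_of_one_le_left (norm_nonneg _) F3
      _ = (‖((i + 1).factorial : K)‖ * ‖((j + 1).factorial : K)‖ * ‖T (i, j)‖) * q ^ (n + 4) := by
          have : n + 4 = (i + 1) + (j + 1) := by omega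
          rw [this, pow_add]; ring
      _ = (‖((i.factorial : K) * j.factorial) * U‖ * ‖V‖) * q ^ (n + 4) := by rw [e']
      _ ≤ (‖(Y : K) - X‖ * (‖β - α‖ * ((q ^ 5)⁻¹) ^ (n + 1))) * q ^ (n + 4) := by gcongr
      _ = ‖(Y : K) - X‖ * ‖β - α‖ * (((q ^ 5)⁻¹) ^ (n + 1) * q ^ (n + 4)) := by ring
      _ ≤ ‖(Y : K) - X‖ * ‖β - α‖ * q⁻¹ := by
          gcongr
          rw [inv_pow, ← pow_mul, inv_mul_le_iff₀ (by positivity), ← div_eq_mul_inv,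
            le_div_iff₀ hq0, ← pow_succ]
          exact pow_le_pow_right₀ hq.le (by omega)
  have m1 : ((0, 1) : ℕ × ℕ) ∈ range M ×ˢ range M := by simp; omega
  have m2 : ((1, 0) : ℕ × ℕ) ∈ (range M ×ˢ range M).erase (0, 1) := by simp; omega
  rw [← add_sum_erase _ _ m1, ← add_sum_erase _ _ m2] at hsum
  have hS : ‖∑ z ∈ ((range M ×ˢ range M).erase (0, 1)).erase (1, 0), T z‖
      ≤ ‖(Y : K) - X‖ * ‖β - α‖ * q⁻¹ := by
    apply IsUltrametricDist.norm_sum_le_of_forall_le_of_nonneg (by positivity)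
    intro z hz
    simp only [mem_erase] at hz
    exact hbound z hz.2.1 hz.1
  have e3 : ∑ z ∈ ((range M ×ˢ range M).erase (0, 1)).erase (1, 0), T z
      = -(((Y : K) - X) * (β - α)) := by
    have : T (0, 1) + T (1, 0) = ((Y : K) - X) * (β - α) := by
      simp [hT]
      ring
    linear_combination hsum - this
  rw [e3, norm_neg, norm_mul] at hS
  have : q⁻¹ < 1 := inv_lt_one_of_one_lt₀ hq
  nlinarith

lemma sG_fac (p : ℕ) [hp : Fact p.Prime] (n : ℕ) :
    1 ≤ ‖(n.factorial : PadicAlgCl p)‖ * (p : ℝ) ^ n := by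
  have h1 : ‖(n.factorial : PadicAlgCl p)‖ = ‖(n.factorial : ℚ_[p])‖ := by
    rw [← PadicAlgCl.norm_extends, map_natCast]
  have hp1 : 1 < p := hp.1.one_lt
  have hv : padicValNat p n.factorial ≤ n := by
    have := sub_one_mul_padicValNat_factorial (p := p) n
    have h2 : 1 * padicValNat p n.factorial ≤ (p - 1) * padicValNat p n.factorial :=
      Nat.mul_le_mul_right _ (by omega)
    omega
  have hn : (n.factorial : ℚ_[p]) ≠ 0 := Nat.cast_ne_zero.mpr n.factorial_ne_zero
  have hp0 : (0 : ℝ) < p := by exact_mod_cast hp.1.pos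
  rw [h1, Padic.norm_eq_zpow_neg_valuation hn, Padic.valuation_natCast, zpow_neg, zpow_natCast,
    inv_mul_eq_div, one_le_div (by positivity)]
  exact pow_le_pow_right₀ (by exact_mod_cast hp1.le) hv

lemma sG_int_one (p : ℕ) [hp : Fact p.Prime] (D : ℤ) (h : ¬ (p : ℤ) ∣ D) :
    ‖(D : PadicAlgCl p)‖ = 1 := by
  have h1 : ‖(D : PadicAlgCl p)‖ = ‖(D : ℚ_[p])‖ := by
    rw [← PadicAlgCl.norm_extends, map_intCast]
  rw [h1]
  have := Padic.norm_intCast_lt_one_iff (p := p) (k := D)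
  have h2 := IsUltrametricDist.norm_intCast_le_one ℚ_[p] D
  exact le_antisymm h2 (not_lt.mp (fun h' => h (this.mp h')))

lemma sG_integral (K : Type*) [NormedField K] [IsUltrametricDist K] (z : K) (hz : IsIntegral ℤ z) :
    ‖z‖ ≤ 1 := by
  by_contra hlt
  push Not at hlt
  obtain ⟨f, hm, hf⟩ := hz
  rw [Polynomial.eval₂_eq_sum_range, Finset.sum_range_succ, hm.coeff_natDegree] at hf
  rcases Nat.eq_zero_or_pos f.natDegree with h0 | hpos
  · simp [h0] at hf
  obtain ⟨n, hn⟩ := Nat.exists_eq_succ_of_ne_zero hpos.ne'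
  have h2 : ‖∑ i ∈ Finset.range f.natDegree, (algebraMap ℤ K) (f.coeff i) * z ^ i‖ ≤ ‖z‖ ^ n := by
    apply IsUltrametricDist.norm_sum_le_of_forall_le_of_nonneg (by positivity)
    intro i hi
    rw [Finset.mem_range] at hi
    rw [norm_mul, norm_pow]
    calc _ ≤ 1 * ‖z‖ ^ i := by
          gcongr
          exact IsUltrametricDist.norm_intCast_le_one K _
      _ ≤ ‖z‖ ^ n := by
          rw [one_mul]
          exact pow_le_pow_right₀ hlt.le (by omega)
  have h3 : ∑ i ∈ Finset.range f.natDegree, (algebraMap ℤ K) (f.coeff i) * z ^ i = - z ^ (n + 1) := by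
    rw [hn] at hf ⊢
    simp at hf ⊢
    linear_combination hf
  rw [h3, norm_neg, norm_pow, pow_succ] at h2
  have : 0 < ‖z‖ ^ n := by positivity
  nlinarith

lemma sG_le_one {L : Type*} [Field L] [CharZero L] [Algebra ℚ L] (z : L) (hz : IsAlgebraic ℚ z) :
    ∃ D : ℤ, D ≠ 0 ∧ ∀ (p : ℕ) [Fact p.Prime] (σ : L →+* PadicAlgCl p), ¬ (p : ℤ) ∣ D →
      ‖σ z‖ ≤ 1 := by
  have hz' : IsAlgebraic ℤ z := (IsFractionRing.isAlgebraic_iff ℤ ℚ L).mpr hz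
  obtain ⟨D, hD, hi⟩ := hz'.exists_integral_multiple
  refine ⟨D, hD, fun p _ σ hp => ?_⟩
  have h1 : IsIntegral ℤ (σ (D • z)) := hi.map σ.toIntAlgHom
  have h2 := sG_integral _ _ h1
  rw [zsmul_eq_mul, map_mul, map_intCast, norm_mul, sG_int_one p D hp, one_mul] at h2
  exact h2

lemma sG_near_one (p : ℕ) [hp : Fact p.Prime] (z : PadicAlgCl p) (hz : ‖z‖ = 1) (ε : ℝ) (hε : 0 < ε) :
    ∃ N : ℕ, 0 < N ∧ ‖z ^ N - 1‖ ≤ ε := by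
  have hint : IsIntegral ℚ_[p] z := (Algebra.IsAlgebraic.isAlgebraic z).isIntegral
  let E : Submodule ℚ_[p] (PadicAlgCl p) := Subalgebra.toSubmodule (Algebra.adjoin ℚ_[p] {z})
  have : FiniteDimensional ℚ_[p] E :=
    Module.Finite.iff_fg.mpr hint.fg_adjoin_singleton
  have : ProperSpace E := FiniteDimensional.proper ℚ_[p] E
  let u : ℕ → E := fun n => ⟨z ^ n, Subalgebra.pow_mem _ (Algebra.self_mem_adjoin_singleton _ _) n⟩
  have hu : ∀ n, u n ∈ Metric.closedBall (0 : E) 1 := by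
    intro n
    rw [mem_closedBall_zero_iff]
    change ‖z ^ n‖ ≤ 1
    rw [norm_pow, hz, one_pow]
  obtain ⟨a, _, φ, hφ, hlim⟩ := (isCompact_closedBall (0 : E) 1).tendsto_subseq hu
  obtain ⟨n, hn⟩ := (Metric.cauchySeq_iff'.mp hlim.cauchySeq) ε hε
  have h1 := hn (n + 1) (by omega)
  have hlt : φ n < φ (n + 1) := hφ (by omega)
  refine ⟨φ (n + 1) - φ n, by omega, ?_⟩
  have h2 : ‖z ^ (φ (n + 1)) - z ^ (φ n)‖ < ε := by
    rw [dist_eq_norm] at h1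
    exact h1
  have h3 : z ^ (φ (n + 1)) - z ^ (φ n) = z ^ (φ n) * (z ^ (φ (n + 1) - φ n) - 1) := by
    rw [mul_sub, ← pow_add, mul_one]; congr 2; omega
  rw [h3, norm_mul, norm_pow, hz, one_pow, one_mul] at h2
  exact h2.le

lemma sG_pow_near {K : Type*} [NormedField K] [IsUltrametricDist K] (z : K) (hz : ‖z‖ = 1) (ε : ℝ)
    (N k : ℕ) (h : ‖z ^ N - 1‖ ≤ ε) : ‖z ^ (N * k) - 1‖ ≤ ε := by
  have h0 : 0 ≤ ε := (norm_nonneg _).trans h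
  rw [pow_mul, ← mul_geom_sum, norm_mul]
  refine (mul_le_of_le_one_right (norm_nonneg _) ?_).trans h
  apply IsUltrametricDist.norm_sum_le_of_forall_le_of_nonneg zero_le_one
  intro i _
  simp [hz]

lemma sG_alg (r : ℂ) (m : ℕ) (hm : 2 ≤ m) (h : 1 + r ^ m - (1 + r) ^ m = 0) : IsAlgebraic ℚ r := by
  refine ⟨1 + Polynomial.X ^ m - (1 + Polynomial.X) ^ m, ?_, by simpa using h⟩
  intro h0
  have := congrArg (Polynomial.eval 1) h0
  simp at this
  have h4 : (2 : ℚ) ^ 2 ≤ 2 ^ m := pow_le_pow_right₀ (by norm_num) hm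
  norm_num at this h4
  linarith

lemma sG_norm_one (z : ℂ) (a b : ℕ) (hab : a < b) (hz : z ≠ 0) (h : z ^ a = z ^ b) : ‖z‖ = 1 := by
  have h1 : z ^ (b - a) = 1 := by
    have : z ^ a * z ^ (b - a) = z ^ a * 1 := by
      rw [← pow_add, mul_one, h]; congr 1; omega
    exact mul_left_cancel₀ (pow_ne_zero _ hz) this
  exact Complex.norm_eq_one_of_pow_eq_one h1 (by omega)

lemma sG_omega (r : ℂ) (h1 : ‖r‖ = 1) (h2 : ‖1 + r‖ = 1) : r ^ 2 + r + 1 = 0 := by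
  have e1 : r * (starRingEnd ℂ) r = 1 := by rw [Complex.mul_conj']; simp [h1]
  have e2 : (1 + r) * (starRingEnd ℂ) (1 + r) = 1 := by rw [Complex.mul_conj']; simp [h2]
  rw [map_add, map_one] at e2
  linear_combination r * e2 - (1 + r) * e1

lemma sG_padic {L : Type*} [Field L] [CharZero L] [Algebra ℚ L] [Algebra.IsAlgebraic ℚ L] (ρ : L) (h0 : ρ ≠ 0)
    (h1 : 1 + ρ ≠ 0) : ∃ N : ℕ, 0 < N ∧ ∀ a x y : ℕ, 0 < x → x < y →
      1 + ρ ^ a = (1 + ρ) ^ a → 1 + ρ ^ (a + N * x) = (1 + ρ) ^ (a + N * x) →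
      1 + ρ ^ (a + N * y) = (1 + ρ) ^ (a + N * y) →
      ρ ^ N = 1 ∨ (1 + ρ) ^ N = 1 ∨ ρ ^ N = (1 + ρ) ^ N := by
  obtain ⟨D1, n1, H1⟩ := sG_le_one ρ (Algebra.IsAlgebraic.isAlgebraic ρ)
  obtain ⟨D2, n2, H2⟩ := sG_le_one ρ⁻¹ (Algebra.IsAlgebraic.isAlgebraic _)
  obtain ⟨D3, n3, H3⟩ := sG_le_one (1 + ρ) (Algebra.IsAlgebraic.isAlgebraic _)
  obtain ⟨D4, n4, H4⟩ := sG_le_one (1 + ρ)⁻¹ (Algebra.IsAlgebraic.isAlgebraic _)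
  obtain ⟨p, hpge, hp⟩ := Nat.exists_infinite_primes ((D1 * D2 * D3 * D4).natAbs + 1)
  have hDne : D1 * D2 * D3 * D4 ≠ 0 := by positivity
  have hnd : ¬ (p : ℤ) ∣ D1 * D2 * D3 * D4 := by
    intro h
    have := Nat.le_of_dvd (Int.natAbs_pos.mpr hDne) (Int.natCast_dvd.mp h)
    omega
  have : Fact p.Prime := ⟨hp⟩
  let σ : L →+* PadicAlgCl p := (IsAlgClosed.lift : L →ₐ[ℚ] PadicAlgCl p).toRingHom
  have hσ : Function.Injective σ := σ.injective
  have key : ∀ z : L, z ≠ 0 → ‖σ z‖ ≤ 1 → ‖σ z⁻¹‖ ≤ 1 → ‖σ z‖ = 1 := by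
    intro z hz ha hb
    have hpos : 0 < ‖σ z‖ := norm_pos_iff.mpr ((map_ne_zero σ).mpr hz)
    rw [map_inv₀, norm_inv] at hb
    exact le_antisymm ha ((inv_le_one₀ hpos).mp hb)
  have k1 : ‖σ ρ‖ = 1 := key ρ h0
    (H1 p σ fun h => hnd (((h.mul_right D2).mul_right D3).mul_right D4))
    (H2 p σ fun h => hnd (((h.mul_left D1).mul_right D3).mul_right D4))
  have k2 : ‖σ (1 + ρ)‖ = 1 := key (1 + ρ) h1
    (H3 p σ fun h => hnd ((h.mul_left (D1 * D2)).mul_right D4))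
    (H4 p σ fun h => hnd (h.mul_left (D1 * D2 * D3)))
  have hp1 : (1 : ℝ) < p := by exact_mod_cast hp.one_lt
  have hε : 0 < (((p : ℝ) ^ 5)⁻¹) := by positivity
  obtain ⟨N1, hN1, e1⟩ := sG_near_one p (σ ρ) k1 _ hε
  obtain ⟨N2, hN2, e2⟩ := sG_near_one p (σ (1 + ρ)) k2 _ hε
  refine ⟨N1 * N2, Nat.mul_pos hN1 hN2, ?_⟩
  have f1 := sG_pow_near _ k1 _ N1 N2 e1
  have f2 := sG_pow_near _ k2 _ N2 N1 e2
  rw [mul_comm N2 N1] at f2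
  generalize N1 * N2 = N at f1 f2
  intro a x y hx hxy z0 zx zy
  by_contra hcon
  push Not at hcon
  obtain ⟨c1, c2, c3⟩ := hcon
  obtain ⟨X, rfl⟩ := Nat.exists_eq_succ_of_ne_zero hx.ne'
  obtain ⟨Y, rfl⟩ := Nat.exists_eq_succ_of_ne_zero (show y ≠ 0 by omega)
  simp only [Nat.succ_eq_add_one] at *
  have := sG_key (p : ℝ) hp1 (sG_fac p) (σ ρ ^ N - 1) (σ (1 + ρ) ^ N - 1) f1 f2
    (by rw [← map_pow, sub_ne_zero, ← map_one σ]; exact fun h => c1 (hσ h))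
    (by rw [← map_pow, sub_ne_zero, ← map_one σ]; exact fun h => c2 (hσ h)) X Y (by omega) ?_
  · rw [sub_left_inj, ← map_pow, ← map_pow] at this
    exact c3 (hσ this)
  · have hL : ((ρ ^ N) ^ (X + 1) - 1) * (((1 + ρ) ^ N) ^ (Y + 1) - 1)
        = ((ρ ^ N) ^ (Y + 1) - 1) * (((1 + ρ) ^ N) ^ (X + 1) - 1) := by
      rw [pow_add, pow_add, pow_mul, pow_mul] at zx zy
      have hu : ρ ^ a * (1 + ρ) ^ a ≠ 0 := by positivity
      apply mul_left_cancel₀ hu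
      generalize ρ ^ a = u at *
      generalize (1 + ρ) ^ a = v at *
      generalize (ρ ^ N) ^ (X + 1) = AX at *
      generalize (ρ ^ N) ^ (Y + 1) = AY at *
      generalize ((1 + ρ) ^ N) ^ (X + 1) = BX at *
      generalize ((1 + ρ) ^ N) ^ (Y + 1) = BY at *
      have q1 : u * (AX - 1) = v * (BX - 1) := by linear_combination zx - z0
      have q2 : u * (AY - 1) = v * (BY - 1) := by linear_combination zy - z0
      linear_combination v * (BY - 1) * q1 - v * (BX - 1) * q2
    have := congrArg σ hL
    simp only [map_mul, map_sub, map_pow, map_one] at this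
    simpa only [add_sub_cancel] using this

lemma sG_class (S : Set ℕ) (hS : S.Infinite) (N : ℕ) (hN : 0 < N) :
    ∃ a x y : ℕ, 0 < x ∧ x < y ∧ a ∈ S ∧ a + N * x ∈ S ∧ a + N * y ∈ S := by
  obtain ⟨s, hs⟩ : ∃ s, {m | m ∈ S ∧ m % N = s}.Infinite := by
    by_contra hcon
    push Not at hcon
    apply hS
    apply ((Set.finite_lt_nat N).biUnion (fun s _ => hcon s)).subset
    intro m hm
    simp only [Set.mem_iUnion]
    exact ⟨m % N, Nat.mod_lt _ hN, hm, rfl⟩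
  obtain ⟨a, ha⟩ := hs.nonempty
  obtain ⟨b, hb, hab⟩ := hs.exists_gt a
  obtain ⟨c, hc, hbc⟩ := hs.exists_gt b
  obtain ⟨x, hx⟩ := (Nat.modEq_iff_dvd' hab.le).mp (ha.2.trans hb.2.symm)
  obtain ⟨y, hy⟩ := (Nat.modEq_iff_dvd' (hab.trans hbc).le).mp (ha.2.trans hc.2.symm)
  have hb' : b = a + N * x := by omega
  have hc' : c = a + N * y := by omega
  refine ⟨a, x, y, ?_, ?_, ha.1, hb' ▸ hb.1, hc' ▸ hc.1⟩
  · rcases Nat.eq_zero_or_pos x with rfl | h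
    · simp at hb'; omega
    · exact h
  · have : N * x < N * y := by omega
    exact lt_of_mul_lt_mul_left this (Nat.zero_le _)

/-- If `1 + r^m - (1+r)^m = 0` for infinitely many `m`, then `r = 0`, `r = -1`, or `r` is a
primitive third root of unity. -/
theorem scalar_G_infinitely_many_zeros (r : ℂ)
    (hinf : {m : ℕ | 1 + r ^ m - (1 + r) ^ m = 0}.Infinite) :
    r = 0 ∨ r = -1 ∨ r ^ 2 + r + 1 = 0 := by
  by_cases h0 : r = 0
  · exact Or.inl h0
  by_cases h1 : r = -1
  · exact Or.inr (Or.inl h1)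
  refine Or.inr (Or.inr ?_)
  have h1' : 1 + r ≠ 0 := fun h => h1 (by linear_combination h)
  obtain ⟨m, hm, hm1⟩ := hinf.exists_gt 1
  have halg : IsAlgebraic ℚ r := sG_alg r m hm1 hm
  let ρ : algebraicClosure ℚ ℂ := ⟨r, mem_algebraicClosure_iff.mpr halg⟩
  have hρ : (algebraMap (algebraicClosure ℚ ℂ) ℂ) ρ = r := rfl
  have hinj := (algebraMap (algebraicClosure ℚ ℂ) ℂ).injective
  have hz : ∀ k : ℕ, 1 + ρ ^ k = (1 + ρ) ^ k ↔ 1 + r ^ k = (1 + r) ^ k := by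
    intro k
    rw [← hinj.eq_iff]
    simp only [map_add, map_pow, map_one, hρ]
  have hLalg : Algebra.IsAlgebraic ℚ (algebraicClosure ℚ ℂ) := by
    have e : (DivisionRing.toRatAlgebra : Algebra ℚ (algebraicClosure ℚ ℂ))
        = (algebraicClosure ℚ ℂ).algebra' := Subsingleton.elim _ _
    rw [e]
    exact algebraicClosure.isAlgebraic ℚ ℂ
  obtain ⟨N, hN, H⟩ := sG_padic ρ
    (fun h => h0 (by rw [← hρ, h, map_zero]))
    (fun h => h1' (by rw [← hρ, ← map_one (algebraMap (algebraicClosure ℚ ℂ) ℂ), ← map_add, h, map_zero]))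
  obtain ⟨a, x, y, hx, hxy, ma, mx, my⟩ := sG_class _ hinf N hN
  have za := sub_eq_zero.mp ma
  have zx := sub_eq_zero.mp mx
  have zy := sub_eq_zero.mp my
  have hlt : a < a + N * x := Nat.lt_add_of_pos_right (Nat.mul_pos hN hx)
  have hcases : r ^ N = 1 ∨ (1 + r) ^ N = 1 ∨ r ^ N = (1 + r) ^ N := by
    have := H a x y hx hxy ((hz _).mpr za) ((hz _).mpr zx) ((hz _).mpr zy)
    rw [← hinj.eq_iff, ← hinj.eq_iff, ← hinj.eq_iff] at this
    simpa only [map_add, map_pow, map_one, hρ] using this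
  rcases hcases with h | h | h
  · apply sG_omega r (Complex.norm_eq_one_of_pow_eq_one h hN.ne')
    apply sG_norm_one (1 + r) a (a + N * x) hlt h1'
    rw [← za, ← zx, pow_add, pow_mul, h]; simp
  · refine sG_omega r ?_ (Complex.norm_eq_one_of_pow_eq_one h hN.ne')
    apply sG_norm_one r a (a + N * x) hlt h0
    have : (1 + r) ^ (a + N * x) = (1 + r) ^ a := by rw [pow_add, pow_mul, h]; simp
    linear_combination za - zx - this
  · rw [pow_add, pow_add, pow_mul, pow_mul, h] at zx
    have hw : ((1 + r) ^ N) ^ x = 1 := by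
      linear_combination ((1 + r) ^ N) ^ x * za - zx
    have hw' : (r ^ N) ^ x = 1 := by rw [h, hw]
    rw [← pow_mul] at hw hw'
    have hne : N * x ≠ 0 := (Nat.mul_pos hN hx).ne'
    exact sG_omega r (Complex.norm_eq_one_of_pow_eq_one hw' hne)
      (Complex.norm_eq_one_of_pow_eq_one hw hne)
end

section
/- Let P ∈ ℂ[y] be a nonconstant polynomial such that P divides the polynomial 1 + y^m - (1 + y)^m in ℂ[y] for infinitely many integers m > 1. Then P divides the polynomial y·(1+y)·(1+y+y²)² in ℂ[y]. -/
open Polynomial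

lemma aux_poly (j : ℕ) : ∃ q : Polynomial ℤ, ∀ k : ℕ,
    ((j + 1).factorial : ℤ) * (k.choose (j + 1) : ℤ) = k * q.eval (k : ℤ) := by
  refine ⟨(descPochhammer ℤ j).comp (X - 1), fun k => ?_⟩
  have h := descPochhammer_eval_eq_descFactorial ℤ k (j + 1)
  rw [Nat.descFactorial_eq_factorial_mul_choose, descPochhammer_succ_left] at h
  push_cast at h
  rw [← h]
  simp

section core
variable {K : Type*} [NormedField K] [IsUltrametricDist K]

lemma aux_coefA {C : ℝ} (hC : 1 ≤ C) (hfac : ∀ j : ℕ, 1 ≤ C ^ j * ‖((j.factorial : ℕ) : K)‖)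
    (k j : ℕ) : ‖((k.choose (j + 1) : ℕ) : K)‖ ≤ ‖(k : K)‖ * C ^ (j + 1) := by
  obtain ⟨q, hq⟩ := aux_poly j
  have h := congrArg (fun z : ℤ => ‖(z : K)‖) (hq k)
  simp only [Int.cast_mul, norm_mul, Int.cast_natCast] at h
  have h1 : ‖((q.eval (k : ℤ) : ℤ) : K)‖ ≤ 1 := IsUltrametricDist.norm_intCast_le_one K _
  have h2 := hfac (j + 1)
  have h3 : ‖(((j+1).factorial : ℕ) : K)‖ * ‖((k.choose (j + 1) : ℕ) : K)‖ ≤ ‖(k : K)‖ := by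
    rw [h]; exact mul_le_of_le_one_right (norm_nonneg _) h1
  have hCp : 0 ≤ C ^ (j + 1) := by positivity
  calc ‖((k.choose (j + 1) : ℕ) : K)‖ ≤ (C ^ (j+1) * ‖(((j+1).factorial : ℕ) : K)‖) * ‖((k.choose (j + 1) : ℕ) : K)‖ :=
        le_mul_of_one_le_left (norm_nonneg _) h2
    _ = C ^ (j+1) * (‖(((j+1).factorial : ℕ) : K)‖ * ‖((k.choose (j + 1) : ℕ) : K)‖) := by ring
    _ ≤ C ^ (j+1) * ‖(k : K)‖ := by gcongr
    _ = _ := by ring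

lemma aux_coefB {C : ℝ} (hC : 1 ≤ C) (hfac : ∀ j : ℕ, 1 ≤ C ^ j * ‖((j.factorial : ℕ) : K)‖)
    (k l j : ℕ) : ‖(k : K) * (l.choose (j + 1) : ℕ) - l * (k.choose (j + 1) : ℕ)‖
      ≤ ‖(k : K) * l * (l - k)‖ * C ^ (j + 1) := by
  obtain ⟨q, hq⟩ := aux_poly j
  obtain ⟨w, hw⟩ := Polynomial.sub_dvd_eval_sub (l : ℤ) (k : ℤ) q
  have h0 : ((j + 1).factorial : ℤ) * ((k : ℤ) * (l.choose (j + 1) : ℕ) - l * (k.choose (j + 1) : ℕ))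
      = k * l * (l - k) * w := by
    linear_combination (k : ℤ) * hq l - l * hq k + k * l * hw
  have h := congrArg (fun z : ℤ => ‖(z : K)‖) h0
  simp only [Int.cast_mul, Int.cast_sub, Int.cast_natCast] at h
  rw [norm_mul, norm_mul _ (w : K)] at h
  set T := (k : K) * (l.choose (j + 1) : ℕ) - l * (k.choose (j + 1) : ℕ)
  have h1 : ‖(w : K)‖ ≤ 1 := IsUltrametricDist.norm_intCast_le_one K _
  have h2 := hfac (j + 1)
  have h3 : ‖(((j+1).factorial : ℕ) : K)‖ * ‖T‖ ≤ ‖(k : K) * l * (l - k)‖ := by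
    rw [h]; exact mul_le_of_le_one_right (norm_nonneg _) h1
  have hCp : 0 ≤ C ^ (j + 1) := by positivity
  calc ‖T‖ ≤ (C ^ (j+1) * ‖(((j+1).factorial : ℕ) : K)‖) * ‖T‖ :=
        le_mul_of_one_le_left (norm_nonneg _) h2
    _ = C ^ (j+1) * (‖(((j+1).factorial : ℕ) : K)‖ * ‖T‖) := by ring
    _ ≤ C ^ (j+1) * ‖(k : K) * l * (l - k)‖ := by gcongr
    _ = _ := by ring

lemma aux_binom {R : Type*} [CommRing R] (e : R) (k N : ℕ) (h : k < N) :
    (1 + e) ^ k = ∑ j ∈ Finset.range N, ((k.choose j : ℕ) : R) * e ^ j := by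
  rw [add_comm, add_pow]
  refine (Finset.sum_subset_zero_on_sdiff (Finset.range_mono h) ?_ ?_)
  · intro x hx
    simp only [Finset.mem_sdiff, Finset.mem_range] at hx
    rw [Nat.choose_eq_zero_of_lt (by omega)]; simp
  · intro x hx; simp [mul_comm]

lemma aux_c {x y e d : K} {ρ μ : ℝ} (he : ‖e‖ ≤ ρ) (hd : ‖d‖ ≤ ρ)
    (h2 : ‖x * e ^ 2 - y * d ^ 2‖ ≤ μ) (h1 : ρ * ‖x * e ^ 1 - y * d ^ 1‖ ≤ μ) (j : ℕ) :
    ‖x * e ^ (j + 2) - y * d ^ (j + 2)‖ ≤ ρ ^ j * μ := by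
  have hρ : 0 ≤ ρ := (norm_nonneg _).trans he
  have hμ : 0 ≤ μ := (norm_nonneg _).trans h2
  have hed : ‖e + d‖ ≤ ρ := (IsUltrametricDist.norm_add_le_max _ _).trans (max_le he hd)
  have hed' : ‖e * d‖ ≤ ρ * ρ := by rw [norm_mul]; gcongr
  have hrec : ∀ i : ℕ, x * e ^ (i + 2) - y * d ^ (i + 2) =
      (e + d) * (x * e ^ (i + 1) - y * d ^ (i + 1)) + - (e * d * (x * e ^ i - y * d ^ i)) := by
    intro i; ring
  induction j using Nat.strong_induction_on with
  | _ j ih =>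
    match j, ih with
    | 0, _ => simpa using h2
    | 1, _ =>
      rw [hrec 1]
      refine (IsUltrametricDist.norm_add_le_max _ _).trans (max_le ?_ ?_)
      · rw [norm_mul, pow_one ρ]; gcongr
      · rw [norm_neg, norm_mul, pow_one ρ]
        calc _ ≤ ρ * ρ * ‖x * e ^ 1 - y * d ^ 1‖ := by gcongr
          _ = ρ * (ρ * ‖x * e ^ 1 - y * d ^ 1‖) := by ring
          _ ≤ _ := by gcongr
    | (n + 2), ih =>
      rw [hrec (n + 2)]
      have a1 := ih (n+1) (by omega)
      have a0 := ih n (by omega)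
      refine (IsUltrametricDist.norm_add_le_max _ _).trans (max_le ?_ ?_)
      · rw [norm_mul]
        calc _ ≤ ρ * (ρ ^ (n+1) * μ) := by gcongr
          _ = _ := by ring
      · rw [norm_neg, norm_mul]
        calc _ ≤ ρ * ρ * (ρ ^ n * μ) := by gcongr
          _ = _ := by ring

theorem core [CharZero K] {C ρ : ℝ} (hC : 1 ≤ C)
    (hfac : ∀ j : ℕ, 1 ≤ C ^ j * ‖((j.factorial : ℕ) : K)‖) (hρ : ρ * C ^ 3 < 1)
    {x y e d : K} (hx : x ≠ 0) (hy : y ≠ 0) (he : ‖e‖ ≤ ρ) (hd : ‖d‖ ≤ ρ)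
    {k l : ℕ} (hk : 0 < k) (hl : k < l) (z0 : 1 + x = y)
    (zk : 1 + x * (1 + e) ^ k = y * (1 + d) ^ k)
    (zl : 1 + x * (1 + e) ^ l = y * (1 + d) ^ l) : e = 0 ∧ d = 0 := by
  have hρ0 : 0 ≤ ρ := (norm_nonneg _).trans he
  set c : ℕ → K := fun j => x * e ^ j - y * d ^ j with hc
  have hsum : ∀ n, n ≤ l → 1 + x * (1 + e) ^ n = y * (1 + d) ^ n →
      (n : K) * c 1 + ((n.choose 2 : ℕ) : K) * c 2
        + ∑ i ∈ Finset.range l, ((n.choose (i + 3) : ℕ) : K) * c (i + 3) = 0 := by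
    intro n hn hz
    rw [aux_binom e n (l + 3) (by omega), aux_binom d n (l + 3) (by omega)] at hz
    have : 1 + ∑ j ∈ Finset.range (l + 3), ((n.choose j : ℕ) : K) * c j = 0 := by
      simp only [hc, mul_sub, Finset.sum_sub_distrib]
      rw [Finset.mul_sum, Finset.mul_sum] at hz
      rw [← add_sub_assoc, sub_eq_zero]
      convert hz using 2
      · exact Finset.sum_congr rfl fun _ _ => by ring
      · ring
    rw [Finset.sum_range_succ', Finset.sum_range_succ', Finset.sum_range_succ'] at this
    simp only [Nat.choose_zero_right, zero_add, Nat.choose_one_right] at this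
    have c0 : c 0 = -1 := by simp [hc]; linear_combination z0
    rw [c0] at this
    simp only [add_assoc, Nat.reduceAdd] at this
    push_cast at this
    linear_combination this
  have ek := hsum k hl.le zk
  have el := hsum l le_rfl zl
  have hk0 : 0 < ‖(k : K)‖ := norm_pos_iff.2 (by exact_mod_cast hk.ne')
  have hC0 : 0 < C := by linarith
  have hρC1 : ρ * C ≤ 1 := by
    refine le_trans ?_ hρ.le
    gcongr
    exact le_self_pow₀ hC (by norm_num)
  have hρC2 : ρ * C ^ 2 < 1 := by
    refine lt_of_le_of_lt ?_ hρ
    gcongr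
    norm_num
  set μ := max ‖c 2‖ (ρ * ‖c 1‖) with hμ
  have hμ0 : 0 ≤ μ := le_max_of_le_left (norm_nonneg _)
  have hcb : ∀ j, ‖c (j + 2)‖ ≤ ρ ^ j * μ := aux_c he hd (le_max_left _ _) (le_max_right _ _)
  -- first estimate
  have est1 : ‖c 1‖ ≤ C ^ 2 * μ := by
    have e1 : (k : K) * c 1 = - ∑ i ∈ Finset.range (l + 1), ((k.choose (i + 2) : ℕ) : K) * c (i + 2) := by
      rw [Finset.sum_range_succ']
      simp only [add_assoc, Nat.reduceAdd]
      linear_combination ek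
    have e2 : ‖(k : K) * c 1‖ ≤ ‖(k : K)‖ * (C ^ 2 * μ) := by
      rw [e1, norm_neg]
      refine IsUltrametricDist.norm_sum_le_of_forall_le_of_nonneg (by positivity) fun i _ => ?_
      rw [norm_mul]
      calc _ ≤ (‖(k : K)‖ * C ^ (i + 1 + 1)) * (ρ ^ i * μ) := by
            gcongr
            · exact aux_coefA hC hfac k (i + 1)
            · exact hcb i
        _ = ‖(k : K)‖ * (C ^ 2 * μ) * (ρ * C) ^ i := by ring
        _ ≤ _ := mul_le_of_le_one_right (by positivity) (pow_le_one₀ (by positivity) hρC1)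
    rw [norm_mul] at e2
    exact le_of_mul_le_mul_left e2 hk0
  have hμ2 : μ = ‖c 2‖ := by
    rcases max_choice ‖c 2‖ (ρ * ‖c 1‖) with h | h
    · rw [hμ, h]
    · have : μ ≤ ρ * C ^ 2 * μ := by
        rw [mul_assoc]
        calc μ = ρ * ‖c 1‖ := by rw [hμ, h]
          _ ≤ _ := by gcongr
      have hz : μ = 0 := by nlinarith
      have := le_max_left ‖c 2‖ (ρ * ‖c 1‖)
      rw [← hμ, hz] at this
      rw [hz]; exact le_antisymm (norm_nonneg _) this
  set N : K := (k : K) * l * (l - k) with hN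
  have hN0 : 0 < ‖N‖ := by
    refine norm_pos_iff.2 (mul_ne_zero (mul_ne_zero ?_ ?_) ?_)
    · exact_mod_cast hk.ne'
    · exact_mod_cast (by omega : l ≠ 0)
    · rw [sub_ne_zero]; exact_mod_cast hl.ne'
  have est2 : ‖N * c 2‖ ≤ ‖N‖ * (ρ * C ^ 3 * μ) := by
    have hch : ∀ n : ℕ, (2 : K) * ((n.choose 2 : ℕ) : K) = n * (n - 1) := by
      intro n
      rw [Nat.cast_choose_two]; field_simp
    have e1 : N * c 2 = - (2 * ∑ i ∈ Finset.range l,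
        ((k : K) * ((l.choose (i + 3) : ℕ) : K) - l * ((k.choose (i + 3) : ℕ) : K)) * c (i + 3)) := by
      simp only [sub_mul, Finset.sum_sub_distrib, mul_assoc, ← Finset.mul_sum]
      linear_combination 2 * (k : K) * el - 2 * (l : K) * ek - k * c 2 * hch l + l * c 2 * hch k
    rw [e1, norm_neg, norm_mul]
    have h2 : ‖(2 : K)‖ ≤ 1 := by exact_mod_cast IsUltrametricDist.norm_natCast_le_one K 2
    refine (mul_le_of_le_one_left (norm_nonneg _) h2).trans ?_
    refine IsUltrametricDist.norm_sum_le_of_forall_le_of_nonneg (by positivity) fun i _ => ?_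
    rw [norm_mul]
    calc _ ≤ (‖N‖ * C ^ (i + 2 + 1)) * (ρ ^ (i + 1) * μ) := by
          gcongr
          · exact aux_coefB hC hfac k l (i + 2)
          · exact hcb (i + 1)
      _ = ‖N‖ * (ρ * C ^ 3 * μ) * (ρ * C) ^ i := by ring
      _ ≤ _ := mul_le_of_le_one_right (by positivity) (pow_le_one₀ (by positivity) hρC1)
  rw [norm_mul] at est2
  have est3 := le_of_mul_le_mul_left est2 hN0
  rw [← hμ2] at est3
  have hz : μ = 0 := by nlinarith
  have c2 : c 2 = 0 := norm_eq_zero.1 (hμ2 ▸ hz)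
  have c1 : c 1 = 0 := by
    rw [hz, mul_zero] at est1
    exact norm_eq_zero.1 (le_antisymm est1 (norm_nonneg _))
  simp only [hc, pow_one] at c1 c2
  have hed : x * e * (e - d) = 0 := by linear_combination c2 - d * c1
  by_cases he0 : e = 0
  · refine ⟨he0, ?_⟩
    rw [he0] at c1
    simpa [hy] using c1
  · exfalso
    have : e = d := by
      simpa [hx, he0, sub_eq_zero] using hed
    subst this
    have : x = y := by
      have : (x - y) * e = 0 := by linear_combination c1
      simpa [he0, sub_eq_zero] using this
    subst this
    simp at z0
end core
section units
variable {K : Type*} [NormedField K] [IsUltrametricDist K]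

lemma aux_expand {r : K} (hr : ‖r‖ ≤ 1) (m : ℕ) :
    ∃ w : K, ‖w‖ ≤ 1 ∧ (1 + r) ^ m = 1 + m * r + r ^ 2 * w := by
  induction m with
  | zero => exact ⟨0, by simp, by simp⟩
  | succ m ih =>
    obtain ⟨w, hw, h⟩ := ih
    refine ⟨m + (1 + r) * w, ?_, by rw [pow_succ, h]; push_cast; ring⟩
    refine (IsUltrametricDist.norm_add_le_max _ _).trans (max_le (IsUltrametricDist.norm_natCast_le_one K m) ?_)
    rw [norm_mul]
    refine mul_le_one₀ ?_ (norm_nonneg _) hw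
    exact (IsUltrametricDist.norm_add_le_max _ _).trans (max_le (by simp) hr)

lemma aux_small {r : K} {m : ℕ} (hm : 1 < m) (hmn : ‖(m : K)‖ = 1) (hr0 : r ≠ 0) (hr : ‖r‖ < 1)
    (h : 1 + r ^ m = (1 + r) ^ m) : False := by
  obtain ⟨w, hw, hw'⟩ := aux_expand hr.le m
  obtain ⟨n, rfl⟩ := Nat.exists_eq_add_of_le' hm
  have h1 : (n + 2 : ℕ) = r * (r ^ n - w) := by
    refine mul_left_cancel₀ hr0 ?_
    linear_combination -h - hw'
  rw [h1, norm_mul] at hmn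
  have : ‖r ^ n - w‖ ≤ 1 := by
    rw [sub_eq_add_neg]
    refine (IsUltrametricDist.norm_add_le_max _ _).trans (max_le ?_ (by rwa [norm_neg]))
    rw [norm_pow]; exact pow_le_one₀ (norm_nonneg _) hr.le
  nlinarith [norm_nonneg r, norm_nonneg (r ^ n - w)]

lemma aux_unit1 {r : K} {m : ℕ} (hm : 1 < m) (hmn : ‖(m : K)‖ = 1) (hr0 : r ≠ 0)
    (h : 1 + r ^ m = (1 + r) ^ m) : ‖r‖ = 1 := by
  rcases lt_trichotomy ‖r‖ 1 with h1 | h1 | h1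
  · exact (aux_small hm hmn hr0 h1 h).elim
  · exact h1
  · refine (aux_small (r := r⁻¹) hm hmn (inv_ne_zero hr0) ?_ ?_).elim
    · rw [norm_inv]; exact inv_lt_one_of_one_lt₀ h1
    · have : (1 + r⁻¹) = (1 + r) * r⁻¹ := by field_simp; ring
      rw [this, mul_pow, ← h]
      rw [add_mul, one_mul, ← mul_pow, mul_inv_cancel₀ hr0, one_pow, add_comm]

lemma aux_unit2 {r : K} {m : ℕ} (hm : 1 < m) (hmn : ‖(m : K)‖ = 1) (h2 : ‖(2 : K)‖ = 1)
    (hr0 : r ≠ 0) (hs0 : 1 + r ≠ 0)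
    (h : 1 + r ^ m = (1 + r) ^ m) : ‖1 + r‖ = 1 := by
  have hr := aux_unit1 hm hmn hr0 h
  refine le_antisymm ((IsUltrametricDist.norm_add_le_max _ _).trans (max_le (by simp) hr.le)) ?_
  by_contra! hs
  set s := 1 + r with hsd
  have hrs : r = - (1 + -s) := by rw [hsd]; ring
  rcases Nat.even_or_odd m with he | ho
  · obtain ⟨w, hw, hw'⟩ := aux_expand (r := -s) (by rw [norm_neg]; exact hs.le) m
    rw [hrs, he.neg_pow, hw'] at h
    obtain ⟨n, rfl⟩ := Nat.exists_eq_add_of_le' hm.le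
    have e : (2 : K) = s * (s ^ n + ((n + 1 : ℕ) : K) + - (s * w)) := by linear_combination h
    rw [e, norm_mul] at h2
    have : ‖s ^ n + ((n + 1 : ℕ) : K) + - (s * w)‖ ≤ 1 := by
      refine (IsUltrametricDist.norm_add_le_max _ _).trans (max_le 
        ((IsUltrametricDist.norm_add_le_max _ _).trans (max_le ?_ ?_)) ?_)
      · rw [norm_pow]; exact pow_le_one₀ (norm_nonneg _) hs.le
      · exact IsUltrametricDist.norm_natCast_le_one K _
      · rw [norm_neg, norm_mul]; exact mul_le_one₀ hs.le (norm_nonneg _) hw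
    nlinarith [norm_nonneg s]
  · refine aux_small (r := -s) hm hmn (neg_ne_zero.2 hs0) (by rwa [norm_neg]) ?_
    rw [hrs, ho.neg_pow] at h
    rw [ho.neg_pow]
    linear_combination h
end units

section padic
variable (p : ℕ) [Fact p.Prime]

lemma aux_natnorm (n : ℕ) : ‖(n : PadicAlgCl p)‖ = ‖(n : ℚ_[p])‖ := by
  rw [← PadicAlgCl.norm_extends]; simp

lemma aux_fac (j : ℕ) : 1 ≤ (p : ℝ) ^ j * ‖((j.factorial : ℕ) : PadicAlgCl p)‖ := by
  have hp : 1 < (p : ℝ) := by exact_mod_cast (Fact.out : p.Prime).one_lt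
  rw [aux_natnorm, Padic.norm_eq_zpow_neg_valuation (by exact_mod_cast j.factorial_ne_zero),
    Padic.valuation_natCast, zpow_neg, zpow_natCast]
  have h := sub_one_mul_padicValNat_factorial (p := p) j
  have h2 : padicValNat p j.factorial ≤ j := by
    have : 1 ≤ p - 1 := by have := (Fact.out : p.Prime).two_le; omega
    calc _ ≤ (p - 1) * padicValNat p j.factorial := Nat.le_mul_of_pos_left _ this
      _ ≤ j := by omega
  rw [← div_eq_mul_inv, one_le_div (by positivity)]
  exact pow_le_pow_right₀ hp.le h2

lemma aux_order {r s : PadicAlgCl p} (hr : ‖r‖ = 1) (hs : ‖s‖ = 1) {η : ℝ} (hη : 0 < η) :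
    ∃ M : ℕ, 0 < M ∧ ‖r ^ M - 1‖ ≤ η ∧ ‖s ^ M - 1‖ ≤ η := by
  let E := IntermediateField.adjoin ℚ_[p] ({r, s} : Set (PadicAlgCl p))
  have hrE : r ∈ E := IntermediateField.subset_adjoin _ _ (by simp)
  have hsE : s ∈ E := IntermediateField.subset_adjoin _ _ (by simp)
  have : FiniteDimensional ℚ_[p] E :=
    IntermediateField.finiteDimensional_adjoin (fun x _ => Algebra.IsIntegral.isIntegral x)
  let V : Submodule ℚ_[p] (PadicAlgCl p) := Subalgebra.toSubmodule E.toSubalgebra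
  have : FiniteDimensional ℚ_[p] V := this
  have : ProperSpace V := FiniteDimensional.proper ℚ_[p] V
  let u : ℕ → V × V := fun n => (⟨r ^ n, pow_mem hrE n⟩, ⟨s ^ n, pow_mem hsE n⟩)
  obtain ⟨a, _, φ, hφ, hlim⟩ := tendsto_subseq_of_bounded (x := u)
    (Metric.isBounded_closedBall (x := (0 : V × V)) (r := 1)) (by
      intro n
      rw [mem_closedBall_zero_iff, Prod.norm_def]
      refine max_le ?_ ?_
      · change ‖r ^ n‖ ≤ 1; simp [hr]
      · change ‖s ^ n‖ ≤ 1; simp [hs])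
  obtain ⟨N, hN⟩ := Metric.cauchySeq_iff'.1 hlim.cauchySeq η hη
  have h := (hN (N + 1) (by omega)).le
  have hlt : φ N < φ (N + 1) := hφ (Nat.lt_succ_self N)
  rw [dist_eq_norm, Prod.norm_def] at h
  have h1 : ‖r ^ φ (N+1) - r ^ φ N‖ ≤ η := (le_max_left _ _).trans h
  have h2 : ‖s ^ φ (N+1) - s ^ φ N‖ ≤ η := (le_max_right _ _).trans h
  obtain ⟨M, hM⟩ := Nat.exists_eq_add_of_lt hlt
  rw [show φ N + M + 1 = φ N + (M + 1) by ring] at hM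
  refine ⟨M + 1, by omega, ?_, ?_⟩
  · rw [hM, pow_add, ← mul_sub_one, norm_mul, norm_pow, hr, one_pow, one_mul] at h1
    exact h1
  · rw [hM, pow_add, ← mul_sub_one, norm_mul, norm_pow, hs, one_pow, one_mul] at h2
    exact h2

lemma aux_three {S : Set ℕ} (hS : S.Infinite) {M : ℕ} (hM : 0 < M) :
    ∃ a k l : ℕ, 0 < k ∧ k < l ∧ a ∈ S ∧ a + M * k ∈ S ∧ a + M * l ∈ S := by
  have : NeZero M := ⟨hM.ne'⟩
  have := hS.to_subtype
  obtain ⟨c, hc⟩ := Finite.exists_infinite_fiber (fun a : S => (⟨a.1 % M, Nat.mod_lt _ hM⟩ : Fin M))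
  have hT : {a | a ∈ S ∧ a % M = c.1}.Infinite := by
    rw [Set.infinite_coe_iff] at hc
    refine (hc.image (f := Subtype.val) Subtype.val_injective.injOn).mono ?_
    rintro _ ⟨a, ha, rfl⟩
    exact ⟨a.2, congrArg Fin.val ha⟩
  obtain ⟨a, ha, hac⟩ := hT.nonempty
  obtain ⟨b, ⟨hb, hbc⟩, hab⟩ := hT.exists_gt a
  obtain ⟨d, ⟨hd, hdc⟩, hbd⟩ := hT.exists_gt b
  obtain ⟨k, hk⟩ := (Nat.modEq_iff_dvd' hab.le).1 (hac.trans hbc.symm)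
  obtain ⟨l, hl⟩ := (Nat.modEq_iff_dvd' (hab.trans hbd).le).1 (hac.trans hdc.symm)
  refine ⟨a, k, l, ?_, ?_, ha, ?_, ?_⟩
  · rcases Nat.eq_zero_or_pos k with rfl | h
    · omega
    · exact h
  · refine lt_of_mul_lt_mul_left (a := M) ?_ (Nat.zero_le _)
    omega
  · rwa [← hk, Nat.add_sub_cancel' hab.le]
  · rwa [← hl, Nat.add_sub_cancel' (hab.trans hbd).le]

lemma aux_rootunity {r : PadicAlgCl p} {S : Set ℕ} (hS : S.Infinite)
    (h : ∀ m ∈ S, 1 + r ^ m = (1 + r) ^ m) (hr : ‖r‖ = 1) (hs : ‖1 + r‖ = 1) :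
    ∃ M : ℕ, 0 < M ∧ r ^ M = 1 ∧ (1 + r) ^ M = 1 := by
  have hp : 1 < (p : ℝ) := by exact_mod_cast (Fact.out : p.Prime).one_lt
  have hp0 : 0 < (p : ℝ) := by linarith
  obtain ⟨M, hM, h1, h2⟩ := aux_order p hr hs (η := ((p : ℝ) ^ 4)⁻¹) (by positivity)
  obtain ⟨a, k, l, hk, hl, ha, hak, hal⟩ := aux_three hS hM
  have hr0 : r ≠ 0 := by rintro rfl; simp at hr
  have hs0 : 1 + r ≠ 0 := by intro h; simp [h] at hs
  have := core (K := PadicAlgCl p) hp.le (aux_fac p) (ρ := ((p : ℝ) ^ 4)⁻¹) (by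
      rw [inv_mul_eq_div, div_lt_one (by positivity)]
      exact pow_lt_pow_right₀ hp (by norm_num)) (pow_ne_zero a hr0) (pow_ne_zero a hs0) h1 h2 hk hl
    (h _ ha) (by
      have := h _ hak
      rw [pow_add, pow_mul, pow_add (1 + r), pow_mul (1 + r)] at this
      simpa using this) (by
      have := h _ hal
      rw [pow_add, pow_mul, pow_add (1 + r), pow_mul (1 + r)] at this
      simpa using this)
  exact ⟨M, hM, sub_eq_zero.1 this.1, sub_eq_zero.1 this.2⟩
end padic

lemma aux_alg {r : ℂ} {m : ℕ} (hm : 1 < m) (h : 1 + r ^ m = (1 + r) ^ m) : IsAlgebraic ℚ r := by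
  refine ⟨1 + X ^ m - (1 + X) ^ m, ?_, by simp [h]⟩
  intro h0
  have := congrArg (fun q : ℚ[X] => q.derivative.eval 0) h0
  simp [derivative_pow] at this
  have h3 : (0 : ℚ) ^ (m - 1) = 0 := zero_pow (by omega)
  rw [h3] at this
  simp at this
  omega

lemma aux_root {r : ℂ} {S : Set ℕ} (hS : S.Infinite) (hS1 : ∀ m ∈ S, 1 < m)
    (h : ∀ m ∈ S, 1 + r ^ m = (1 + r) ^ m) (hr0 : r ≠ 0) (hs0 : 1 + r ≠ 0) :
    1 + r + r ^ 2 = 0 := by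
  obtain ⟨m, hm⟩ := hS.nonempty
  have hm1 := hS1 m hm
  have halg := aux_alg hm1 (h m hm)
  obtain ⟨p, hpm, hp⟩ := Nat.exists_infinite_primes (2 * m)
  have : Fact p.Prime := ⟨hp⟩
  let F := IntermediateField.adjoin ℚ ({r} : Set ℂ)
  have : Algebra.IsAlgebraic ℚ F := by
    have := IntermediateField.adjoin.finiteDimensional halg.isIntegral
    infer_instance
  let φ : F →ₐ[ℚ] PadicAlgCl p := IsAlgClosed.lift
  let g : F := IntermediateField.AdjoinSimple.gen ℚ r
  have hg : algebraMap F ℂ g = r := IntermediateField.AdjoinSimple.algebraMap_gen ℚ r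
  have hg' : (g : ℂ) = r := hg
  have hinj : Function.Injective (algebraMap F ℂ) := (algebraMap F ℂ).injective
  have hgm : ∀ m ∈ S, 1 + g ^ m = (1 + g) ^ m := by
    intro m hm
    apply hinj
    simpa [hg'] using h m hm
  have hpm' : ∀ m ∈ S, 1 + (φ g) ^ m = (1 + φ g) ^ m := by
    intro m hm
    simpa using congrArg φ (hgm m hm)
  have hq0 : φ g ≠ 0 := by
    intro h0
    apply hr0
    have : g = 0 := φ.injective (by simpa using h0)
    rw [← hg, this, map_zero]
  have hq1 : 1 + φ g ≠ 0 := by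
    intro h0
    apply hs0
    have : 1 + g = 0 := φ.injective (by simpa using h0)
    have := congrArg (algebraMap F ℂ) this
    simpa [hg'] using this
  have hnm : ∀ n : ℕ, 0 < n → n < p → ‖(n : PadicAlgCl p)‖ = 1 := by
    intro n hn hnp
    rw [aux_natnorm, Padic.norm_natCast_eq_one_iff]
    exact (Nat.Prime.coprime_iff_not_dvd hp).2 (Nat.not_dvd_of_pos_of_lt hn hnp)
  have n1 := aux_unit1 hm1 (hnm m (by omega) (by omega)) hq0 (hpm' m hm)
  have n2 := aux_unit2 hm1 (hnm m (by omega) (by omega)) (by exact_mod_cast hnm 2 (by omega) (by omega))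
    hq0 hq1 (hpm' m hm)
  obtain ⟨M, hM, e1, e2⟩ := aux_rootunity p hS hpm' n1 n2
  have f1 : r ^ M = 1 := by
    have : g ^ M = 1 := φ.injective (by simpa using e1)
    simpa [hg'] using congrArg (algebraMap F ℂ) this
  have f2 : (1 + r) ^ M = 1 := by
    have : (1 + g) ^ M = 1 := φ.injective (by simpa using e2)
    simpa [hg'] using congrArg (algebraMap F ℂ) this
  have a1 : ‖r‖ = 1 := by
    have := congrArg norm f1
    rw [norm_pow, norm_one] at this
    exact (pow_eq_one_iff_of_nonneg (norm_nonneg _) hM.ne').1 this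
  have a2 : ‖1 + r‖ = 1 := by
    have := congrArg norm f2
    rw [norm_pow, norm_one] at this
    exact (pow_eq_one_iff_of_nonneg (norm_nonneg _) hM.ne').1 this
  have b1 : r.re ^ 2 + r.im ^ 2 = 1 := by
    have := Complex.sq_norm r
    rw [a1, Complex.normSq_apply] at this; nlinarith
  have b2 : (1 + r.re) ^ 2 + r.im ^ 2 = 1 := by
    have := Complex.sq_norm (1 + r)
    rw [a2, Complex.normSq_apply] at this
    simp at this; nlinarith
  have b3 : r.re = -1/2 := by nlinarith
  apply Complex.ext
  · simp [pow_two]; nlinarith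
  · simp [pow_two]; rw [b3]; ring

lemma aux_mult2 {r : ℂ} {m : ℕ} (hm : 1 < m) (hr0 : r ≠ 0)
    (h : (X - C r) ^ 3 ∣ (1 + X ^ m - (1 + X) ^ m : ℂ[X])) : 1 + r = 0 := by
  obtain ⟨n, rfl⟩ := Nat.exists_eq_add_of_le' hm
  obtain ⟨Q, hQ⟩ := h
  have h1 := congrArg (fun q : ℂ[X] => q.derivative.eval r) hQ
  have h2 := congrArg (fun q : ℂ[X] => q.derivative.derivative.eval r) hQ
  simp [derivative_pow] at h1 h2
  have k2 : (n : ℂ) + 2 ≠ 0 := by exact_mod_cast (by omega : n + 2 ≠ 0)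
  have k1 : (n : ℂ) + 1 ≠ 0 := by exact_mod_cast (by omega : n + 1 ≠ 0)
  have e : ((n : ℂ) + 2) * (n + 1) * r ^ n = 0 := by
    linear_combination (1 + r) * h2 - (n + 1) * h1
  exact absurd e (mul_ne_zero (mul_ne_zero k2 k1) (pow_ne_zero n hr0))

lemma aux_mult1 {r : ℂ} {m : ℕ} (hm : 1 < m) (hr : r = 0 ∨ 1 + r = 0)
    (h : (X - C r) ^ 2 ∣ (1 + X ^ m - (1 + X) ^ m : ℂ[X])) : False := by
  obtain ⟨n, rfl⟩ := Nat.exists_eq_add_of_le' hm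
  obtain ⟨Q, hQ⟩ := h
  have h1 := congrArg (fun q : ℂ[X] => q.derivative.eval r) hQ
  simp [derivative_pow] at h1
  have k2 : (n : ℂ) + 2 ≠ 0 := by exact_mod_cast (by omega : n + 2 ≠ 0)
  rcases hr with hr | hr
  · simp [hr] at h1
    exact k2 (by linear_combination -h1)
  · have hr' : r = -1 := by linear_combination hr
    rw [hr, hr'] at h1
    simp [k2] at h1

/-- A nonconstant polynomial dividing `1 + y^m - (1+y)^m` for infinitely many `m > 1`
divides `y (1+y) (1+y+y²)²`. -/
theorem divisors_of_scalar_G (P : Polynomial ℂ) (hP : 0 < P.natDegree)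
    (hinf : {m : ℕ | 1 < m ∧ P ∣ (1 + X ^ m - (1 + X) ^ m)}.Infinite) :
    P ∣ X * (1 + X) * (1 + X + X ^ 2) ^ 2 := by
  have hP0 : P ≠ 0 := by rintro rfl; simp at hP
  have hT0 : (X * (1 + X) * (1 + X + X ^ 2) ^ 2 : ℂ[X]) ≠ 0 := by
    intro h
    have := congrArg (eval 1) h
    norm_num at this
  rw [IsAlgClosed.dvd_iff_roots_le_roots hP0 hT0, Multiset.le_iff_count]
  intro r
  rw [count_roots, count_roots, le_rootMultiplicity_iff hT0]
  have hd : (X - C r) ^ rootMultiplicity r P ∣ P := pow_rootMultiplicity_dvd P r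
  obtain ⟨m, hm1, hm⟩ := hinf.nonempty
  by_cases h0 : rootMultiplicity r P = 0
  · rw [h0]; simp
  by_cases hr : r = 0 ∨ 1 + r = 0
  · have hle : rootMultiplicity r P ≤ 1 := by
      by_contra! hlt
      exact aux_mult1 hm1 hr (((pow_dvd_pow _ hlt).trans hd).trans hm)
    refine (pow_dvd_pow _ hle).trans ?_
    rw [pow_one, dvd_iff_isRoot]
    rcases hr with hr | hr <;> simp [hr]
  · rw [not_or] at hr
    have hle : rootMultiplicity r P ≤ 2 := by
      by_contra! hlt
      exact hr.2 (aux_mult2 hm1 hr.1 (((pow_dvd_pow _ hlt).trans hd).trans hm))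
    refine (pow_dvd_pow _ hle).trans (Dvd.dvd.mul_left (pow_dvd_pow_of_dvd ?_ 2) _)
    have hrP : IsRoot P r := (rootMultiplicity_pos hP0).1 (Nat.pos_of_ne_zero h0)
    rw [dvd_iff_isRoot]
    have := aux_root (r := r) hinf (fun m hm => hm.1) (fun m hm => by
      have := hrP.dvd hm.2
      simpa [sub_eq_zero] using this) hr.1 hr.2
    simpa using this
end
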